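/- Under the normalized setup with the quadratic asymptotic expansion, define u^λ(x,t) := λ^{−2}u(λx, λ²t) for λ > 0 and Q(x,t) := −τt + ½xᵀAx. Then u^λ → Q uniformly on compact subsets of ℝ^{n+1}_− as λ → ∞; moreover, for every α′ ∈ (0,1) there is a sequence λ_j → ∞ such that D_x u^{λ_j} → D_x Q in the parabolic Hölder space C^{α′,α′/2} on every compact subset of ℝ^{n+1}_−. -/

import Mathlib

open Set MeasureTheory

noncomputable section

abbrev En (n : ℕ) : Type := EuclideanSpace ℝ (Fin n)

namespace PMA

variable {n : ℕ}

/-- The lower half-space `ℝⁿ × (−∞,0]`. -/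
def halfSpace (n : ℕ) : Set (En n × ℝ) := univ ×ˢ Iic (0:ℝ)

/-- The time derivative `u_t`. -/
def timeDeriv (u : En n → ℝ → ℝ) (x : En n) (t : ℝ) : ℝ := deriv (u x) t

/-- The spatial gradient `D_x u`. -/
def spaceGrad (u : En n → ℝ → ℝ) (x : En n) (t : ℝ) : En n := gradient (fun y => u y t) x

/-- The spatial Hessian `D_x² u`, as an `n × n` matrix. -/
def spaceHess (u : En n → ℝ → ℝ) (x : En n) (t : ℝ) : Matrix (Fin n) (Fin n) ℝ :=
  fun i j => iteratedFDeriv ℝ 2 (fun y => u y t) x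
    ![EuclideanSpace.single i 1, EuclideanSpace.single j 1]

/-- A function is parabolically convex on `D` if it is convex in `x` and nonincreasing in `t`. -/
def ParabolicallyConvexOn (D : Set (En n × ℝ)) (u : En n → ℝ → ℝ) : Prop :=
  (∀ t : ℝ, ConvexOn ℝ {x | (x, t) ∈ D} (fun x => u x t)) ∧
  (∀ x : En n, ∀ s t : ℝ, s ≤ t → (x, s) ∈ D → (x, t) ∈ D → u x t ≤ u x s)

/-- The time slice `D(t)`. -/
def slice (D : Set (En n × ℝ)) (t : ℝ) : Set (En n) := {x | (x, t) ∈ D}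

/-- Bowl-shaped domain. -/
def IsBowlShaped (D : Set (En n × ℝ)) : Prop :=
  D ⊆ halfSpace n ∧ (∀ t, Convex ℝ (slice D t)) ∧
  ∀ t₁ t₂ : ℝ, t₁ ≤ t₂ → (slice D t₂).Nonempty → slice D t₁ ⊆ slice D t₂

/-- The parabolic boundary `∂_p D`. -/
def parabolicBoundary (D : Set (En n × ℝ)) : Set (En n × ℝ) :=
  (closure (slice D (sInf {t | (slice D t).Nonempty})) ×ˢ
      ({sInf {t | (slice D t).Nonempty}} : Set ℝ)) ∪
  ⋃ t ∈ Iic (0:ℝ), frontier (slice D t) ×ˢ ({t} : Set ℝ)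

/-- Parabolic distance between two points. -/
def pdist (X Y : En n × ℝ) : ℝ := Real.sqrt (‖X.1 - Y.1‖^2 + |X.2 - Y.2|)

/-- Parabolic distance from a point to a set. -/
def pdistSet (Z : En n × ℝ) (S : Set (En n × ℝ)) : ℝ := sInf (pdist Z '' S)

/-- `C^{2k,k}` regularity on a set: all mixed derivatives `D_x^i D_t^j u` with `i + 2j ≤ 2k`
exist and are continuous. -/
def IsC2kOn (k : ℕ) (u : En n → ℝ → ℝ) (D : Set (En n × ℝ)) : Prop :=
  ∀ i j : ℕ, i + 2*j ≤ 2*k →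
    (∀ p ∈ D, ContDiffAt ℝ i (fun y => iteratedDeriv j (u y) p.2) p.1 ∧
      ContDiffAt ℝ j (u p.1) p.2) ∧
    ContinuousOn
      (fun p : En n × ℝ => iteratedFDeriv ℝ i (fun y => iteratedDeriv j (u y) p.2) p.1) D

/-- A matrix acting on `ℝⁿ`. -/
def mApply (M : Matrix (Fin n) (Fin n) ℝ) (x : En n) : En n :=
  (WithLp.equiv 2 (Fin n → ℝ)).symm (M.mulVec (WithLp.equiv 2 (Fin n → ℝ) x))

/-- The quadratic form `xᵀ A x`. -/
def quadForm (A : Matrix (Fin n) (Fin n) ℝ) (x : En n) : ℝ := ∑ i, ∑ j, A i j * x i * x j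

/-- The dot product `b · x` on `ℝⁿ`. -/
def dotp (b x : En n) : ℝ := ∑ i, b i * x i

/-- Second-order difference quotient `Δ_e² u`. -/
def sdq (u : En n → ℝ → ℝ) (e : En n) (x : En n) (t : ℝ) : ℝ :=
  (u (x + e) t + u (x - e) t - 2 * u x t) / ‖e‖^2

end PMA

namespace PMA

set_option linter.unusedSectionVars false

section LinearAlgebra

variable {E : Type*} [NormedAddCommGroup E] [InnerProductSpace ℝ E] [FiniteDimensional ℝ E]

/-- Symmetric endomorphisms of a real inner product space. -/
def SymmOp (T : E →L[ℝ] E) : Prop := ∀ x y : E, inner ℝ (T x) y = inner ℝ x (T y)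

/-- A symmetric positive definite operator has a symmetric invertible square root. -/
theorem exists_sqrt (T : E →L[ℝ] E) (hs : SymmOp T) (hp : ∀ x, x ≠ 0 → 0 < inner ℝ (T x) x) :
    ∃ B : E ≃L[ℝ] E, SymmOp (B : E →L[ℝ] E) ∧ (∀ x, B (B x) = T x) := by
  have hS : (T : E →ₗ[ℝ] E).IsSymmetric := fun x y => hs x y
  set d := Module.finrank ℝ E with hd
  let b := hS.eigenvectorBasis hd.symm
  let l := hS.eigenvalues hd.symm
  have hb : ∀ i, T (b i) = l i • b i := fun i =>
    hS.apply_eigenvectorBasis hd.symm i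
  have hl : ∀ i, 0 < l i := fun i => by
    have h := hp (b i) (b.orthonormal.ne_zero i)
    rw [hb, real_inner_smul_left, real_inner_self_eq_norm_sq, b.orthonormal.1 i] at h
    simpa using h
  let B₀ : E →ₗ[ℝ] E := b.toBasis.constr ℝ (fun i => Real.sqrt (l i) • b i)
  have hB₀ : ∀ i, B₀ (b i) = Real.sqrt (l i) • b i := fun i => by
    have := b.toBasis.constr_basis ℝ (fun i => Real.sqrt (l i) • b i) i
    rwa [OrthonormalBasis.coe_toBasis] at this
  have hBB : ∀ x, B₀ (B₀ x) = T x := by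
    intro x
    have : B₀ ∘ₗ B₀ = (T : E →ₗ[ℝ] E) := by
      apply b.toBasis.ext
      intro i
      simp only [OrthonormalBasis.coe_toBasis, LinearMap.comp_apply, hB₀, map_smul, smul_smul,
        Real.mul_self_sqrt (hl i).le]
      exact (hb i).symm
    exact congrArg (fun f => f x) this
  have hinj : Function.Injective B₀ := by
    rw [← LinearMap.ker_eq_bot, LinearMap.ker_eq_bot']
    intro x hx
    by_contra h
    have := hp x h
    rw [← hBB, hx, map_zero, inner_zero_left] at this
    exact lt_irrefl _ this
  let B := (LinearEquiv.ofInjectiveEndo B₀ hinj).toContinuousLinearEquiv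
  have hB : ∀ x, B x = B₀ x := fun x => rfl
  refine ⟨B, ?_, fun x => by rw [hB, hB, hBB]⟩
  intro x y
  change inner ℝ (B₀ x) y = inner ℝ x (B₀ y)
  rw [← b.sum_repr x, ← b.sum_repr y]
  simp only [map_sum, map_smul, hB₀, sum_inner, inner_sum, real_inner_smul_left,
    real_inner_smul_right]
  refine Finset.sum_congr rfl fun i _ => Finset.sum_congr rfl fun j _ => ?_
  by_cases h : i = j
  · subst h; ring
  · rw [orthonormal_iff_ite.mp b.orthonormal j i, if_neg (Ne.symm h)]; simp

theorem SymmOp.inv {B : E ≃L[ℝ] E} (h : SymmOp (B : E →L[ℝ] E)) :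
    SymmOp (B.symm : E →L[ℝ] E) := by
  intro x y
  have := h (B.symm x) (B.symm y)
  simp only [ContinuousLinearEquiv.coe_coe, ContinuousLinearEquiv.apply_symm_apply] at this ⊢
  exact this.symm

/-- Simultaneous diagonalization of a positive definite and a symmetric operator. -/
theorem exists_simul_diag (T G : E →L[ℝ] E) (hs : SymmOp T)
    (hp : ∀ x, x ≠ 0 → 0 < inner ℝ (T x) x) (hG : SymmOp G) :
    ∃ (b : Module.Basis (Fin (Module.finrank ℝ E)) ℝ E) (μ : Fin (Module.finrank ℝ E) → ℝ),
      ∀ i, G (b i) = μ i • T (b i) := by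
  obtain ⟨B, hB, hBB⟩ := exists_sqrt T hs hp
  let C : E →L[ℝ] E := (B.symm : E →L[ℝ] E) ∘L G ∘L (B.symm : E →L[ℝ] E)
  have hC : (C : E →ₗ[ℝ] E).IsSymmetric := by
    intro x y
    change inner ℝ (B.symm (G (B.symm x))) y = inner ℝ x (B.symm (G (B.symm y)))
    have h1 := hB.inv (G (B.symm x)) y
    have h2 := hB.inv x (G (B.symm y))
    simp only [ContinuousLinearEquiv.coe_coe] at h1 h2
    rw [h1, ← h2, hG]
  refine ⟨(hC.eigenvectorBasis rfl).toBasis.map B.symm.toLinearEquiv, hC.eigenvalues rfl,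
    fun i => ?_⟩
  have h := hC.apply_eigenvectorBasis rfl i
  have h' : B.symm (G (B.symm (hC.eigenvectorBasis rfl i))) =
      hC.eigenvalues rfl i • hC.eigenvectorBasis rfl i := h
  simp only [Module.Basis.map_apply, OrthonormalBasis.coe_toBasis]
  change G (B.symm _) = _ • T (B.symm _)
  rw [← hBB, B.apply_symm_apply, ← map_smul, ← h', B.apply_symm_apply]

theorem det_of_diag (T X : E →L[ℝ] E) {ι : Type*} [Fintype ι] [DecidableEq ι]
    (b : Module.Basis ι ℝ E) (ν : ι → ℝ) (h : ∀ i, X (b i) = ν i • T (b i)) :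
    X.det = T.det * ∏ i, ν i := by
  let D : E →ₗ[ℝ] E := Matrix.toLin b b (Matrix.diagonal ν)
  have hX : (X : E →ₗ[ℝ] E) = (T : E →ₗ[ℝ] E) ∘ₗ D := by
    apply b.ext
    intro i
    simp [D, Matrix.toLin_self, h, Matrix.diagonal_apply]
  change LinearMap.det (X : E →ₗ[ℝ] E) = LinearMap.det (T : E →ₗ[ℝ] E) * _
  rw [hX, LinearMap.det_comp]
  simp [D, LinearMap.det_toLin, Matrix.det_diagonal]

theorem prod_le_pow_of_sum_le {ι : Type*} [Fintype ι] [Nonempty ι] (z : ι → ℝ)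
    (hz : ∀ i, 0 ≤ z i) {a : ℝ} (h : ∑ i, z i ≤ Fintype.card ι * a) :
    ∏ i, z i ≤ a ^ Fintype.card ι := by
  have hN : (0:ℝ) < Fintype.card ι := by exact_mod_cast Fintype.card_pos
  have key := Real.geom_mean_le_arith_mean_weighted Finset.univ
    (fun _ : ι => (Fintype.card ι : ℝ)⁻¹) z (fun _ _ => by positivity)
    (by simp [Finset.card_univ, hN.ne']) (fun i _ => hz i)
  rw [← Finset.mul_sum, Real.finsetProd_rpow _ _ (fun i _ => hz i)] at key
  have h2 : (∏ i, z i) ^ ((Fintype.card ι : ℝ)⁻¹) ≤ a := by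
    refine key.trans ?_
    rw [inv_mul_le_iff₀ hN]; exact h
  have h0 : 0 ≤ ∏ i, z i := Finset.prod_nonneg fun i _ => hz i
  calc ∏ i, z i = ((∏ i, z i) ^ ((Fintype.card ι : ℝ)⁻¹)) ^ Fintype.card ι := by
        rw [← Real.rpow_natCast, ← Real.rpow_mul h0, inv_mul_cancel₀ hN.ne', Real.rpow_one]
    _ ≤ a ^ Fintype.card ι := pow_le_pow_left₀ (Real.rpow_nonneg h0 _) h2 _

theorem prod_le_of_prod_ge {ι : Type*} [Fintype ι] [Nonempty ι] (μ : ι → ℝ) (κ q : ℝ)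
    (hκ : 0 < κ) (hq1 : q ≤ 1) (hμ : ∀ i, 0 ≤ μ i)
    (hx : ∀ i, 0 < (1 + κ) - κ * μ i) (hprod : q ≤ ∏ i, ((1 + κ) - κ * μ i)) :
    ∏ i, μ i ≤ (1 + (1 - q) / κ) ^ Fintype.card ι := by
  have hN : (0:ℝ) < Fintype.card ι := by exact_mod_cast Fintype.card_pos
  apply prod_le_pow_of_sum_le _ hμ
  have hsum : (Fintype.card ι : ℝ) * q ≤ ∑ i, ((1 + κ) - κ * μ i) := by
    by_contra hlt
    push Not at hlt
    obtain ⟨r, hr1, hr2⟩ : ∃ r, ∑ i, ((1 + κ) - κ * μ i) = Fintype.card ι * r ∧ r < q := by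
      refine ⟨(∑ i, ((1 + κ) - κ * μ i)) / Fintype.card ι, by field_simp, ?_⟩
      rw [div_lt_iff₀ hN]; linarith
    have hr0 : 0 ≤ r := by
      have : 0 ≤ ∑ i, ((1 + κ) - κ * μ i) := Finset.sum_nonneg fun i _ => (hx i).le
      rw [hr1] at this
      exact nonneg_of_mul_nonneg_right this hN
    have := prod_le_pow_of_sum_le _ (fun i => (hx i).le) hr1.le
    have h3 : r ^ Fintype.card ι ≤ r :=
      pow_le_of_le_one hr0 (by linarith) Fintype.card_ne_zero
    linarith
  rw [Finset.sum_sub_distrib, ← Finset.mul_sum] at hsum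
  simp only [Finset.sum_const, Finset.card_univ, nsmul_eq_mul] at hsum
  have : κ * ∑ i, μ i ≤ κ * (Fintype.card ι * (1 + (1 - q) / κ)) := by
    have : κ * (Fintype.card ι * (1 + (1 - q) / κ)) = Fintype.card ι * (κ + (1 - q)) := by
      field_simp
    rw [this]; linarith
  exact le_of_mul_le_mul_left this hκ

/-- Concavity of the (parabolic) Monge-Ampère operator along an extrapolation segment. -/
theorem det_extrapolation_le (T G : E →L[ℝ] E) (hs : SymmOp T)
    (hp : ∀ x, x ≠ 0 → 0 < inner ℝ (T x) x) (hG : SymmOp G) (hG0 : ∀ x, 0 ≤ inner ℝ (G x) x)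
    (κ q wt wg : ℝ) (hκ : 0 < κ) (hq1 : q ≤ 1) (hwt : 0 < wt) (hwg : 0 ≤ wg)
    (hU : ∀ x, x ≠ 0 → 0 < inner ℝ (((1 + κ) • T - κ • G) x) x)
    (hwu : 0 < (1 + κ) * wt - κ * wg)
    (hdet : q * (wt * T.det) ≤ ((1 + κ) * wt - κ * wg) * ((1 + κ) • T - κ • G).det) :
    0 < T.det ∧ 0 ≤ G.det ∧
      wg * G.det ≤ wt * T.det * (1 + (1 - q) / κ) ^ (Module.finrank ℝ E + 1) := by
  obtain ⟨b, μ, hb⟩ := exists_simul_diag T G hs hp hG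
  have hTb : ∀ i, 0 < inner ℝ (T (b i)) (b i) := fun i => hp _ (b.ne_zero i)
  have hTdet : 0 < T.det := by
    obtain ⟨B, -, hBB⟩ := exists_sqrt T hs hp
    have h1 : (T : E →ₗ[ℝ] E) = (B : E →ₗ[ℝ] E) ∘ₗ (B : E →ₗ[ℝ] E) := by
      ext x; exact (hBB x).symm
    change 0 < LinearMap.det (T : E →ₗ[ℝ] E)
    rw [h1, LinearMap.det_comp]
    have : LinearMap.det (B : E →ₗ[ℝ] E) ≠ 0 :=
      (LinearEquiv.isUnit_det' B.toLinearEquiv).ne_zero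
    exact mul_self_pos.mpr this
  have hμ : ∀ i, 0 ≤ μ i := fun i => by
    have h := hG0 (b i)
    rw [hb, real_inner_smul_left] at h
    exact nonneg_of_mul_nonneg_left h (hTb i)
  have hUb : ∀ i, ((1 + κ) • T - κ • G) (b i) = ((1 + κ) - κ * μ i) • T (b i) := fun i => by
    simp only [sub_apply, smul_apply, hb, smul_smul,
      sub_smul]
  have hx : ∀ i, 0 < (1 + κ) - κ * μ i := fun i => by
    have h := hU (b i) (b.ne_zero i)
    rw [hUb, real_inner_smul_left] at h
    exact pos_of_mul_pos_left h (hTb i).le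
  have hGd := det_of_diag T G b μ hb
  have hUd := det_of_diag T _ b _ hUb
  refine ⟨hTdet, by rw [hGd]; exact mul_nonneg hTdet.le (Finset.prod_nonneg fun i _ => hμ i), ?_⟩
  rw [hUd] at hdet
  let ν : Option (Fin (Module.finrank ℝ E)) → ℝ := fun o => o.elim (wg / wt) μ
  have h := prod_le_of_prod_ge ν κ q hκ hq1
    (by rintro (_ | i)
        · exact div_nonneg hwg hwt.le
        · exact hμ i)
    (by rintro (_ | i)
        · have : (1 + κ) - κ * (wg / wt) = ((1 + κ) * wt - κ * wg) / wt := by field_simp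
          simp only [ν, Option.elim]
          rw [this]; positivity
        · exact hx i)
    (by
      rw [Fintype.prod_option]
      simp only [ν, Option.elim]
      have : (1 + κ) - κ * (wg / wt) = ((1 + κ) * wt - κ * wg) / wt := by field_simp
      rw [this, div_mul_eq_mul_div, le_div_iff₀ hwt]
      refine le_of_mul_le_mul_left ?_ hTdet
      calc _ = q * (wt * T.det) := by ring
        _ ≤ _ := hdet
        _ = _ := by ring)
  rw [Fintype.prod_option] at h
  simp only [ν, Option.elim, Fintype.card_option, Fintype.card_fin] at h
  rw [hGd]
  calc wg * (T.det * ∏ i, μ i) = wt * T.det * (wg / wt * ∏ i, μ i) := by field_simp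
    _ ≤ _ := mul_le_mul_of_nonneg_left h (by positivity)

end LinearAlgebra

section ABP

variable {E : Type*} [NormedAddCommGroup E] [InnerProductSpace ℝ E] [FiniteDimensional ℝ E]
  [MeasurableSpace E] [BorelSpace E]

/-- The determinant of a block operator on `E × ℝ`. -/
theorem det_block (H : E →L[ℝ] E) (b c : E) (r : ℝ) (L : E × ℝ →L[ℝ] E × ℝ)
    (hL : ∀ z, L z = (H z.1 + z.2 • b, inner ℝ c (H z.1 + z.2 • b) + r * z.2)) :
    L.det = r * H.det := by
  let f₁ : Module.Dual ℝ (E × ℝ) := LinearMap.snd ℝ E ℝ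
  let f₂ : Module.Dual ℝ (E × ℝ) := ((innerSL ℝ c : E →L[ℝ] ℝ) : E →ₗ[ℝ] ℝ) ∘ₗ LinearMap.fst ℝ E ℝ
  have h : (L : E × ℝ →ₗ[ℝ] E × ℝ) = LinearMap.transvection f₂ ((0 : E), (1 : ℝ)) ∘ₗ
      (LinearMap.prodMap LinearMap.id (r • LinearMap.id)) ∘ₗ
      LinearMap.transvection f₁ (b, (0 : ℝ)) ∘ₗ
      (LinearMap.prodMap (H : E →ₗ[ℝ] E) LinearMap.id) := by
    refine LinearMap.ext fun z => ?_
    change L z = _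
    rw [hL]
    simp [f₁, f₂, LinearMap.transvection.apply, add_comm]
  change LinearMap.det (L : E × ℝ →ₗ[ℝ] E × ℝ) = _
  rw [h, LinearMap.det_comp, LinearMap.det_comp, LinearMap.det_comp, LinearMap.det_prodMap,
    LinearMap.det_prodMap, LinearMap.transvection.det, LinearMap.transvection.det]
  simp [f₁, f₂]

/-- At an interior minimum the second derivative is nonnegative. -/
theorem hess_nonneg_of_isLocalMin {f : E → ℝ} {p : E → E} {H : E →L[ℝ] E} {x : E}
    (hf : ∀ y, HasGradientAt f (p y) y) (hp : HasFDerivAt p H x) (hmin : IsLocalMin f x) :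
    p x = 0 ∧ ∀ v, 0 ≤ inner ℝ (H v) v := by
  have hp0 : p x = 0 := by
    have h := hmin.hasFDerivAt_eq_zero (hf x).hasFDerivAt
    simpa using h
  refine ⟨hp0, fun v => ?_⟩
  by_contra hneg
  push Not at hneg
  let φ : ℝ → ℝ := fun r => f (x + r • v)
  have hline : ∀ r : ℝ, HasDerivAt (fun r : ℝ => x + r • v) v r := fun r => by
    simpa using ((hasDerivAt_id r).smul_const v).const_add x
  have hφ : ∀ r, HasDerivAt φ (inner ℝ (p (x + r • v)) v) r := fun r => by
    have := (hf (x + r • v)).hasFDerivAt.comp_hasDerivAt r (hline r)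
    rw [InnerProductSpace.toDual_apply_apply] at this
    exact this
  have hφ' : HasDerivAt (fun r : ℝ => inner ℝ (p (x + r • v)) v) (inner ℝ (H v) v) 0 := by
    have hp' : HasFDerivAt p H (x + (0:ℝ) • v) := by simpa using hp
    have := (hp'.comp_hasDerivAt (0:ℝ) (hline 0)).inner ℝ (hasDerivAt_const (0:ℝ) v)
    simpa using this
  have hdφ : deriv φ = fun r => inner ℝ (p (x + r • v)) v := funext fun r => (hφ r).deriv
  have hd0 : deriv φ 0 = 0 := by rw [hdφ]; simp [hp0]
  have hdd : deriv (deriv φ) 0 < 0 := by rw [hdφ, hφ'.deriv]; exact hneg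
  have hev := eventually_nhdsWithin_sign_eq_of_deriv_neg hdd hd0
  -- strictly decreasing to the right of zero
  have hev' : ∀ᶠ r in nhdsWithin (0:ℝ) (Ioi 0), deriv φ r < 0 := by
    have h2 : nhdsWithin (0:ℝ) (Ioi 0) ≤ nhds 0 := nhdsWithin_le_nhds
    filter_upwards [h2 hev, self_mem_nhdsWithin] with r hr hr0
    have hr0' : (0:ℝ) < r := hr0
    have : SignType.sign (deriv φ r) = -1 := by
      rw [hr]; simp [hr0']
    exact sign_eq_neg_one_iff.mp this
  obtain ⟨c, hc, hcI⟩ := (mem_nhdsGT_iff_exists_Ioo_subset).mp hev'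
  have hmin' : ∀ᶠ r in nhds (0:ℝ), φ 0 ≤ φ r := by
    have hcont : ContinuousAt (fun r : ℝ => x + r • v) 0 := (hline 0).continuousAt
    have hm : ∀ᶠ y in nhds (x + (0:ℝ) • v), f x ≤ f y := by
      rw [zero_smul, add_zero]; exact hmin
    have := hcont.tendsto.eventually hm
    simpa [φ] using this
  obtain ⟨e, he, heI⟩ := Metric.eventually_nhds_iff.mp hmin'
  have hc' : (0:ℝ) < c := hc
  set r := min (c / 2) (e / 2) with hr
  have hr0 : 0 < r := by positivity
  have hrc : r < c := (min_le_left _ _).trans_lt (by linarith)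
  have hre : r < e := (min_le_right _ _).trans_lt (by linarith)
  have hanti : StrictAntiOn φ (Icc 0 r) := by
    apply strictAntiOn_of_deriv_neg (convex_Icc 0 r)
    · exact fun r _ => (hφ r).continuousAt.continuousWithinAt
    · intro s hs
      rw [interior_Icc] at hs
      exact hcI ⟨hs.1, hs.2.trans hrc⟩
  have h1 := hanti (left_mem_Icc.mpr hr0.le) (right_mem_Icc.mpr hr0.le) hr0
  have h2 := @heI r (by rw [Real.dist_eq, sub_zero, abs_of_pos hr0]; exact hre)
  linarith

/-- Linear interpolation. -/
def interp {V : Type*} [AddCommGroup V] [Module ℝ V] (a b : V) (θ : ℝ) : V :=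
  (1 - θ) • a + θ • b

/-- The map sending a contact point to the parameters of the tangent plane, for the function
interpolating linearly in time between `g₀` (at time `r`) and `g₁` (at time `r + δ`). -/
def slabMap (g₀ g₁ : E → ℝ) (p₀ p₁ : E → E) (r δ : ℝ) (z : E × ℝ) : E × ℝ :=
  let P := interp (p₀ z.1) (p₁ z.1) ((z.2 - r) / δ)
  (P, inner ℝ z.1 P - interp (g₀ z.1) (g₁ z.1) ((z.2 - r) / δ) - ‖P‖ ^ 2 / 2)

theorem hasFDerivAt_slabMap {g₀ g₁ : E → ℝ} {p₀ p₁ : E → E} {H₀ H₁ : E → E →L[ℝ] E}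
    (hg₀ : ∀ x, HasGradientAt g₀ (p₀ x) x) (hg₁ : ∀ x, HasGradientAt g₁ (p₁ x) x)
    (hp₀ : ∀ x, HasFDerivAt p₀ (H₀ x) x) (hp₁ : ∀ x, HasFDerivAt p₁ (H₁ x) x)
    (r δ : ℝ) (z : E × ℝ) :
    ∃ L : E × ℝ →L[ℝ] E × ℝ, HasFDerivAt (slabMap g₀ g₁ p₀ p₁ r δ) L z ∧
      L.det = ((g₀ z.1 - g₁ z.1) / δ) * (interp (H₀ z.1) (H₁ z.1) ((z.2 - r) / δ)).det := by
  set θ := (z.2 - r) / δ with hθ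
  set P := interp (p₀ z.1) (p₁ z.1) θ with hP
  have dθ : HasFDerivAt (fun z : E × ℝ => (z.2 - r) / δ)
      (δ⁻¹ • ContinuousLinearMap.snd ℝ E ℝ) z := by
    have := ((hasFDerivAt_snd (𝕜 := ℝ) (p := z)).sub_const r).const_smul δ⁻¹
    refine this.congr_of_eventuallyEq (Filter.Eventually.of_forall fun y => ?_)
    simp [div_eq_inv_mul]
  have d1 : HasFDerivAt (fun z : E × ℝ => z.1) (ContinuousLinearMap.fst ℝ E ℝ) z :=
    hasFDerivAt_fst
  have dp₀ : HasFDerivAt (fun z : E × ℝ => p₀ z.1) ((H₀ z.1) ∘L ContinuousLinearMap.fst ℝ E ℝ) z :=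
    (hp₀ z.1).comp z d1
  have dp₁ : HasFDerivAt (fun z : E × ℝ => p₁ z.1) ((H₁ z.1) ∘L ContinuousLinearMap.fst ℝ E ℝ) z :=
    (hp₁ z.1).comp z d1
  have dg₀ := (hg₀ z.1).hasFDerivAt.comp z d1
  have dg₁ := (hg₁ z.1).hasFDerivAt.comp z d1
  have dP := ((dθ.const_sub 1).smul dp₀).add (dθ.smul dp₁)
  have dG := ((dθ.const_sub 1).mul dg₀).add (dθ.mul dg₁)
  have dN := dP.norm_sq
  have dI := d1.inner ℝ dP
  have dS := (dI.sub dG).sub (dN.const_mul (1 / 2 : ℝ))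
  have dΨ := dP.prodMk dS
  refine ⟨_, dΨ.congr_of_eventuallyEq (Filter.Eventually.of_forall fun y => ?_), ?_⟩
  · simp only [slabMap, interp]
    refine Prod.ext rfl ?_
    simp [div_eq_inv_mul]
  · refine det_block _ (δ⁻¹ • (p₁ z.1 - p₀ z.1)) (z.1 - P) _ _ fun y => ?_
    refine Prod.ext ?_ ?_
    · simp only [interp, ← hθ]
      simp
      module
    · simp only [interp, ← hθ, hP]
      simp [inner_add_left, inner_add_right, inner_sub_left, inner_sub_right,
        real_inner_smul_left, real_inner_smul_right, smul_sub]
      simp only [real_inner_comm (p₀ z.1) y.1, real_inner_comm (p₁ z.1) y.1]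
      ring

end ABP

section Sol

variable {E : Type*} [NormedAddCommGroup E] [InnerProductSpace ℝ E] [FiniteDimensional ℝ E]
  [MeasurableSpace E] [BorelSpace E]

/-- Classical solutions of `-u_t det D²u = F(x)` in `E × (-∞,0)`, with spatial gradient `p`,
spatial Hessian `H` and `w = -u_t`. -/
structure Sol (F : E → ℝ) (u : E → ℝ → ℝ) (p : E → ℝ → E) (H : E → ℝ → E →L[ℝ] E)
    (w : E → ℝ → ℝ) : Prop where
  cont_u : ContinuousOn (fun z : E × ℝ => u z.1 z.2) (univ ×ˢ Iio 0)
  cont_p : ContinuousOn (fun z : E × ℝ => p z.1 z.2) (univ ×ˢ Iio 0)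
  cont_H : ContinuousOn (fun z : E × ℝ => H z.1 z.2) (univ ×ˢ Iio 0)
  cont_w : ContinuousOn (fun z : E × ℝ => w z.1 z.2) (univ ×ˢ Iio 0)
  grad : ∀ t < 0, ∀ x, HasGradientAt (fun y => u y t) (p x t) x
  hess : ∀ t < 0, ∀ x, HasFDerivAt (fun y => p y t) (H x t) x
  tder : ∀ t < 0, ∀ x, HasDerivAt (u x) (-(w x t)) t
  symm : ∀ t < 0, ∀ x, SymmOp (H x t)
  pos : ∀ t < 0, ∀ x v, v ≠ 0 → 0 < inner ℝ (H x t v) v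
  wpos : ∀ t < 0, ∀ x, 0 < w x t
  eq : ∀ t < 0, ∀ x, w x t * (H x t).det = F x

variable {F : E → ℝ} {u ũ : E → ℝ → ℝ} {p pt : E → ℝ → E} {H Ht : E → ℝ → E →L[ℝ] E}
  {w wt : E → ℝ → ℝ}

theorem det_pos_of_pos {T : E →L[ℝ] E} (hs : SymmOp T)
    (hp : ∀ x, x ≠ 0 → 0 < inner ℝ (T x) x) : 0 < T.det := by
  obtain ⟨B, -, hBB⟩ := exists_sqrt T hs hp
  have h1 : (T : E →ₗ[ℝ] E) = (B : E →ₗ[ℝ] E) ∘ₗ (B : E →ₗ[ℝ] E) := by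
    ext x; exact (hBB x).symm
  change 0 < LinearMap.det (T : E →ₗ[ℝ] E)
  rw [h1, LinearMap.det_comp]
  have : LinearMap.det (B : E →ₗ[ℝ] E) ≠ 0 :=
    (LinearEquiv.isUnit_det' B.toLinearEquiv).ne_zero
  exact mul_self_pos.mpr this

theorem Sol.F_pos (h : Sol F u p H w) (x : E) : 0 < F x := by
  rw [← h.eq (-1) (by norm_num) x]
  exact mul_pos (h.wpos _ (by norm_num) x) (det_pos_of_pos (h.symm _ (by norm_num) x)
    (h.pos _ (by norm_num) x))

theorem continuous_slice {X : Type*} [TopologicalSpace X] {f : E → ℝ → X}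
    (hf : ContinuousOn (fun z : E × ℝ => f z.1 z.2) (univ ×ˢ Iio 0)) {t : ℝ} (ht : t < 0) :
    Continuous fun x => f x t := by
  rw [← continuousOn_univ]
  exact hf.comp (f := fun x : E => (x, t)) (by fun_prop) (fun x _ => ⟨mem_univ _, ht⟩)

theorem Sol.cont_F (h : Sol F u p H w) : Continuous F := by
  have h1 : F = fun x => w x (-1) * (H x (-1)).det :=
    funext fun x => (h.eq (-1) (by norm_num) x).symm
  rw [h1]
  exact (continuous_slice h.cont_w (by norm_num)).mul
    (ContinuousLinearMap.continuous_det.comp (continuous_slice h.cont_H (by norm_num)))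

theorem Sol.unif (h : Sol F u p H w) (R t₀ t₁ : ℝ) (ht₁ : t₁ < 0) {η : ℝ} (hη : 0 < η) :
    ∃ δ > 0, ∀ x ∈ Metric.closedBall (0:E) R, ∀ t ∈ Icc t₀ t₁, ∀ t' ∈ Icc t₀ t₁,
      ∀ t'' ∈ Icc t₀ t₁, ∀ θ ∈ Icc (0:ℝ) 1, |t' - t| < δ → |t'' - t| < δ →
      |w x t'' * (interp (H x t) (H x t') θ).det - F x| ≤ η * F x := by
  let K : Set (E × ℝ × ℝ × ℝ × ℝ) := Metric.closedBall (0:E) R ×ˢ Icc t₀ t₁ ×ˢ Icc t₀ t₁ ×ˢ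
    Icc t₀ t₁ ×ˢ Icc (0:ℝ) 1
  have hK : IsCompact K := (isCompact_closedBall 0 R).prod (isCompact_Icc.prod (isCompact_Icc.prod
    (isCompact_Icc.prod isCompact_Icc)))
  let Θ : E × ℝ × ℝ × ℝ × ℝ → ℝ := fun z =>
    w z.1 z.2.2.2.1 * (interp (H z.1 z.2.1) (H z.1 z.2.2.1) z.2.2.2.2).det
  have hlt : ∀ {t}, t ∈ Icc t₀ t₁ → t < 0 := fun ht => ht.2.trans_lt ht₁
  have hΘ : ContinuousOn Θ K := by
    have c1 : ContinuousOn (fun z : E × ℝ × ℝ × ℝ × ℝ => w z.1 z.2.2.2.1) K :=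
      h.cont_w.comp (f := fun z : E × ℝ × ℝ × ℝ × ℝ => (z.1, z.2.2.2.1)) (by fun_prop)
        (fun z hz => ⟨mem_univ _, hlt hz.2.2.2.1⟩)
    have c2 : ContinuousOn (fun z : E × ℝ × ℝ × ℝ × ℝ => H z.1 z.2.1) K :=
      h.cont_H.comp (f := fun z : E × ℝ × ℝ × ℝ × ℝ => (z.1, z.2.1)) (by fun_prop)
        (fun z hz => ⟨mem_univ _, hlt hz.2.1⟩)
    have c3 : ContinuousOn (fun z : E × ℝ × ℝ × ℝ × ℝ => H z.1 z.2.2.1) K :=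
      h.cont_H.comp (f := fun z : E × ℝ × ℝ × ℝ × ℝ => (z.1, z.2.2.1)) (by fun_prop)
        (fun z hz => ⟨mem_univ _, hlt hz.2.2.1⟩)
    have c4 : Continuous (fun z : E × ℝ × ℝ × ℝ × ℝ => z.2.2.2.2) := by fun_prop
    refine c1.mul (ContinuousLinearMap.continuous_det.comp_continuousOn ?_)
    exact ((continuousOn_const.sub c4.continuousOn).smul c2).add (c4.continuousOn.smul c3)
  obtain ⟨m, hm, hmF⟩ : ∃ m > 0, ∀ x ∈ Metric.closedBall (0:E) R, m ≤ F x :=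
    (isCompact_closedBall (0:E) R).exists_forall_le' h.cont_F.continuousOn (a := 0)
      (fun x _ => h.F_pos x)
  obtain ⟨δ, hδ, hu⟩ := Metric.uniformContinuousOn_iff.mp
    (hK.uniformContinuousOn_of_continuous hΘ) (η * m) (by positivity)
  refine ⟨δ, hδ, fun x hx t ht t' ht' t'' ht'' θ hθ h1 h2 => ?_⟩
  have h3 := hu (x, t, t', t'', θ) ⟨hx, ht, ht', ht'', hθ⟩ (x, t, t, t, θ) ⟨hx, ht, ht, ht, hθ⟩
    (by simp [Prod.dist_eq, Real.dist_eq, h1, h2])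
  have h4 : Θ (x, t, t, t, θ) = F x := by
    simp only [Θ, interp]
    rw [← add_smul, sub_add_cancel, one_smul]
    exact h.eq t (hlt ht) x
  rw [h4, Real.dist_eq] at h3
  exact h3.le.trans (mul_le_mul_of_nonneg_left (hmF x hx) hη.le)

theorem symm_interp {A B : E →L[ℝ] E} (hA : SymmOp A) (hB : SymmOp B) (θ : ℝ) :
    SymmOp (interp A B θ) := by
  intro x y
  simp [interp, inner_add_left, inner_add_right, real_inner_smul_left, real_inner_smul_right,
    hA x y, hB x y]

theorem pos_interp {A B : E →L[ℝ] E} (hA : ∀ x, x ≠ 0 → 0 < inner ℝ (A x) x)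
    (hB : ∀ x, x ≠ 0 → 0 < inner ℝ (B x) x) {θ : ℝ} (hθ : θ ∈ Icc (0:ℝ) 1) (x : E) (hx : x ≠ 0) :
    0 < inner ℝ (interp A B θ x) x := by
  have h1 := hA x hx
  have h2 := hB x hx
  simp only [interp, add_apply, smul_apply, inner_add_left, real_inner_smul_left]
  rcases hθ.1.eq_or_lt with h | h
  · rw [← h]; simpa using h1
  · have := mul_nonneg (sub_nonneg.mpr hθ.2) h1.le
    have := mul_pos h h2
    linarith

/-- Time difference quotients are values of `w`. -/
theorem Sol.mvt (h : Sol F u p H w) (x : E) {r δ : ℝ} (hδ : 0 < δ) (hr : r + δ < 0) :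
    ∃ t ∈ Icc r (r + δ), (u x r - u x (r + δ)) / δ = w x t := by
  obtain ⟨c, hc, hc'⟩ := exists_hasDerivAt_eq_slope (u x) (fun t => -(w x t))
    (show r < r + δ by linarith)
    (fun t ht => (h.tder t (ht.2.trans_lt hr) x).continuousAt.continuousWithinAt)
    (fun t ht => h.tder t (ht.2.trans hr) x)
  refine ⟨c, Ioo_subset_Icc_self hc, ?_⟩
  have h1 : r + δ - r = δ := by ring
  rw [h1] at hc'
  have : w x c = -((u x (r + δ) - u x r) / δ) := by linarith
  rw [this]; ring

/-- The Jacobian bound at contact points of the extrapolated function. -/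
theorem jacobian_bound (h : Sol F u p H w) (ht : Sol F ũ pt Ht wt) {κ : ℝ} (hκ : 0 < κ)
    {x : E} {r δ θ η : ℝ} (hδ : 0 < δ) (hr : r + δ < 0) (hθ : θ ∈ Icc (0:ℝ) 1)
    (hη : 0 < η) (hη1 : η < 1)
    (hb : ∀ t ∈ Icc r (r + δ), |w x t * (interp (H x r) (H x (r + δ)) θ).det - F x| ≤ η * F x)
    (hbt : ∀ t ∈ Icc r (r + δ),
      |wt x t * (interp (Ht x r) (Ht x (r + δ)) θ).det - F x| ≤ η * F x)
    (G : E →L[ℝ] E) (wg : ℝ) (hG0 : ∀ v, 0 ≤ inner ℝ (G v) v) (hwg : 0 ≤ wg)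
    (hG : κ • G = (1 + κ) • interp (Ht x r) (Ht x (r + δ)) θ - interp (H x r) (H x (r + δ)) θ)
    (hwgeq : κ * wg = (1 + κ) * ((ũ x r - ũ x (r + δ)) / δ) - (u x r - u x (r + δ)) / δ) :
    |wg * G.det| ≤ F x * ((1 + η) * (1 + (2 * η / (1 + η)) / κ) ^ (Module.finrank ℝ E + 1)) := by
  obtain ⟨t1, ht1, e1⟩ := h.mvt x hδ hr
  obtain ⟨t2, ht2, e2⟩ := ht.mvt x hδ hr
  have hr0 : r < 0 := by linarith
  set T := interp (Ht x r) (Ht x (r + δ)) θ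
  set U := interp (H x r) (H x (r + δ)) θ
  have hTs : SymmOp T := symm_interp (ht.symm r hr0 x) (ht.symm _ hr x) θ
  have hUs : SymmOp U := symm_interp (h.symm r hr0 x) (h.symm _ hr x) θ
  have hTp : ∀ v, v ≠ 0 → 0 < inner ℝ (T v) v := pos_interp (ht.pos r hr0 x) (ht.pos _ hr x) hθ
  have hUp : ∀ v, v ≠ 0 → 0 < inner ℝ (U v) v := pos_interp (h.pos r hr0 x) (h.pos _ hr x) hθ
  have hU : (1 + κ) • T - κ • G = U := by rw [hG]; abel
  have hGs : SymmOp G := by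
    intro a b
    have h1 : G = κ⁻¹ • ((1 + κ) • T - U) := by
      rw [← hG, smul_smul, inv_mul_cancel₀ hκ.ne', one_smul]
    rw [h1]
    simp only [smul_apply, sub_apply, inner_sub_left, inner_sub_right, real_inner_smul_left,
      real_inner_smul_right, hTs a b, hUs a b]
  rw [e1, e2] at hwgeq
  have hF := h.F_pos x
  have b1 := abs_le.mp (hb t1 ht1)
  have b2 := abs_le.mp (hbt t2 ht2)
  have hwu : (1 + κ) * wt x t2 - κ * wg = w x t1 := by rw [hwgeq]; ring
  have hq : (1 - η) / (1 + η) * (wt x t2 * T.det) ≤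
      ((1 + κ) * wt x t2 - κ * wg) * ((1 + κ) • T - κ • G).det := by
    rw [hwu, hU]
    calc (1 - η) / (1 + η) * (wt x t2 * T.det) ≤ (1 - η) / (1 + η) * ((1 + η) * F x) := by
          apply mul_le_mul_of_nonneg_left (by linarith [b2.2])
          exact div_nonneg (by linarith) (by linarith)
      _ = (1 - η) * F x := by field_simp
      _ ≤ _ := by linarith [b1.1]
  obtain ⟨hTd, hGd, hmain⟩ := det_extrapolation_le T G hTs hTp hGs hG0 κ ((1 - η) / (1 + η))
    (wt x t2) wg hκ (by rw [div_le_one (by linarith)]; linarith)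
    (ht.wpos _ (ht2.2.trans_lt hr) x) hwg
    (by rw [hU]; exact hUp) (by rw [hwu]; exact h.wpos _ (ht1.2.trans_lt hr) x) hq
  rw [abs_of_nonneg (mul_nonneg hwg hGd)]
  refine hmain.trans ?_
  have e3 : 1 - (1 - η) / (1 + η) = 2 * η / (1 + η) := by field_simp; ring
  rw [e3, ← mul_assoc]
  refine mul_le_mul_of_nonneg_right (by linarith [b2.2]) (by positivity)

end Sol

section ABPmain

variable {E : Type*} [NormedAddCommGroup E] [InnerProductSpace ℝ E] [FiniteDimensional ℝ E]
  [MeasurableSpace E] [BorelSpace E]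
variable {F : E → ℝ} {u ũ : E → ℝ → ℝ} {p pt : E → ℝ → E} {H Ht : E → ℝ → E →L[ℝ] E}
  {w wt : E → ℝ → ℝ}

/-- The plane with parameters `z = (y,s)`: the tangent plane of `½|x|² - t` at `(y,s)`. -/
def plane (z : E × ℝ) (x : E) : ℝ := inner ℝ z.1 x - ‖z.1‖ ^ 2 / 2 - z.2

theorem hasGradientAt_sub_plane {f : E → ℝ} {f' x : E} (hf : HasGradientAt f f' x) (z : E × ℝ) :
    HasGradientAt (fun y => f y - plane z y) (f' - z.1) x := by
  rw [hasGradientAt_iff_hasFDerivAt] at hf ⊢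
  have h1 : HasFDerivAt (fun y : E => plane z y) (innerSL ℝ z.1 : E →L[ℝ] ℝ) x := by
    unfold plane
    exact (((innerSL ℝ z.1 : E →L[ℝ] ℝ).hasFDerivAt (x := x)).sub_const _).sub_const _
  refine (hf.sub h1).congr_fderiv ?_
  ext v
  simp

theorem hasGradientAt_comb {f g : E → ℝ} {f' g' x : E} (hf : HasGradientAt f f' x)
    (hg : HasGradientAt g g' x) (a b c : ℝ) :
    HasGradientAt (fun y => a * f y + b * g y + c) (a • f' + b • g') x := by
  rw [hasGradientAt_iff_hasFDerivAt] at hf hg ⊢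
  refine (((hf.const_mul a).add (hg.const_mul b)).add_const c).congr_fderiv ?_
  ext v
  simp

/-- First contact point of a plane with a function interpolated linearly in time. -/
theorem exists_first_contact {R : ℝ} {g₀ g₁ : E → ℝ} (hg₀ : Continuous g₀) (hg₁ : Continuous g₁)
    (h₀ : ∀ x ∈ Metric.closedBall (0:E) R, 0 < g₀ x)
    (h₁ : ∃ x ∈ Metric.closedBall (0:E) R, g₁ x ≤ 0) :
    ∃ x ∈ Metric.closedBall (0:E) R, ∃ θ ∈ Ioc (0:ℝ) 1, interp (g₀ x) (g₁ x) θ = 0 ∧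
      ∀ y ∈ Metric.closedBall (0:E) R, 0 ≤ interp (g₀ y) (g₁ y) θ := by
  let φ : E × ℝ → ℝ := fun z => interp (g₀ z.1) (g₁ z.1) z.2
  have hφ : Continuous φ := by simp only [φ, interp, smul_eq_mul]; fun_prop
  have hA : IsCompact ((Metric.closedBall (0:E) R ×ˢ Icc (0:ℝ) 1) ∩ {z | φ z ≤ 0}) :=
    ((isCompact_closedBall 0 R).prod isCompact_Icc).inter_right
      (isClosed_le hφ continuous_const)
  obtain ⟨x₁, hx₁, hx₁'⟩ := h₁
  obtain ⟨⟨x, θ⟩, ⟨⟨hx, hθ⟩, hle⟩, hmin⟩ := hA.exists_isMinOn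
    ⟨(x₁, 1), ⟨hx₁, by simp⟩, by simpa [φ, interp] using hx₁'⟩ continuous_snd.continuousOn
  have hle' : interp (g₀ x) (g₁ x) θ ≤ 0 := hle
  simp only at hx hθ
  have hθ0 : 0 < θ := by
    rcases hθ.1.eq_or_lt with h | h
    · rw [← h] at hle'
      simp [interp] at hle'
      linarith [h₀ x hx]
    · exact h
  have hall : ∀ y ∈ Metric.closedBall (0:E) R, 0 ≤ interp (g₀ y) (g₁ y) θ := by
    intro y hy
    by_contra hneg
    push Not at hneg
    have ha := h₀ y hy
    have hlt : g₀ y < θ * (g₀ y - g₁ y) := by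
      simp only [interp, smul_eq_mul] at hneg; linarith
    have hd : 0 < g₀ y - g₁ y := pos_of_mul_pos_right (ha.trans hlt) hθ0.le
    have hlt' : g₀ y / (g₀ y - g₁ y) < θ := by rwa [div_lt_iff₀ hd]
    have hm := hmin (a := (y, g₀ y / (g₀ y - g₁ y)))
      ⟨⟨hy, ⟨by positivity, hlt'.le.trans hθ.2⟩⟩, by
        change φ _ ≤ 0
        simp only [φ, interp, smul_eq_mul]
        apply le_of_eq
        field_simp
        ring⟩
    simp only [mem_ofPred_eq] at hm
    linarith
  exact ⟨x, hx, θ, ⟨hθ0, hθ.2⟩, le_antisymm hle' (hall x hx), hall⟩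

set_option maxHeartbeats 2000000 in
/-- Alexandrov-Bakelman-Pucci type estimate for the extrapolation `ũ + (ũ - u)/κ + b` of two
solutions: the measure of a set of planes crossing it is controlled by the
measure of the possible contact points. -/
theorem abp (h : Sol F u p H w) (ht : Sol F ũ pt Ht wt) {κ : ℝ} (hκ : 0 < κ) (b : ℝ)
    {R t₀ tm η₀ : ℝ} (ht₀ : t₀ < tm) (htm : tm < 0) (hη₀ : 0 < η₀)
    {G : Set (E × ℝ)} (hG : MeasurableSet G) (Y : Set (E × ℝ))
    (hY : ∀ z ∈ Y, ∃ t₁ ∈ Icc t₀ tm, ∃ x₁ ∈ Metric.closedBall (0:E) R,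
      ũ x₁ t₁ + (ũ x₁ t₁ - u x₁ t₁) / κ + b - plane z x₁ ≤ -η₀ ∧
      ∀ x ∈ Metric.closedBall (0:E) R, ∀ t ∈ Icc t₀ t₁,
        ũ x t + (ũ x t - u x t) / κ + b - plane z x ≤ η₀ → (x, t) ∈ G ∧ ‖x‖ < R ∧ t₀ < t) :
    volume Y ≤ ∫⁻ z in G, ENNReal.ofReal (F z.1) := by
  set g : E → ℝ → ℝ := fun x t => ũ x t + (ũ x t - u x t) / κ + b with hg
  let pg : E → ℝ → E := fun x t => (1 + κ⁻¹) • pt x t + (-κ⁻¹) • p x t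
  let Hg : E → ℝ → E →L[ℝ] E := fun x t => (1 + κ⁻¹) • Ht x t + (-κ⁻¹) • H x t
  have hgrad : ∀ t < 0, ∀ x, HasGradientAt (fun y => g y t) (pg x t) x := fun t ht0 x => by
    have := hasGradientAt_comb (ht.grad t ht0 x) (h.grad t ht0 x) (1 + κ⁻¹) (-κ⁻¹) b
    refine this.congr_of_eventuallyEq (Filter.Eventually.of_forall fun y => ?_)
    simp only [hg]; field_simp; ring
  have hhess : ∀ t < 0, ∀ x, HasFDerivAt (fun y => pg y t) (Hg x t) x := fun t ht0 x =>
    ((ht.hess t ht0 x).const_smul (1 + κ⁻¹)).add ((h.hess t ht0 x).const_smul (-κ⁻¹))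
  have hgcont : ContinuousOn (fun z : E × ℝ => g z.1 z.2) (univ ×ˢ Iio 0) :=
    (ht.cont_u.add ((ht.cont_u.sub h.cont_u).div_const κ)).add_const b
  have hHgcont : ContinuousOn (fun z : E × ℝ => Hg z.1 z.2) (univ ×ˢ Iio 0) :=
    (ht.cont_H.const_smul (1 + κ⁻¹)).add (h.cont_H.const_smul (-κ⁻¹))
  set cst : ℝ → ℝ := fun η =>
    (1 + η) * (1 + (2 * η / (1 + η)) / κ) ^ (Module.finrank ℝ E + 1) with hcst
  suffices hmain : ∀ η ∈ Ioo (0:ℝ) 1,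
      volume Y ≤ ENNReal.ofReal (cst η) * ∫⁻ z in G, ENNReal.ofReal (F z.1) by
    have hlim : Filter.Tendsto (fun η => ENNReal.ofReal (cst η) * ∫⁻ z in G, ENNReal.ofReal (F z.1))
        (nhdsWithin 0 (Ioi 0)) (nhds (ENNReal.ofReal 1 * ∫⁻ z in G, ENNReal.ofReal (F z.1))) := by
      refine ENNReal.Tendsto.mul_const (ENNReal.tendsto_ofReal ?_) (Or.inl (by simp))
      have hc : ContinuousAt cst 0 := by
        simp only [hcst]
        refine (by fun_prop : ContinuousAt (fun η : ℝ => 1 + η) 0).mul ?_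
        refine (continuousAt_const.add (ContinuousAt.div_const ?_ _)).pow _
        exact (by fun_prop : ContinuousAt (fun η : ℝ => 2 * η) 0).div (by fun_prop) (by norm_num)
      have h0 : cst 0 = 1 := by simp [hcst]
      have := hc.tendsto
      rw [h0] at this
      exact this.mono_left nhdsWithin_le_nhds
    rw [ENNReal.ofReal_one, one_mul] at hlim
    refine ge_of_tendsto hlim ?_
    filter_upwards [Ioo_mem_nhdsGT (show (0:ℝ) < 1 by norm_num)] with η hη using hmain η hη
  intro η hη
  obtain ⟨δ₁, hδ₁, hu₁⟩ := h.unif R t₀ tm htm hη.1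
  obtain ⟨δ₂, hδ₂, hu₂⟩ := ht.unif R t₀ tm htm hη.1
  have hK : IsCompact (Metric.closedBall (0:E) R ×ˢ Icc t₀ tm) :=
    (isCompact_closedBall 0 R).prod isCompact_Icc
  obtain ⟨δ₃, hδ₃, hu₃⟩ := Metric.uniformContinuousOn_iff.mp (hK.uniformContinuousOn_of_continuous
    (hgcont.mono fun z hz => ⟨mem_univ _, hz.2.2.trans_lt htm⟩)) (η₀ / 2) (by positivity)
  obtain ⟨N, hN⟩ := exists_nat_gt ((tm - t₀) / min δ₁ (min δ₂ δ₃))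
  have hmin : 0 < min δ₁ (min δ₂ δ₃) := by positivity
  have hN0 : (0:ℝ) < N := lt_of_le_of_lt (div_nonneg (by linarith) hmin.le) hN
  set δ := (tm - t₀) / N with hδ
  have hδ0 : 0 < δ := div_pos (by linarith) hN0
  have hδm : δ < min δ₁ (min δ₂ δ₃) := by
    rw [hδ, div_lt_iff₀ hN0]; rw [div_lt_iff₀ hmin] at hN; linarith
  have hδ1 : δ < δ₁ := hδm.trans_le (min_le_left _ _)
  have hδ2 : δ < δ₂ := hδm.trans_le ((min_le_right _ _).trans (min_le_left _ _))
  have hδ3 : δ < δ₃ := hδm.trans_le ((min_le_right _ _).trans (min_le_right _ _))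
  let τ : ℕ → ℝ := fun j => t₀ + j * δ
  have hτs : ∀ j, τ (j + 1) = τ j + δ := fun j => by simp only [τ]; push_cast; ring
  have hτN : τ N = tm := by simp only [τ, hδ]; field_simp; ring
  have hτmono : Monotone τ := monotone_nat_of_le_succ fun j => by rw [hτs]; linarith
  have hτ0 : ∀ j, t₀ ≤ τ j := fun j => by simp only [τ]; nlinarith [Nat.cast_nonneg (α := ℝ) j]
  let Ψ : ℕ → E × ℝ → E × ℝ := fun j =>
    slabMap (fun x => g x (τ j)) (fun x => g x (τ (j + 1))) (fun x => pg x (τ j))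
      (fun x => pg x (τ (j + 1))) (τ j) δ
  let J : ℕ → E × ℝ → ℝ := fun j z => ((g z.1 (τ j) - g z.1 (τ (j + 1))) / δ) *
    (interp (Hg z.1 (τ j)) (Hg z.1 (τ (j + 1))) ((z.2 - τ j) / δ)).det
  let S : ℕ → Set (E × ℝ) := fun j =>
    (G ∩ univ ×ˢ Ioc (τ j) (τ (j + 1))) ∩ {z | |J j z| ≤ F z.1 * cst η}
  have hτlt : ∀ j < N, τ (j + 1) < 0 := fun j hj => by
    have := hτmono (show j + 1 ≤ N from hj)
    rw [hτN] at this; linarith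
  have hτlt' : ∀ j < N, τ j < 0 := fun j hj => by
    have := hτlt j hj
    rw [hτs] at this; linarith
  have hSmeas : ∀ j < N, MeasurableSet (S j) := by
    intro j hj
    refine (hG.inter (MeasurableSet.univ.prod measurableSet_Ioc)).inter ?_
    have c1 := (continuous_slice hgcont (hτlt' j hj)).comp (continuous_fst (X := E) (Y := ℝ))
    have c2 := (continuous_slice hgcont (hτlt j hj)).comp (continuous_fst (X := E) (Y := ℝ))
    have c3 := (continuous_slice hHgcont (hτlt' j hj)).comp (continuous_fst (X := E) (Y := ℝ))
    have c4 := (continuous_slice hHgcont (hτlt j hj)).comp (continuous_fst (X := E) (Y := ℝ))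
    have c5 : Continuous fun z : E × ℝ => (z.2 - τ j) / δ := by fun_prop
    have cJ : Continuous (J j) := ((c1.sub c2).div_const δ).mul
      (ContinuousLinearMap.continuous_det.comp
        (((continuous_const.sub c5).smul c3).add (c5.smul c4)))
    exact (isClosed_le cJ.abs ((h.cont_F.comp continuous_fst).mul continuous_const)).measurableSet
  have hcover : Y ⊆ ⋃ j ∈ Finset.range N, Ψ j '' S j := by
    intro z hz
    obtain ⟨t₁, ht₁, x₁, hx₁, hneg, hin⟩ := hY z hz
    set ℓ := plane z with hℓ
    let P : ℕ → Prop := fun j => ∃ x ∈ Metric.closedBall (0:E) R, g x (τ j) - ℓ x ≤ 0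
    let j₁ := ⌊(t₁ - t₀) / δ⌋₊
    have hq0 : 0 ≤ (t₁ - t₀) / δ := div_nonneg (by linarith [ht₁.1]) hδ0.le
    have hj₁ : τ j₁ ≤ t₁ := by
      have := Nat.floor_le hq0
      rw [le_div_iff₀ hδ0] at this
      simp only [τ]; linarith
    have hj₁' : t₁ < τ j₁ + δ := by
      have := Nat.lt_floor_add_one ((t₁ - t₀) / δ)
      rw [div_lt_iff₀ hδ0] at this
      simp only [τ]; linarith
    have hclose : ∀ x ∈ Metric.closedBall (0:E) R, ∀ s ∈ Icc t₀ tm, ∀ s' ∈ Icc t₀ tm,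
        |s - s'| ≤ δ → |g x s - g x s'| < η₀ / 2 := fun x hx s hs s' hs' hss => by
      have := hu₃ (x, s) ⟨hx, hs⟩ (x, s') ⟨hx, hs'⟩ (by
        simp only [Prod.dist_eq, dist_self, Real.dist_eq]
        exact max_lt hδ₃ (hss.trans_lt hδ3))
      simpa [Real.dist_eq] using this
    have hPj₁ : P j₁ := by
      refine ⟨x₁, hx₁, ?_⟩
      have := hclose x₁ hx₁ (τ j₁) ⟨hτ0 _, hj₁.trans ht₁.2⟩ t₁ ht₁ (by rw [abs_le]; constructor <;> linarith)
      have := (abs_lt.mp this).2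
      linarith
    classical
    have hex : ∃ j, P j := ⟨j₁, hPj₁⟩
    have hfind := Nat.find_spec hex
    have hfind_le : Nat.find hex ≤ j₁ := Nat.find_min' hex hPj₁
    obtain ⟨j, hj⟩ : ∃ j, Nat.find hex = j + 1 := by
      apply Nat.exists_eq_succ_of_ne_zero
      intro h0
      rw [h0] at hfind
      obtain ⟨x, hx, hx'⟩ := hfind
      have e0 : τ 0 = t₀ := by simp [τ]
      rw [e0] at hx'
      have := (hin x hx t₀ ⟨le_rfl, ht₁.1⟩ (by linarith)).2.2
      exact lt_irrefl _ this
    rw [hj] at hfind hfind_le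
    have hnot : ¬ P j := Nat.find_min hex (by rw [hj]; exact Nat.lt_succ_self j)
    have hτj1 : τ (j + 1) ≤ t₁ := (hτmono hfind_le).trans hj₁
    have hjN : j < N := by
      by_contra hge
      push Not at hge
      have := hτmono (show N + 1 ≤ j + 1 by omega)
      rw [hτs, hτN] at this
      linarith [ht₁.2]
    have hjj : τ j ≤ τ (j + 1) := hτmono (Nat.le_succ j)
    have hI : τ j ∈ Icc t₀ tm := ⟨hτ0 j, hjj.trans (hτj1.trans ht₁.2)⟩
    have hI' : τ (j + 1) ∈ Icc t₀ tm := ⟨hτ0 _, hτj1.trans ht₁.2⟩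
    have hℓc : Continuous ℓ := by rw [hℓ]; unfold plane; fun_prop
    obtain ⟨x, hx, θ, hθ, hzero, hnn⟩ := exists_first_contact (R := R)
      (g₀ := fun x => g x (τ j) - ℓ x) (g₁ := fun x => g x (τ (j + 1)) - ℓ x)
      ((continuous_slice hgcont (hτlt' j hjN)).sub hℓc)
      ((continuous_slice hgcont (hτlt j hjN)).sub hℓc)
      (fun x hx => by
        by_contra hh
        exact hnot ⟨x, hx, not_lt.mp hh⟩) hfind
    have ha : 0 < g x (τ j) - ℓ x := by
      by_contra hh
      exact hnot ⟨x, hx, not_lt.mp hh⟩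
    have hzero' : g x (τ j) - ℓ x = θ * (g x (τ j) - g x (τ (j + 1))) := by
      simp only [interp, smul_eq_mul] at hzero; linarith
    have hwg : 0 < g x (τ j) - g x (τ (j + 1)) := by
      rw [hzero'] at ha; exact pos_of_mul_pos_right ha hθ.1.le
    set ts := τ j + θ * δ with hts
    have hts1 : τ j < ts := by rw [hts]; nlinarith [hθ.1]
    have hts2 : ts ≤ τ (j + 1) := by rw [hts, hτs]; nlinarith [hθ.2]
    have hθeq : (ts - τ j) / δ = θ := by rw [hts]; field_simp; ring
    have hIts : ts ∈ Icc t₀ tm := ⟨hI.1.trans hts1.le, hts2.trans hI'.2⟩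
    have hc1 := (abs_lt.mp (hclose x hx _ hI _ hI' (by
      rw [hτs, abs_le]; constructor <;> linarith))).2
    have hc2 := (abs_lt.mp (hclose x hx _ hIts _ hI (by
      have := hτs j
      rw [abs_le]; constructor <;> linarith))).2
    obtain ⟨hmemG, hnorm, -⟩ := hin x hx ts ⟨hIts.1, hts2.trans hτj1⟩ (by
      have : θ * (g x (τ j) - g x (τ (j + 1))) ≤ g x (τ j) - g x (τ (j + 1)) :=
        mul_le_of_le_one_left hwg.le hθ.2
      change g x ts - ℓ x ≤ η₀
      linarith)
    have hθI : θ ∈ Icc (0:ℝ) 1 := ⟨hθ.1.le, hθ.2⟩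
    have hlocmin : IsLocalMin
        (fun y => ((1 - θ) * g y (τ j) + θ * g y (τ (j + 1)) + 0) - plane z y) x := by
      have hball : Metric.closedBall (0:E) R ∈ nhds x :=
        Metric.closedBall_mem_nhds_of_mem (by simpa using hnorm)
      filter_upwards [hball] with y hy
      have h1 := hnn y hy
      simp only [interp, smul_eq_mul] at h1 hzero
      linarith
    obtain ⟨hgr, hpsd⟩ := hess_nonneg_of_isLocalMin
      (p := fun y => (1 - θ) • pg y (τ j) + θ • pg y (τ (j + 1)) - z.1)
      (H := interp (Hg x (τ j)) (Hg x (τ (j + 1))) θ)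
      (fun y => hasGradientAt_sub_plane (hasGradientAt_comb (hgrad _ (hτlt' j hjN) y)
        (hgrad _ (hτlt j hjN) y) (1 - θ) θ 0) z)
      ((((hhess _ (hτlt' j hjN) x).const_smul (1 - θ)).add
        ((hhess _ (hτlt j hjN) x).const_smul θ)).sub_const z.1) hlocmin
    have hJ : |J j (x, ts)| ≤ F x * cst η := by
      simp only [J, hθeq]
      have hrδ : τ j + δ < 0 := by rw [← hτs]; exact hτlt j hjN
      refine jacobian_bound h ht hκ hδ0 hrδ hθI hη.1 hη.2 ?_ ?_ _ _ hpsd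
        (div_nonneg hwg.le hδ0.le) ?_ ?_
      · intro t htI
        rw [← hτs] at htI ⊢
        exact hu₁ x hx _ hI _ hI' t ⟨hI.1.trans htI.1, htI.2.trans hI'.2⟩ θ hθI
          (by rw [hτs, add_sub_cancel_left, abs_of_pos hδ0]; exact hδ1)
          (by rw [hτs] at htI; rw [abs_of_nonneg (by linarith [htI.1])]; linarith [htI.2])
      · intro t htI
        rw [← hτs] at htI ⊢
        exact hu₂ x hx _ hI _ hI' t ⟨hI.1.trans htI.1, htI.2.trans hI'.2⟩ θ hθI
          (by rw [hτs, add_sub_cancel_left, abs_of_pos hδ0]; exact hδ2)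
          (by rw [hτs] at htI; rw [abs_of_nonneg (by linarith [htI.1])]; linarith [htI.2])
      · rw [← hτs]
        simp only [interp, Hg, smul_add, smul_smul]
        have e1 : κ * ((1 - θ) * (1 + κ⁻¹)) = (1 + κ) * (1 - θ) := by
          field_simp
          try ring
        have e2 : κ * ((1 - θ) * -κ⁻¹) = -(1 - θ) := by
          field_simp
          try ring
        have e3 : κ * (θ * (1 + κ⁻¹)) = (1 + κ) * θ := by
          field_simp
          try ring
        have e4 : κ * (θ * -κ⁻¹) = -θ := by
          field_simp
          try ring
        rw [e1, e2, e3, e4]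
        module
      · rw [← hτs]
        simp only [hg]
        field_simp
        ring
    have hP : interp (pg x (τ j)) (pg x (τ (j + 1))) θ = z.1 := sub_eq_zero.mp hgr
    refine mem_iUnion₂.mpr ⟨j, Finset.mem_range.mpr hjN, (x, ts),
      ⟨⟨hmemG, mem_univ _, hts1, hts2⟩, hJ⟩, ?_⟩
    simp only [Ψ, slabMap, hθeq, hP]
    refine Prod.ext rfl ?_
    have e : interp (g x (τ j)) (g x (τ (j + 1))) θ = plane z x := by
      simp only [interp, smul_eq_mul] at hzero ⊢; linarith
    simp only [e, plane, real_inner_comm z.1 x]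
    ring
  have hdisj : Set.PairwiseDisjoint (↑(Finset.range N)) S := by
    intro i _ j _ hij
    refine Set.disjoint_left.mpr fun z hzi hzj => ?_
    have hi := hzi.1.2.2
    have hj := hzj.1.2.2
    rcases lt_or_gt_of_ne hij with hlt | hlt
    · have := hτmono (show i + 1 ≤ j from hlt)
      linarith [hi.2, hj.1]
    · have := hτmono (show j + 1 ≤ i from hlt)
      linarith [hj.2, hi.1]
  have hcst0 : 0 ≤ cst η := by
    have := hη.1
    simp only [hcst]; positivity
  have : (volume : Measure (E × ℝ)).IsAddHaarMeasure :=
    inferInstanceAs (((volume : Measure E).prod (volume : Measure ℝ)).IsAddHaarMeasure)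
  calc volume Y ≤ volume (⋃ j ∈ Finset.range N, Ψ j '' S j) := measure_mono hcover
    _ ≤ ∑ j ∈ Finset.range N, volume (Ψ j '' S j) := measure_biUnion_finset_le _ _
    _ ≤ ∑ j ∈ Finset.range N,
        ∫⁻ z in S j, ENNReal.ofReal (cst η) * ENNReal.ofReal (F z.1) := by
        refine Finset.sum_le_sum fun j hj => ?_
        rw [Finset.mem_range] at hj
        choose L hL hLdet using hasFDerivAt_slabMap (hgrad _ (hτlt' j hj)) (hgrad _ (hτlt j hj))
          (hhess _ (hτlt' j hj)) (hhess _ (hτlt j hj)) (τ j) δ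
        refine (addHaar_image_le_lintegral_abs_det_fderiv volume (hSmeas j hj)
          (fun z _ => (hL z).hasFDerivWithinAt)).trans ?_
        refine setLIntegral_mono' (hSmeas j hj) fun z hz => ?_
        rw [hLdet, ← ENNReal.ofReal_mul hcst0, mul_comm (cst η)]
        exact ENNReal.ofReal_le_ofReal hz.2
    _ = ∫⁻ z in ⋃ j ∈ Finset.range N, S j, ENNReal.ofReal (cst η) * ENNReal.ofReal (F z.1) :=
        (lintegral_biUnion_finset hdisj (fun j hj => hSmeas j (Finset.mem_range.mp hj)) _).symm
    _ ≤ ∫⁻ z in G, ENNReal.ofReal (cst η) * ENNReal.ofReal (F z.1) := by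
        refine lintegral_mono_set (iUnion₂_subset fun j _ z hz => hz.1.1)
    _ = _ := lintegral_const_mul _ (h.cont_F.comp continuous_fst).measurable.ennreal_ofReal

end ABPmain

section Contact

variable {E : Type*} [NormedAddCommGroup E] [InnerProductSpace ℝ E] [FiniteDimensional ℝ E]
  [MeasurableSpace E] [BorelSpace E]

/-- The reference cylinder. -/
def Dom (E : Type*) [NormedAddCommGroup E] : Set (E × ℝ) :=
  {z | ‖z.1‖ ≤ 4 ∧ -16 ≤ z.2 ∧ z.2 < 0}

/-- The measure estimate for contact sets of `v` with paraboloids. -/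
def ContactEstimate (v : E → ℝ → ℝ) (F : E → ℝ) (ω : ℝ) : Prop :=
  ∀ a > 0, ∀ tm < 0, ∀ G : Set (E × ℝ), MeasurableSet G → ∀ Y : Set (E × ℝ),
    (∀ z ∈ Y, ∃ x₁ t₁, ‖x₁‖ ≤ 4 ∧ -16 ≤ t₁ ∧ t₁ ≤ tm ∧
      v x₁ t₁ / a + ‖x₁ - z.1‖ ^ 2 / 2 + 2 * ω ≤ t₁ - z.2 ∧
      ∀ x t, ‖x‖ ≤ 4 → -16 ≤ t → t ≤ t₁ → ‖x - z.1‖ ^ 2 / 2 ≤ t - z.2 + 2 * ω →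
        v x t ≤ a * (t - z.2 + 2 * ω) → (x, t) ∈ G ∧ ‖x‖ < 4 ∧ -16 < t) →
    volume Y ≤ ∫⁻ z in G, ENNReal.ofReal (F z.1)

theorem contactEstimate {F : E → ℝ} {u ũ : E → ℝ → ℝ} {p pt : E → ℝ → E}
    {H Ht : E → ℝ → E →L[ℝ] E} {w wt : E → ℝ → ℝ}
    (h : Sol F u p H w) (ht : Sol F ũ pt Ht wt) {c ω : ℝ} (hc : 0 < c) (b : ℝ) (hω : 0 < ω)
    (hQ : ∀ z ∈ Dom E, |ũ z.1 z.2 - (‖z.1‖ ^ 2 / 2 - z.2)| ≤ ω)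
    (hv : ∀ z ∈ Dom E, 0 ≤ (ũ z.1 z.2 - u z.1 z.2) / c + b) :
    ContactEstimate (fun x t => (ũ x t - u x t) / c + b) F ω := by
  intro a ha tm htm G hG Y hY
  have key : ∀ z : E × ℝ, ∀ x t, ũ x t + (ũ x t - u x t) / (c * a) + b / a - plane z x =
      (ũ x t - (‖x‖ ^ 2 / 2 - t)) + ((ũ x t - u x t) / c + b) / a
        + (‖x - z.1‖ ^ 2 / 2 - (t - z.2)) := by
    intro z x t
    rw [norm_sub_sq_real, plane, real_inner_comm]
    field_simp
    ring
  rcases Y.eq_empty_or_nonempty with rfl | ⟨z₀, hz₀⟩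
  · simp
  have htm' : -16 < max tm (-1) := lt_of_lt_of_le (by norm_num) (le_max_right _ _)
  refine abp h ht (κ := c * a) (by positivity) (b / a) (R := 4) (t₀ := -16) (tm := max tm (-1))
    (η₀ := ω) htm' (max_lt htm (by norm_num)) hω hG Y ?_
  intro z hz
  obtain ⟨x₁, t₁, hx₁, ht₁, ht₁m, hle, hall⟩ := hY z hz
  refine ⟨t₁, ⟨ht₁, ht₁m.trans (le_max_left _ _)⟩, x₁, by simpa using hx₁, ?_, ?_⟩
  · rw [key]
    have := abs_le.mp (hQ (x₁, t₁) ⟨hx₁, ht₁, ht₁m.trans_lt htm⟩)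
    simp only at this
    linarith [this.2]
  · intro x hx t htt hle'
    have hx' : ‖x‖ ≤ 4 := by simpa using hx
    have hD : (x, t) ∈ Dom E := ⟨hx', htt.1, htt.2.trans_lt (ht₁m.trans_lt htm)⟩
    rw [key] at hle'
    have h1 := abs_le.mp (hQ _ hD)
    have h2 := hv _ hD
    have h3 : 0 ≤ ((ũ x t - u x t) / c + b) / a := div_nonneg h2 ha.le
    simp only at h1
    refine hall x t hx' htt.1 htt.2 (by linarith [h1.1]) ?_
    have h4 : ((ũ x t - u x t) / c + b) / a ≤ t - z.2 + 2 * ω := by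
      nlinarith [h1.1, sq_nonneg ‖x - z.1‖]
    rw [div_le_iff₀ ha] at h4
    linarith

/-- The limit set of points where the functions `v k` are small. -/
def limZ (𝒰 : Filter ℕ) (v : ℕ → E → ℝ → ℝ) : Set (E × ℝ) :=
  {q | ∀ ε > 0, ∀ᶠ k in 𝒰, ∃ q' ∈ Dom E, dist q' q < ε ∧ v k q'.1 q'.2 < ε}

variable {𝒰 : Ultrafilter ℕ} {v : ℕ → E → ℝ → ℝ} {F : ℕ → E → ℝ} {ω : ℕ → ℝ} {Λ : ℝ}

theorem isClosed_limZ : IsClosed (limZ (𝒰 : Filter ℕ) v) := by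
  refine isClosed_of_closure_subset fun q hq ε hε => ?_
  obtain ⟨q₁, hq₁, hd⟩ := Metric.mem_closure_iff.mp hq (ε / 2) (by positivity)
  filter_upwards [hq₁ (ε / 2) (by positivity)] with k ⟨q', hq', h1, h2⟩
  refine ⟨q', hq', ?_, by linarith⟩
  have := dist_triangle q' q₁ q
  rw [dist_comm q q₁] at hd
  linarith

theorem eventually_le_of_disjoint {K : Set (E × ℝ)} (hK : IsCompact K)
    (hKZ : Disjoint K (limZ (𝒰 : Filter ℕ) v)) :
    ∃ ε > 0, ∀ᶠ k in (𝒰 : Filter ℕ), ∀ q ∈ K, q ∈ Dom E → ε ≤ v k q.1 q.2 := by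
  refine hK.induction_on (p := fun K => ∃ ε > 0, ∀ᶠ k in (𝒰 : Filter ℕ), ∀ q ∈ K, q ∈ Dom E →
    ε ≤ v k q.1 q.2) ⟨1, one_pos, by simp⟩ ?_ ?_ ?_
  · rintro s t hst ⟨ε, hε, h⟩
    exact ⟨ε, hε, h.mono fun k hk q hq => hk q (hst hq)⟩
  · rintro s t ⟨ε, hε, h⟩ ⟨ε', hε', h'⟩
    refine ⟨min ε ε', lt_min hε hε', ?_⟩
    filter_upwards [h, h'] with k hk hk' q hq hD
    rcases hq with hq | hq
    · exact (min_le_left _ _).trans (hk q hq hD)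
    · exact (min_le_right _ _).trans (hk' q hq hD)
  · intro q hq
    have hqZ : q ∉ limZ (𝒰 : Filter ℕ) v := Set.disjoint_left.mp hKZ hq
    simp only [limZ, Set.mem_ofPred_eq, not_forall] at hqZ
    obtain ⟨ε, hε, hq'⟩ := hqZ
    rw [Ultrafilter.eventually_not.symm.trans Iff.rfl] at hq'
    refine ⟨Metric.ball q ε, mem_nhdsWithin_of_mem_nhds (Metric.ball_mem_nhds q hε), ε, hε, ?_⟩
    filter_upwards [hq'] with k hk r hr hD
    by_contra hlt
    exact hk ⟨r, hD, hr, not_le.mp hlt⟩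

theorem eventually_exists_of_subset {K : Set (E × ℝ)} (hK : IsCompact K)
    (hKZ : K ⊆ limZ (𝒰 : Filter ℕ) v) {ε : ℝ} (hε : 0 < ε) :
    ∀ᶠ k in (𝒰 : Filter ℕ), ∀ q ∈ K, ∃ q' ∈ Dom E, dist q' q < ε ∧ v k q'.1 q'.2 < ε := by
  obtain ⟨t, htK, ht⟩ := hK.elim_nhds_subcover (fun q => Metric.ball q (ε / 2))
    (fun q _ => Metric.ball_mem_nhds q (by positivity))
  have : ∀ᶠ k in (𝒰 : Filter ℕ), ∀ q ∈ t, ∃ q' ∈ Dom E, dist q' q < ε / 2 ∧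
      v k q'.1 q'.2 < ε / 2 :=
    (Filter.eventually_all_finset t).mpr fun q hq => hKZ (htK q hq) _ (by positivity)
  filter_upwards [this] with k hk q hq
  obtain ⟨r, hr, hqr⟩ := mem_iUnion₂.mp (ht hq)
  obtain ⟨q', hq', h1, h2⟩ := hk r hr
  refine ⟨q', hq', ?_, by linarith⟩
  have := dist_triangle q' r q
  have h3 : dist q r < ε / 2 := hqr
  rw [dist_comm] at h3
  linarith

/-- Measure estimate for paraboloids with a common point over `limZ`. -/
theorem volume_le_of_mem_limZ (hest : ∀ k, ContactEstimate (v k) (F k) (ω k))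
    (hF : ∀ k x, F k x ≤ Λ) (hω : Filter.Tendsto ω 𝒰 (nhds 0))
    {x' : E} {t' : ℝ} (hp : (x', t') ∈ limZ (𝒰 : Filter ℕ) v) (ht' : t' ≤ 0) {O K : Set (E × ℝ)}
    (hO : MeasurableSet O) (hK : IsCompact K) (hKZ : Disjoint K (limZ (𝒰 : Filter ℕ) v))
    {Y : Set (E × ℝ)} {μ η M : ℝ} (hμ : 0 < μ) (hη : 0 < η)
    (hYM : ∀ z ∈ Y, ‖x' - z.1‖ ≤ M ∧ -M ≤ z.2)
    (hYμ : ∀ z ∈ Y, ‖x' - z.1‖ ^ 2 / 2 + μ ≤ t' - z.2)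
    (hYC : ∀ z ∈ Y, ∀ x t, t ≤ t' + η → ‖x - z.1‖ ^ 2 / 2 ≤ t - z.2 + η →
      (x, t) ∈ O ∪ K ∧ ‖x‖ < 4 ∧ -16 < t) :
    volume Y ≤ ENNReal.ofReal Λ * volume O := by
  rcases Y.eq_empty_or_nonempty with rfl | ⟨z₀, hz₀⟩
  · simp
  have hM : 0 ≤ M := (norm_nonneg _).trans (hYM z₀ hz₀).1
  obtain ⟨ε₀, hε₀, hev⟩ := eventually_le_of_disjoint hK hKZ
  set a := ε₀ / (2 * (M + 2 * η)) with ha_def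
  have ha : 0 < a := by positivity
  have haM : a * (M + 2 * η) < ε₀ := by
    rw [ha_def]; field_simp; linarith
  set ε := min (min (μ / 8) η) (min (a * μ / 4) (μ / (8 * (M + 1)) ⊓ 1)) with hε_def
  have hε : 0 < ε := by positivity
  have hε1 : ε ≤ μ / 8 := (min_le_left _ _).trans (min_le_left _ _)
  have hε2 : ε ≤ η := (min_le_left _ _).trans (min_le_right _ _)
  have hε3 : ε ≤ a * μ / 4 := (min_le_right _ _).trans (min_le_left _ _)
  have hε4 : ε ≤ μ / (8 * (M + 1)) :=
    (min_le_right _ _).trans ((min_le_right _ _).trans (min_le_left _ _))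
  have hε5 : ε ≤ 1 := (min_le_right _ _).trans ((min_le_right _ _).trans (min_le_right _ _))
  have hωev : ∀ᶠ k in (𝒰 : Filter ℕ), ω k < min (η / 2) (μ / 8) :=
    hω.eventually_lt_const (by positivity)
  obtain ⟨k, hk, ⟨⟨x₁, t₁⟩, hD, hd, hsm⟩, hωk⟩ := (hev.and ((hp ε hε).and hωev)).exists
  simp only at hsm
  have hω1 : 2 * ω k ≤ η := by linarith [hωk.trans_le (min_le_left _ _)]
  have hω2 : 2 * ω k ≤ μ / 4 := by linarith [hωk.trans_le (min_le_right _ _)]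
  rw [Prod.dist_eq, max_lt_iff, dist_eq_norm, Real.dist_eq] at hd
  simp only at hd
  have htd := abs_lt.mp hd.2
  have hle := hest k a ha t₁ hD.2.2 O hO Y ?_
  · refine hle.trans ?_
    rw [← setLIntegral_const]
    exact lintegral_mono fun z => ENNReal.ofReal_le_ofReal (hF k _)
  intro z hz
  refine ⟨x₁, t₁, hD.1, hD.2.1, le_rfl, ?_, ?_⟩
  · have h1 : v k x₁ t₁ / a ≤ μ / 4 := by
      rw [div_le_iff₀ ha]; linarith
    have h2 : ‖x₁ - z.1‖ ≤ ‖x' - z.1‖ + ε := by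
      have := norm_add_le (x' - z.1) (x₁ - x')
      rw [show x' - z.1 + (x₁ - x') = x₁ - z.1 by abel] at this
      linarith [hd.1]
    have h3 : ‖x₁ - z.1‖ ^ 2 / 2 ≤ ‖x' - z.1‖ ^ 2 / 2 + μ / 8 := by
      have h4 := (hYM z hz).1
      have h5 : ε * (8 * (M + 1)) ≤ μ := by
        rwa [le_div_iff₀ (by positivity)] at hε4
      nlinarith [norm_nonneg (x₁ - z.1), norm_nonneg (x' - z.1)]
    linarith [hYμ z hz]
  · intro x t hx ht ht1 hpar hvle
    have h1 := hYC z hz x t (by linarith) (by linarith)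
    refine ⟨h1.1.resolve_right fun hxK => ?_, h1.2⟩
    have h2 := hk _ hxK ⟨hx, ht, ht1.trans_lt hD.2.2⟩
    have h3 : t - z.2 + 2 * ω k ≤ M + 2 * η := by linarith [(hYM z hz).2]
    have := mul_le_mul_of_nonneg_left h3 ha.le
    simp only at h2
    linarith

end Contact

section Tangent

open scoped Pointwise

variable {E : Type*} [NormedAddCommGroup E] [InnerProductSpace ℝ E] [FiniteDimensional ℝ E]
  [MeasurableSpace E] [BorelSpace E]
variable {𝒰 : Ultrafilter ℕ} {v : ℕ → E → ℝ → ℝ} {F : ℕ → E → ℝ} {ω : ℕ → ℝ} {Λ : ℝ}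

theorem isClosed_slab (a : E) (R C : ℝ) :
    IsClosed {X : E | ‖X‖ ≤ R ∧ |inner ℝ X a| ≤ C} := by
  have h1 : IsClosed {X : E | ‖X‖ ≤ R} := isClosed_le (by fun_prop) (by fun_prop)
  have h2 : IsClosed {X : E | |inner ℝ X a| ≤ C} := isClosed_le (by fun_prop) (by fun_prop)
  exact h1.inter h2

theorem tendsto_volume_slab {a : E} (ha : a ≠ 0) (R C : ℝ) :
    Filter.Tendsto (fun m : ℕ => volume {X : E | ‖X‖ ≤ R ∧ |inner ℝ X a| ≤ C * (1 / ((m:ℝ) + 1))})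
      Filter.atTop (nhds 0) := by
  rcases lt_or_ge C 0 with hC | hC
  · have : ∀ m : ℕ, {X : E | ‖X‖ ≤ R ∧ |inner ℝ X a| ≤ C * (1 / ((m:ℝ) + 1))} = ∅ := by
      intro m
      refine Set.eq_empty_of_forall_notMem fun X hX => ?_
      have : C * (1 / ((m:ℝ) + 1)) < 0 := mul_neg_of_neg_of_pos hC (by positivity)
      linarith [hX.2, abs_nonneg (inner ℝ X a)]
    simp only [this, measure_empty]
    exact tendsto_const_nhds
  have hcl : ∀ m : ℕ, IsClosed {X : E | ‖X‖ ≤ R ∧ |inner ℝ X a| ≤ C * (1 / ((m:ℝ) + 1))} :=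
    fun m => isClosed_slab a R _
  have key := tendsto_measure_iInter_atTop (μ := (volume : Measure E))
    (s := fun m : ℕ => {X : E | ‖X‖ ≤ R ∧ |inner ℝ X a| ≤ C * (1 / ((m:ℝ) + 1))})
    (fun m => (hcl m).measurableSet.nullMeasurableSet) ?_ ⟨0, ?_⟩
  · have h0 : volume (⋂ m : ℕ, {X : E | ‖X‖ ≤ R ∧ |inner ℝ X a| ≤ C * (1 / ((m:ℝ) + 1))}) = 0 := by
      refine measure_mono_null (t := ((LinearMap.ker (innerSL ℝ a : E →L[ℝ] ℝ).toLinearMap :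
        Submodule ℝ E) : Set E)) ?_ (Measure.addHaar_submodule _ _ ?_)
      · intro X hX
        simp only [mem_iInter, Set.mem_ofPred_eq] at hX
        have h1 : |inner ℝ X a| ≤ C * 0 :=
          ge_of_tendsto' (tendsto_one_div_add_atTop_nhds_zero_nat.const_mul C) fun m => (hX m).2
        rw [mul_zero] at h1
        have h2 : inner ℝ X a = 0 := abs_eq_zero.mp (le_antisymm h1 (abs_nonneg _))
        simpa [real_inner_comm] using h2
      · intro htop
        have : a ∈ (LinearMap.ker (innerSL ℝ a : E →L[ℝ] ℝ).toLinearMap : Submodule ℝ E) := by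
          rw [htop]; trivial
        exact ha (by simpa using this)
    rwa [h0] at key
  · intro m m' hmm X hX
    refine ⟨hX.1, hX.2.trans ?_⟩
    have : (m:ℝ) ≤ m' := by exact_mod_cast hmm
    gcongr
  · refine ((measure_mono (fun X hX => ?_)).trans_lt
      (measure_closedBall_lt_top (x := (0:E)) (r := R))).ne
    simpa using hX.1

set_option maxHeartbeats 2000000 in
/-- A point of `limZ` is never the vertex-side end of an untouched tilted paraboloid. -/
theorem exists_mem_limZ_below (hest : ∀ k, ContactEstimate (v k) (F k) (ω k))
    (hF : ∀ k x, F k x ≤ Λ) (hω : Filter.Tendsto ω 𝒰 (nhds 0))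
    {x' : E} {t' : ℝ} (hp : (x', t') ∈ limZ (𝒰 : Filter ℕ) v) (ht' : t' ≤ 0) (ht'' : -15 < t')
    (hx' : ‖x'‖ < 3) {a : E} (ha : a ≠ 0) (ha' : ‖a‖ ≤ 1 / 4) :
    ∃ x t, (x, t) ∈ limZ (𝒰 : Filter ℕ) v ∧ t < t' ∧
      ‖x - x'‖ ^ 2 / 2 + inner ℝ (x - x') a < t - t' := by
  by_contra hcon
  push Not at hcon
  let slab : ℝ → Set E := fun κ => {X : E | ‖X‖ ≤ 6 ∧ |inner ℝ X a| ≤ 28 * κ}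
  have hslabm : ∀ κ, MeasurableSet (slab κ) := fun κ =>
    (isClosed_slab a 6 _).measurableSet
  set d := Module.finrank ℝ E
  -- the estimate at scale `κ`
  have step : ∀ κ : ℝ, 0 < κ → κ ≤ 1 / 8 → volume (Metric.ball (0:E) 1) ≤
      ENNReal.ofReal Λ * (volume (slab κ) * 9) := by
    intro κ hκ hκ8
    let f : E → ℝ := fun y => t' - ‖x' - y‖ ^ 2 / 2 - 2 * κ ^ 2
    have hfc : Continuous f := by fun_prop
    let y₁ : E := x' - (1 / 2 : ℝ) • a
    let Y : Set (E × ℝ) := regionBetween f (fun y => f y + κ ^ 2) (Metric.ball y₁ κ)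
    have hYvol : volume Y = ENNReal.ofReal (κ ^ d) * volume (Metric.ball (0:E) 1) *
        ENNReal.ofReal (κ ^ 2) := by
      rw [Measure.volume_eq_prod, volume_regionBetween_eq_lintegral hfc.aemeasurable
        (hfc.add_const _).aemeasurable measurableSet_ball]
      simp only [Pi.sub_apply, add_sub_cancel_left, lintegral_const, MeasurableSet.univ,
        Measure.restrict_apply, univ_inter]
      rw [Measure.addHaar_ball_of_pos _ _ hκ, mul_comm]
    let S : Set E := (fun y => y + -x') ⁻¹' (κ • slab κ)
    have hSm : MeasurableSet S :=
      MeasurableSet.preimage ((hslabm κ).const_smul₀ κ) (by fun_prop)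
    have hSvol : volume S = ENNReal.ofReal (κ ^ d) * volume (slab κ) := by
      rw [measure_preimage_add_right, Measure.addHaar_smul, abs_of_pos (by positivity)]
    have hO2vol : volume (S ×ˢ Icc (t' - 9 * κ ^ 2) t') =
        ENNReal.ofReal (κ ^ d) * volume (slab κ) * ENNReal.ofReal (9 * κ ^ 2) := by
      rw [Measure.volume_eq_prod, Measure.prod_prod, Real.volume_Icc, hSvol]
      congr 2; ring
    have hσ : ∀ σ : ℝ, 0 < σ → σ ≤ κ ^ 2 → volume Y ≤ ENNReal.ofReal Λ *
        (volume (Metric.closedBall x' 1) * ENNReal.ofReal (2 * σ) +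
          ENNReal.ofReal (κ ^ d) * volume (slab κ) * ENNReal.ofReal (9 * κ ^ 2)) := by
      intro σ hσ hσκ
      let O1 : Set (E × ℝ) := Metric.closedBall x' 1 ×ˢ Icc (t' - σ) (t' + σ)
      let O : Set (E × ℝ) := O1 ∪ S ×ˢ Icc (t' - 9 * κ ^ 2) t'
      let K : Set (E × ℝ) := (Metric.closedBall x' 1 ×ˢ Icc (t' - 1) t') ∩
        {z | z.2 ≤ t' - σ ∧ ‖z.1 - x'‖ ^ 2 / 2 + inner ℝ (z.1 - x') a ≤ z.2 - t' - σ}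
      have hO : MeasurableSet O := (measurableSet_closedBall.prod measurableSet_Icc).union
        (hSm.prod measurableSet_Icc)
      have hK : IsCompact K := ((isCompact_closedBall _ _).prod isCompact_Icc).inter_right
        (IsClosed.inter (s₁ := {z : E × ℝ | z.2 ≤ t' - σ})
          (isClosed_le (by fun_prop) (by fun_prop))
          (isClosed_le (f := fun z : E × ℝ => ‖z.1 - x'‖ ^ 2 / 2 + inner ℝ (z.1 - x') a)
            (g := fun z : E × ℝ => z.2 - t' - σ) (by fun_prop) (by fun_prop)))
      have hKZ : Disjoint K (limZ (𝒰 : Filter ℕ) v) := by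
        refine Set.disjoint_left.mpr fun z hz hzZ => ?_
        have := hcon z.1 z.2 hzZ (by linarith [hz.2.1])
        linarith [hz.2.2]
      have hOvol : volume O ≤ volume (Metric.closedBall x' 1) * ENNReal.ofReal (2 * σ) +
          ENNReal.ofReal (κ ^ d) * volume (slab κ) * ENNReal.ofReal (9 * κ ^ 2) := by
        refine (measure_union_le _ _).trans (add_le_add (le_of_eq ?_) hO2vol.le)
        rw [Measure.volume_eq_prod, Measure.prod_prod, Real.volume_Icc]
        congr 2; ring
      refine le_trans ?_ (mul_le_mul_right hOvol _)
      have hdec : ∀ z ∈ Y, ∃ e : E, ‖e‖ < κ ∧ x' - z.1 = (1 / 2 : ℝ) • a - e ∧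
          κ ^ 2 ≤ t' - z.2 - ‖x' - z.1‖ ^ 2 / 2 ∧ t' - z.2 - ‖x' - z.1‖ ^ 2 / 2 ≤ 2 * κ ^ 2 := by
        intro z hz
        obtain ⟨hz1, hz2, hz3⟩ := hz
        refine ⟨z.1 - y₁, by simpa [dist_eq_norm] using hz1, ?_, ?_, ?_⟩
        · simp only [y₁]; abel
        · simp only [f] at hz3; linarith
        · simp only [f] at hz2; linarith
      refine volume_le_of_mem_limZ hest hF hω hp ht' hO hK hKZ (μ := κ ^ 2) (η := σ) (M := 20)
        (by positivity) hσ ?_ ?_ ?_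
      · intro z hz
        obtain ⟨e, he, hze, h1, h2⟩ := hdec z hz
        have h3 : ‖x' - z.1‖ ≤ 1 := by
          rw [hze]
          refine (norm_sub_le _ _).trans ?_
          rw [norm_smul]
          norm_num
          linarith
        refine ⟨h3.trans (by norm_num), ?_⟩
        nlinarith [norm_nonneg (x' - z.1)]
      · intro z hz
        obtain ⟨e, he, hze, h1, h2⟩ := hdec z hz
        linarith
      · intro z hz x t htη hpar
        obtain ⟨e, he, hze, h1, h2⟩ := hdec z hz
        set X := x - x' with hX
        set T := t - t' with hT
        have e1 : ‖x - z.1‖ ^ 2 = ‖X‖ ^ 2 + inner ℝ X a - 2 * inner ℝ X e + ‖x' - z.1‖ ^ 2 := by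
          rw [show x - z.1 = X + (x' - z.1) by rw [hX]; abel, norm_add_sq_real]
          rw [hze, inner_sub_right, inner_smul_right]
          ring
        have e2 : inner ℝ X e ≤ ‖X‖ * κ :=
          (real_inner_le_norm X e).trans (by gcongr)
        have e3 := abs_le.mp (abs_real_inner_le_norm X a)
        have hI : ‖X‖ ^ 2 + inner ℝ X a ≤ 2 * T + 2 * κ * ‖X‖ + 6 * κ ^ 2 := by
          nlinarith
        have hXn := norm_nonneg X
        have hTσ : T ≤ σ := by linarith
        have hκ2 : κ ^ 2 ≤ 1 / 64 := by nlinarith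
        have hXa : ‖X‖ * ‖a‖ ≤ ‖X‖ * (1 / 4) := by gcongr
        have hX1 : ‖X‖ < 1 := by nlinarith
        have hT1 : -1 < T := by nlinarith [sq_nonneg (‖X‖ - 1 / 4)]
        have hxX : x = x' + X := by rw [hX]; abel
        refine ⟨?_, ?_, by linarith⟩
        · by_cases hc1 : -σ < T
          · refine Or.inl (Or.inl ⟨?_, by simp only; linarith, by simp only; linarith⟩)
            rw [mem_closedBall_iff_norm]
            exact hX1.le
          push Not at hc1
          by_cases hc2 : ‖X‖ ^ 2 / 2 + inner ℝ X a ≤ T - σ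
          · refine Or.inr ⟨⟨?_, by simp only; linarith, by simp only; linarith⟩,
              by simp only; linarith, by simp only; linarith⟩
            rw [mem_closedBall_iff_norm]
            exact hX1.le
          push Not at hc2
          have hX6 : ‖X‖ ≤ 6 * κ := by nlinarith
          have hT9 : -(9 * κ ^ 2) ≤ T := by nlinarith [sq_nonneg (‖X‖ - 2 * κ)]
          refine Or.inl (Or.inr ⟨?_, by simp only; linarith, by simp only; linarith⟩)
          refine Set.mem_smul_set.mpr ⟨κ⁻¹ • X, ⟨?_, ?_⟩, ?_⟩
          · rw [norm_smul, norm_inv, Real.norm_of_nonneg hκ.le, inv_mul_le_iff₀ hκ]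
            linarith
          · rw [inner_smul_left, abs_mul]
            simp only [conj_trivial]
            rw [abs_of_pos (inv_pos.mpr hκ), inv_mul_le_iff₀ hκ, abs_le]
            constructor <;> nlinarith
          · rw [smul_smul, mul_inv_cancel₀ hκ.ne', one_smul, hX]; exact sub_eq_add_neg x x'
        · rw [hxX]
          linarith [norm_add_le x' X]
    have hlim : volume Y ≤ ENNReal.ofReal Λ *
        (volume (Metric.closedBall x' 1) * ENNReal.ofReal (2 * 0) +
          ENNReal.ofReal (κ ^ d) * volume (slab κ) * ENNReal.ofReal (9 * κ ^ 2)) := by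
      have ht : Filter.Tendsto (fun σ : ℝ => ENNReal.ofReal Λ *
        (volume (Metric.closedBall x' 1) * ENNReal.ofReal (2 * σ) +
          ENNReal.ofReal (κ ^ d) * volume (slab κ) * ENNReal.ofReal (9 * κ ^ 2)))
          (nhdsWithin 0 (Ioi 0)) (nhds (ENNReal.ofReal Λ *
        (volume (Metric.closedBall x' 1) * ENNReal.ofReal (2 * 0) +
          ENNReal.ofReal (κ ^ d) * volume (slab κ) * ENNReal.ofReal (9 * κ ^ 2)))) := by
        refine ENNReal.Tendsto.const_mul (Filter.Tendsto.add (ENNReal.Tendsto.const_mul ?_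
          (Or.inr measure_closedBall_lt_top.ne)) tendsto_const_nhds) (Or.inr ENNReal.ofReal_ne_top)
        refine ENNReal.tendsto_ofReal (Filter.Tendsto.const_mul 2 ?_)
        exact Filter.tendsto_id.mono_left nhdsWithin_le_nhds
      refine ge_of_tendsto ht ?_
      filter_upwards [Ioo_mem_nhdsGT (show (0:ℝ) < κ ^ 2 by positivity)] with σ hσ'
      exact hσ σ hσ'.1 hσ'.2.le
    rw [hYvol] at hlim
    simp only [mul_zero, ENNReal.ofReal_zero, zero_add] at hlim
    have h9 : ENNReal.ofReal (9 * κ ^ 2) = 9 * ENNReal.ofReal (κ ^ 2) := by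
      rw [ENNReal.ofReal_mul (by norm_num)]; norm_num
    rw [h9] at hlim
    have hd0 : ENNReal.ofReal (κ ^ d) ≠ 0 := (ENNReal.ofReal_pos.mpr (by positivity)).ne'
    have h20 : ENNReal.ofReal (κ ^ 2) ≠ 0 := (ENNReal.ofReal_pos.mpr (by positivity)).ne'
    have hfac0 : ENNReal.ofReal (κ ^ d) * ENNReal.ofReal (κ ^ 2) ≠ 0 := mul_ne_zero hd0 h20
    have hfact : ENNReal.ofReal (κ ^ d) * ENNReal.ofReal (κ ^ 2) ≠ ⊤ :=
      ENNReal.mul_ne_top ENNReal.ofReal_ne_top ENNReal.ofReal_ne_top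
    rw [← ENNReal.mul_le_mul_iff_right hfac0 hfact]
    calc _ = ENNReal.ofReal (κ ^ d) * volume (Metric.ball (0:E) 1) * ENNReal.ofReal (κ ^ 2) := by
          ring
      _ ≤ _ := hlim
      _ = _ := by ring
  have hlim := tendsto_volume_slab ha 6 28
  have hlim' : Filter.Tendsto (fun m : ℕ => ENNReal.ofReal Λ *
      (volume (slab (1 / ((m:ℝ) + 1))) * 9)) Filter.atTop (nhds (ENNReal.ofReal Λ * (0 * 9))) :=
    ENNReal.Tendsto.const_mul (ENNReal.Tendsto.mul_const hlim (Or.inr (by norm_num)))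
      (Or.inr ENNReal.ofReal_ne_top)
  have hle : volume (Metric.ball (0:E) 1) ≤ ENNReal.ofReal Λ * (0 * 9) := by
    refine ge_of_tendsto hlim' ?_
    filter_upwards [Filter.eventually_ge_atTop 7] with m hm
    refine step _ (by positivity) ?_
    have : (7:ℝ) ≤ m := by exact_mod_cast hm
    rw [div_le_div_iff₀ (by positivity) (by norm_num)]
    linarith
  simp only [zero_mul, mul_zero, nonpos_iff_eq_zero] at hle
  exact (Metric.measure_ball_pos volume (0:E) one_pos).ne' hle

end Tangent

section MinPrinciple

variable {E : Type*} [NormedAddCommGroup E] [InnerProductSpace ℝ E] [FiniteDimensional ℝ E]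
  [MeasurableSpace E] [BorelSpace E]

set_option maxHeartbeats 2000000 in
/-- Strong minimum principle, in geometric form: a closed set `Z` that can be decreased along
every tilted paraboloid contains everything in the past of each of its points. -/
theorem mem_of_descent [Nontrivial E] {Z : Set (E × ℝ)} (hZ : IsClosed Z)
    (hdesc : ∀ x' t', (x', t') ∈ Z → t' ≤ 0 → -15 < t' → ‖x'‖ < 3 → ∀ a : E, a ≠ 0 →
      ‖a‖ ≤ 1 / 4 → ∃ x t, (x, t) ∈ Z ∧ t < t' ∧
      ‖x - x'‖ ^ 2 / 2 + inner ℝ (x - x') a < t - t')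
    {xp c : E} {tp τ₀ : ℝ} (hp : (xp, tp) ∈ Z) (hxp : ‖xp‖ ≤ 2) (hc : ‖c‖ ≤ 2) (htp : tp ≤ 0)
    (hτ₀ : -5 ≤ τ₀) (hlt : τ₀ < tp) : (c, τ₀) ∈ Z := by
  by_contra hq
  -- smallness of the displacement
  have hsmall : ∀ (X a : E) (T : ℝ), ‖X‖ ^ 2 / 2 + inner ℝ X a < T → T < 0 →
      ‖X‖ ≤ 2 * ‖a‖ ∧ -(‖a‖ ^ 2 / 2) < T := by
    intro X a T h1 h2
    have h3 := abs_le.mp (abs_real_inner_le_norm X a)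
    have h4 := norm_nonneg X
    have h5 := norm_nonneg a
    constructor
    · by_contra hh
      push Not at hh
      nlinarith
    · nlinarith [sq_nonneg (‖X‖ - ‖a‖)]
  set vel : E := (tp - τ₀)⁻¹ • (xp - c) with hvel
  let ax : ℝ → E := fun t => c + (t - τ₀) • vel
  have hax : Continuous ax := by fun_prop
  have hax0 : ax τ₀ = c := by simp [ax]
  have haxp : ax tp = xp := by
    simp only [ax, hvel, smul_smul]
    rw [mul_inv_cancel₀ (by linarith), one_smul]; abel
  have haxn : ∀ t ∈ Icc τ₀ tp, ‖ax t‖ ≤ 2 := by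
    intro t ht
    have hpos : 0 < tp - τ₀ := by linarith
    have : ax t ∈ Metric.closedBall (0:E) 2 := by
      have e : ax t = (1 - (t - τ₀) / (tp - τ₀)) • c + ((t - τ₀) / (tp - τ₀)) • xp := by
        simp only [ax, hvel, smul_smul, div_eq_mul_inv]
        module
      rw [e]
      refine (convex_closedBall (0:E) 2) (by simpa using hc) (by simpa using hxp) ?_ ?_ (by ring)
      · rw [sub_nonneg, div_le_one hpos]; linarith [ht.2]
      · exact div_nonneg (by linarith [ht.1]) hpos.le
    simpa using this
  -- first time on the axis
  have hcomp : IsCompact (Icc τ₀ tp ∩ (fun t => (ax t, t)) ⁻¹' Z) :=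
    isCompact_Icc.inter_right (hZ.preimage (by fun_prop))
  obtain ⟨ts, ⟨hts, htsZ⟩, htsmin⟩ := hcomp.exists_isMinOn
    ⟨tp, ⟨hlt.le, le_rfl⟩, by simpa [haxp] using hp⟩ continuous_id.continuousOn
  have htsmin' : ∀ t, τ₀ ≤ t → t < ts → (ax t, t) ∉ Z := by
    intro t h1 h2 h3
    have : ts ≤ t := htsmin ⟨⟨h1, h2.le.trans hts.2⟩, h3⟩
    linarith
  have hts0 : τ₀ < ts := by
    refine lt_of_le_of_ne hts.1 fun h => hq ?_
    rw [← h] at htsZ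
    simpa [hax0] using htsZ
  -- a point of `Z` just below
  obtain ⟨a₀, ha₀⟩ := exists_ne (0:E)
  set V := ‖vel‖ with hV
  have hV0 : 0 ≤ V := norm_nonneg _
  obtain ⟨r, hr0, hr1, hr2⟩ : ∃ r : ℝ, 0 < r ∧ r ≤ 1 / 16 ∧ r * (1 + V) ≤ min (1 / 16) (ts - τ₀) := by
    refine ⟨min (1 / 16) (min (1 / 16) (ts - τ₀)) / (1 + V), ?_, ?_, ?_⟩
    · have : 0 < ts - τ₀ := by linarith
      positivity
    · rw [div_le_iff₀ (by positivity)]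
      refine (min_le_left _ _).trans ?_
      linarith
    · rw [div_mul_cancel₀ _ (by positivity)]
      exact min_le_right _ _
  have hrV : r * V ≤ 1 / 16 := by
    have := hr2.trans (min_le_left _ _); linarith
  have hrt : r ≤ ts - τ₀ := by
    have := hr2.trans (min_le_right _ _)
    have := mul_nonneg hr0.le hV0
    linarith
  have hrr : r ^ 2 ≤ r * (1 / 16) := by rw [sq]; exact mul_le_mul_of_nonneg_left hr1 hr0.le
  obtain ⟨xQ, tQ, hQZ, htQ, hQ⟩ := hdesc (ax ts) ts htsZ (by linarith [hts.2]) (by linarith)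
    (by linarith [haxn ts hts]) ((r / ‖a₀‖) • a₀)
    (smul_ne_zero (div_ne_zero hr0.ne' (norm_ne_zero_iff.mpr ha₀)) ha₀)
    (by rw [norm_smul, Real.norm_of_nonneg (by positivity),
      div_mul_cancel₀ _ (norm_ne_zero_iff.mpr ha₀)]; linarith)
  have hrn : ‖(r / ‖a₀‖) • a₀‖ = r := by
    rw [norm_smul, Real.norm_of_nonneg (by positivity),
      div_mul_cancel₀ _ (norm_ne_zero_iff.mpr ha₀)]
  obtain ⟨hQ1, hQ2⟩ := hsmall _ _ _ hQ (by linarith)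
  rw [hrn] at hQ1 hQ2
  have htQ0 : τ₀ < tQ := by linarith
  have haxdiff : ∀ t t', ax t - ax t' = (t - t') • vel := by
    intro t t'; simp only [ax]; module
  have hQax : ‖xQ - ax tQ‖ ≤ 1 / 4 := by
    have e : xQ - ax tQ = (xQ - ax ts) + (ts - tQ) • vel := by
      rw [← haxdiff]; abel
    rw [e]
    refine (norm_add_le _ _).trans ?_
    rw [norm_smul, Real.norm_of_nonneg (by linarith)]
    have : (ts - tQ) * V ≤ r * V := by
      gcongr
      linarith
    linarith
  -- minimise over `Z`
  obtain ⟨B, hB0, hB1, hB2⟩ : ∃ B : ℝ, 0 < B ∧ 1 < B * (tQ - τ₀) ∧ 1 < B * (ts - tQ) := by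
    have h1 : 0 < tQ - τ₀ := by linarith
    have h2 : 0 < ts - tQ := by linarith
    refine ⟨2 / (tQ - τ₀) + 2 / (ts - tQ), by positivity, ?_, ?_⟩
    · rw [add_mul, div_mul_cancel₀ _ h1.ne']
      have : 0 < 2 / (ts - tQ) * (tQ - τ₀) := by positivity
      linarith
    · rw [add_mul, div_mul_cancel₀ _ h2.ne']
      have : 0 < 2 / (tQ - τ₀) * (ts - tQ) := by positivity
      linarith
  let φ : E × ℝ → ℝ := fun z => ‖z.1 - ax z.2‖ ^ 2 / 2 + B * |z.2 - tQ|
  have hφ : Continuous φ := by fun_prop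
  have hcomp2 : IsCompact ((Metric.closedBall (0:E) (5 / 2) ×ˢ Icc τ₀ ts) ∩ Z) :=
    ((isCompact_closedBall _ _).prod isCompact_Icc).inter_right hZ
  have hxQ : ‖xQ‖ ≤ 5 / 2 := by
    have := norm_add_le (xQ - ax tQ) (ax tQ)
    rw [sub_add_cancel] at this
    linarith [haxn tQ ⟨htQ0.le, by linarith [hts.2]⟩]
  obtain ⟨⟨x', t'⟩, ⟨⟨hx'b, ht'I⟩, hx'Z⟩, hmin⟩ := hcomp2.exists_isMinOn
    ⟨(xQ, tQ), ⟨by simpa using hxQ, htQ0.le, htQ.le⟩, hQZ⟩ hφ.continuousOn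
  simp only at hx'b ht'I
  have hle : φ (x', t') ≤ 1 / 32 := by
    refine le_trans (hmin ⟨⟨by simpa using hxQ, htQ0.le, htQ.le⟩, hQZ⟩) ?_
    simp only [φ, sub_self, abs_zero, mul_zero, add_zero]
    have := pow_le_pow_left₀ (norm_nonneg _) hQax 2
    linarith
  simp only [φ] at hle
  set dd := x' - ax t' with hdd
  have hB' : B * |t' - tQ| ≤ 1 / 32 := by linarith [sq_nonneg ‖dd‖]
  have ht'0 : τ₀ < t' := by
    by_contra hh
    push Not at hh
    have : t' = τ₀ := le_antisymm hh ht'I.1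
    rw [this, abs_sub_comm, abs_of_pos (by linarith)] at hB'
    linarith
  have ht's : t' < ts := by
    by_contra hh
    push Not at hh
    have : t' = ts := le_antisymm ht'I.2 hh
    rw [this, abs_of_pos (by linarith)] at hB'
    linarith
  have hddn : ‖dd‖ ≤ 1 / 4 := by
    have : 0 ≤ B * |t' - tQ| := by positivity
    rw [← pow_le_pow_iff_left₀ (norm_nonneg _) (by norm_num) two_ne_zero]
    linarith
  have hdd0 : dd ≠ 0 := by
    intro h
    refine htsmin' t' ht'0.le ht's ?_
    rw [← sub_eq_zero.mp h]; exact hx'Z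
  have hx'n : ‖x'‖ ≤ 9 / 4 := by
    have := norm_add_le dd (ax t')
    rw [hdd, sub_add_cancel, ← hdd] at this
    linarith [haxn t' ⟨ht'I.1, by linarith [hts.2]⟩]
  obtain ⟨l, hl0, hl1, hl2, hl3⟩ : ∃ l : ℝ, 0 < l ∧ l ≤ 1 / 2 ∧ l ≤ t' - τ₀ ∧
      l * (V + V ^ 2 + B) < 1 := by
    have hpos : 0 < t' - τ₀ := by linarith
    refine ⟨min (1 / 2) (min (t' - τ₀) (1 / (2 * (V + V ^ 2 + B)))), by positivity,
      min_le_left _ _, (min_le_right _ _).trans (min_le_left _ _), ?_⟩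
    have h1 : 0 < V + V ^ 2 + B := by positivity
    have h2 : min (1 / 2) (min (t' - τ₀) (1 / (2 * (V + V ^ 2 + B)))) ≤
      1 / (2 * (V + V ^ 2 + B)) := (min_le_right _ _).trans (min_le_right _ _)
    have h3 := mul_le_mul_of_nonneg_right h2 h1.le
    have h4 : 1 / (2 * (V + V ^ 2 + B)) * (V + V ^ 2 + B) = 1 / 2 := by field_simp
    linarith
  have hln : ‖l • dd‖ ≤ 1 / 8 := by
    rw [norm_smul, Real.norm_of_nonneg hl0.le]
    have := mul_le_mul hl1 hddn (norm_nonneg _) (by norm_num)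
    linarith
  have hln' : ‖l • dd‖ ≤ l := by
    rw [norm_smul, Real.norm_of_nonneg hl0.le]
    exact mul_le_of_le_one_right hl0.le (by linarith)
  have hlsq : ‖l • dd‖ ^ 2 ≤ l := by
    rw [sq]
    have := mul_le_mul hln' hln (norm_nonneg _) hl0.le
    linarith
  obtain ⟨x, t, hxZ, htt, hxt⟩ := hdesc x' t' hx'Z (by linarith [hts.2]) (by linarith)
    (by linarith) (l • dd) (smul_ne_zero hl0.ne' hdd0) (by linarith)
  obtain ⟨hX1, hX2⟩ := hsmall _ _ _ hxt (by linarith)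
  set X := x - x' with hX
  set T := t - t' with hT
  have hT1 : -(1:ℝ) < T := by linarith
  have ht0 : τ₀ ≤ t := by linarith
  have hxn : ‖x‖ ≤ 5 / 2 := by
    have := norm_add_le X x'
    rw [hX, sub_add_cancel, ← hX] at this
    linarith
  have hge : φ (x', t') ≤ φ (x, t) := hmin ⟨⟨by simpa using hxn, ht0, by linarith⟩, hxZ⟩
  simp only [φ] at hge
  have e1 : x - ax t = dd + (X - T • vel) := by
    rw [hT, ← haxdiff]; simp only [hdd, hX]; abel
  have e2 : ‖X - T • vel‖ ^ 2 ≤ 2 * ‖X‖ ^ 2 + 2 * T ^ 2 * V ^ 2 := by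
    have h1 := norm_sub_le X (T • vel)
    rw [norm_smul, Real.norm_eq_abs] at h1
    have h2 : ‖X - T • vel‖ ^ 2 ≤ (‖X‖ + |T| * V) ^ 2 := by gcongr
    have h3 := add_sq_le (a := ‖X‖) (b := |T| * V)
    rw [mul_pow, sq_abs] at h3
    linarith
  have e3 : |t - tQ| ≤ |t' - tQ| + -T := by
    have := abs_add_le (t' - tQ) T
    rw [show t' - tQ + T = t - tQ by rw [hT]; ring, abs_of_neg (show T < 0 by linarith)] at this
    exact this
  rw [inner_smul_right, real_inner_comm] at hxt
  have e4 : inner ℝ dd (X - T • vel) ≤ inner ℝ dd X + (-T) * V := by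
    rw [inner_sub_right, inner_smul_right]
    have h1 := abs_le.mp (abs_real_inner_le_norm dd vel)
    have h2 : ‖dd‖ * V ≤ V := mul_le_of_le_one_left hV0 (by linarith)
    have h3 := mul_le_mul_of_nonneg_left (h1.2.trans h2) (show 0 ≤ -T by linarith)
    linarith
  rw [e1, norm_add_sq_real] at hge
  have e5 : B * |t - tQ| ≤ B * |t' - tQ| + B * -T := by
    rw [← mul_add]
    gcongr
  have e6 : T ^ 2 * V ^ 2 ≤ (-T) * V ^ 2 := by
    have : T ^ 2 ≤ -T := by
      have := mul_le_mul_of_nonneg_left (show -T ≤ 1 by linarith) (show 0 ≤ -T by linarith)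
      linarith
    gcongr
  have e7 : 0 ≤ inner ℝ dd X + ‖X‖ ^ 2 + (-T) * (V + V ^ 2 + B) := by linarith
  have e8 := mul_le_mul_of_nonneg_left e7 hl0.le
  have e9 : l * ‖X‖ ^ 2 ≤ ‖X‖ ^ 2 / 2 := by
    have := mul_le_mul_of_nonneg_right hl1 (sq_nonneg ‖X‖)
    linarith
  have e10 : (-T) * (l * (V + V ^ 2 + B)) < -T := by
    have := mul_lt_mul_of_pos_left hl3 (show 0 < -T by linarith)
    linarith
  linarith

end MinPrinciple

section Osc

variable {E : Type*} [NormedAddCommGroup E] [InnerProductSpace ℝ E] [FiniteDimensional ℝ E]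
  [MeasurableSpace E] [BorelSpace E]
variable {𝒰 : Ultrafilter ℕ} {v : ℕ → E → ℝ → ℝ} {F : ℕ → E → ℝ} {ω : ℕ → ℝ} {Λ : ℝ}

theorem eventually_volume_le (hest : ∀ k, ContactEstimate (v k) (F k) (ω k))
    (hω : Filter.Tendsto ω 𝒰 (nhds 0))
    (hcont : ∀ k, ContinuousOn (fun z : E × ℝ => v k z.1 z.2) (univ ×ˢ Iio 0))
    (hZ : Metric.closedBall (0:E) 1 ×ˢ Icc (-3:ℝ) (-3 / 2) ⊆ limZ (𝒰 : Filter ℕ) v)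
    {ε δ : ℝ} (hε : 0 < ε) (hδ : 0 < δ) :
    ∀ᶠ k in (𝒰 : Filter ℕ), volume (Metric.closedBall (0:E) (1 - δ) ×ˢ Icc (-3 + δ) (-2 - δ)) ≤
      ∫⁻ z in (Metric.closedBall (0:E) 1 ×ˢ Icc (-3:ℝ) (-2)) ∩ {z | v k z.1 z.2 < ε},
        ENNReal.ofReal (F k z.1) := by
  set h := min (min (δ ^ 2 / 8) (δ / 3)) (min (ε / 5) (1 / 4)) with hh
  have h0 : 0 < h := by positivity
  have h1 : h ≤ δ ^ 2 / 8 := (min_le_left _ _).trans (min_le_left _ _)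
  have h2 : h ≤ δ / 3 := (min_le_left _ _).trans (min_le_right _ _)
  have h3 : h ≤ ε / 5 := (min_le_right _ _).trans (min_le_left _ _)
  have h4 : h ≤ 1 / 4 := (min_le_right _ _).trans (min_le_right _ _)
  clear_value h
  have hωev : ∀ᶠ k in (𝒰 : Filter ℕ), ω k < h / 8 := hω.eventually_lt_const (by positivity)
  filter_upwards [eventually_exists_of_subset ((isCompact_closedBall (0:E) 1).prod isCompact_Icc)
    hZ (show 0 < h / 4 by positivity), hωev] with k hk hωk
  have hopen : IsOpen ((univ ×ˢ Iio (0:ℝ)) ∩ {z : E × ℝ | v k z.1 z.2 < ε}) :=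
    (hcont k).isOpen_inter_preimage (isOpen_univ.prod isOpen_Iio) isOpen_Iio
  have hGm : MeasurableSet ((Metric.closedBall (0:E) 1 ×ˢ Icc (-3:ℝ) (-2)) ∩
      {z | v k z.1 z.2 < ε}) := by
    have e : (Metric.closedBall (0:E) 1 ×ˢ Icc (-3:ℝ) (-2)) ∩ {z | v k z.1 z.2 < ε} =
        (Metric.closedBall (0:E) 1 ×ˢ Icc (-3:ℝ) (-2)) ∩
          ((univ ×ˢ Iio (0:ℝ)) ∩ {z : E × ℝ | v k z.1 z.2 < ε}) := by
      ext z
      refine ⟨fun hz => ⟨hz.1, ⟨mem_univ _, ?_⟩, hz.2⟩, fun hz => ⟨hz.1, hz.2.2⟩⟩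
      have := hz.1.2.2
      exact this.trans_lt (by norm_num)
    rw [e]
    exact (measurableSet_closedBall.prod measurableSet_Icc).inter hopen.measurableSet
  refine hest k 1 one_pos (-2) (by norm_num) _ hGm _ ?_
  rintro ⟨y, s⟩ ⟨hy, hs⟩
  have hy' : ‖y‖ ≤ 1 - δ := by simpa using hy
  simp only [mem_Icc] at hs
  obtain ⟨⟨x₁, t₁⟩, hD, hd, hsm⟩ := hk (y, s + 2 * h) ⟨by simpa using (by linarith : ‖y‖ ≤ 1),
    by simp only; linarith, by simp only; linarith⟩
  rw [Prod.dist_eq, max_lt_iff, dist_eq_norm, Real.dist_eq] at hd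
  simp only at hd hsm
  have hd2 := abs_lt.mp hd.2
  refine ⟨x₁, t₁, hD.1, hD.2.1, by linarith, ?_, ?_⟩
  · have : ‖x₁ - y‖ ^ 2 ≤ h / 4 := by
      rw [sq]
      have := mul_le_mul hd.1.le (show ‖x₁ - y‖ ≤ 1 by linarith) (norm_nonneg _)
        (show 0 ≤ h / 4 by positivity)
      linarith
    simp only [div_one]
    linarith
  · intro x t hx ht ht1 hpar hvle
    simp only at hpar hvle
    have hxy : ‖x - y‖ ≤ δ := by
      rw [← pow_le_pow_iff_left₀ (norm_nonneg _) hδ.le two_ne_zero]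
      linarith
    have hx1 : ‖x‖ ≤ 1 := by
      have := norm_add_le (x - y) y
      rw [sub_add_cancel] at this
      linarith
    have : 0 ≤ ‖x - y‖ ^ 2 := by positivity
    refine ⟨⟨⟨by simpa using hx1, by simp only; linarith, by simp only; linarith⟩, ?_⟩,
      by linarith, by linarith⟩
    simp only [Set.mem_ofPred_eq]
    linarith

theorem limZ_past [Nontrivial E] (hest : ∀ k, ContactEstimate (v k) (F k) (ω k))
    (hF : ∀ k x, F k x ≤ Λ) (hω : Filter.Tendsto ω 𝒰 (nhds 0))
    {x : ℕ → E} {t : ℕ → ℝ} (hx : ∀ k, ‖x k‖ ≤ 1) (ht : ∀ k, t k ∈ Ico (-1:ℝ) 0)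
    (hsmall : Filter.Tendsto (fun k => v k (x k) (t k)) 𝒰 (nhds 0)) :
    Metric.closedBall (0:E) 1 ×ˢ Icc (-3:ℝ) (-3 / 2) ⊆ limZ (𝒰 : Filter ℕ) v := by
  have hcomp : IsCompact (Metric.closedBall (0:E) 1 ×ˢ Icc (-1:ℝ) 0) :=
    (isCompact_closedBall _ _).prod isCompact_Icc
  obtain ⟨⟨xp, tp⟩, ⟨hxp, htp⟩, hlim⟩ := hcomp.ultrafilter_le_nhds
    (𝒰.map fun k => (x k, t k)) (by
      rw [Filter.le_principal_iff]
      have hmem : ∀ k, (x k, t k) ∈ Metric.closedBall (0:E) 1 ×ˢ Icc (-1:ℝ) 0 := fun k =>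
        ⟨by simpa using hx k, (ht k).1, (ht k).2.le⟩
      exact Ultrafilter.mem_map.mpr (Filter.Eventually.of_forall hmem))
  have hlim' : Filter.Tendsto (fun k => (x k, t k)) (𝒰 : Filter ℕ) (nhds (xp, tp)) := hlim
  have hp : (xp, tp) ∈ limZ (𝒰 : Filter ℕ) v := by
    intro ε hε
    filter_upwards [hlim'.eventually (Metric.ball_mem_nhds _ hε),
      hsmall.eventually_lt_const hε] with k hk hk'
    exact ⟨(x k, t k), ⟨(hx k).trans (by norm_num), (by norm_num : (-16:ℝ) ≤ -1).trans (ht k).1,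
      (ht k).2⟩, hk, hk'⟩
  have hxp' : ‖xp‖ ≤ 1 := by simpa using hxp
  simp only [mem_Icc] at htp
  rintro ⟨c, τ₀⟩ ⟨hc, hτ₀⟩
  have hc' : ‖c‖ ≤ 1 := by simpa using hc
  simp only [mem_Icc] at hτ₀
  refine mem_of_descent isClosed_limZ ?_ hp (by linarith) (by linarith) htp.2 (by linarith)
    (by linarith)
  intro x' t' h1 h2 h3 h4 a ha ha'
  exact exists_mem_limZ_below hest hF hω h1 h2 h3 h4 ha ha'

theorem exists_shrink (d : ℕ) : ∃ δ : ℝ, 0 < δ ∧ δ ≤ 1 / 4 ∧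
    3 / 2 < 2 * ((1 - δ) ^ d * (1 - 2 * δ)) := by
  have hc : Filter.Tendsto (fun δ : ℝ => 2 * ((1 - δ) ^ d * (1 - 2 * δ))) (nhdsWithin 0 (Ioi 0))
      (nhds (2 * ((1 - 0) ^ d * (1 - 2 * 0)))) := by
    refine (Continuous.tendsto (f := fun δ : ℝ => 2 * ((1 - δ) ^ d * (1 - 2 * δ)))
      (by fun_prop) 0).mono_left nhdsWithin_le_nhds
  have h2 : (3:ℝ) / 2 < 2 * ((1 - 0) ^ d * (1 - 2 * 0)) := by norm_num
  obtain ⟨δ, h3, h4⟩ := ((hc.eventually_const_lt h2).and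
    (Ioo_mem_nhdsGT (show (0:ℝ) < 1 / 4 by norm_num))).exists
  exact ⟨δ, h4.1, h4.2.le, h3⟩

theorem false_of_limit [Nontrivial E] {v' : ℕ → E → ℝ → ℝ}
    (hest : ∀ k, ContactEstimate (v k) (F k) (ω k))
    (hest' : ∀ k, ContactEstimate (v' k) (F k) (ω k))
    (hsum : ∀ k x t, v k x t + v' k x t = 2)
    (hF : ∀ k x, F k x ≤ Λ) (hω : Filter.Tendsto ω 𝒰 (nhds 0))
    (hcont : ∀ k, ContinuousOn (fun z : E × ℝ => v k z.1 z.2) (univ ×ˢ Iio 0))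
    (hcont' : ∀ k, ContinuousOn (fun z : E × ℝ => v' k z.1 z.2) (univ ×ˢ Iio 0))
    (hFm : ∀ k, Measurable (F k))
    (hFint : ∀ k, ∫⁻ x in Metric.closedBall (0:E) 1, ENNReal.ofReal (F k x) ≤
      ENNReal.ofReal (3 / 2) * volume (Metric.closedBall (0:E) 1))
    {x x' : ℕ → E} {t t' : ℕ → ℝ} (hx : ∀ k, ‖x k‖ ≤ 1) (ht : ∀ k, t k ∈ Ico (-1:ℝ) 0)
    (hx' : ∀ k, ‖x' k‖ ≤ 1) (ht' : ∀ k, t' k ∈ Ico (-1:ℝ) 0)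
    (hsmall : Filter.Tendsto (fun k => v k (x k) (t k)) 𝒰 (nhds 0))
    (hsmall' : Filter.Tendsto (fun k => v' k (x' k) (t' k)) 𝒰 (nhds 0)) : False := by
  obtain ⟨δ, hδ0, hδ1, hδ⟩ := exists_shrink (Module.finrank ℝ E)
  have hA := eventually_volume_le hest hω hcont (limZ_past hest hF hω hx ht hsmall)
    (show (0:ℝ) < 1 / 2 by norm_num) hδ0
  have hB := eventually_volume_le hest' hω hcont' (limZ_past hest' hF hω hx' ht' hsmall')
    (show (0:ℝ) < 1 / 2 by norm_num) hδ0
  obtain ⟨k, hk1, hk2⟩ := (hA.and hB).exists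
  set Bx : Set (E × ℝ) := Metric.closedBall (0:E) 1 ×ˢ Icc (-3:ℝ) (-2) with hBx
  have hBxm : MeasurableSet Bx := measurableSet_closedBall.prod measurableSet_Icc
  have hdis : Disjoint (Bx ∩ {z | v k z.1 z.2 < 1 / 2}) (Bx ∩ {z | v' k z.1 z.2 < 1 / 2}) := by
    refine Set.disjoint_left.mpr fun z h1 h2 => ?_
    have h3 : v k z.1 z.2 < 1 / 2 := h1.2
    have h4 : v' k z.1 z.2 < 1 / 2 := h2.2
    linarith [hsum k z.1 z.2]
  have hopen : IsOpen ((univ ×ˢ Iio (0:ℝ)) ∩ {z : E × ℝ | v' k z.1 z.2 < 1 / 2}) :=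
    (hcont' k).isOpen_inter_preimage (isOpen_univ.prod isOpen_Iio) isOpen_Iio
  have hGm : MeasurableSet (Bx ∩ {z | v' k z.1 z.2 < 1 / 2}) := by
    have e : Bx ∩ {z | v' k z.1 z.2 < 1 / 2} =
        Bx ∩ ((univ ×ˢ Iio (0:ℝ)) ∩ {z : E × ℝ | v' k z.1 z.2 < 1 / 2}) := by
      ext z
      refine ⟨fun hz => ⟨hz.1, ⟨mem_univ _, ?_⟩, hz.2⟩, fun hz => ⟨hz.1, hz.2.2⟩⟩
      exact (show z.2 ≤ -2 from hz.1.2.2).trans_lt (by norm_num)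
    rw [e]
    exact hBxm.inter hopen.measurableSet
  have hsumle := add_le_add hk1 hk2
  rw [← lintegral_union hGm hdis] at hsumle
  have h1 : ∫⁻ z in Bx, ENNReal.ofReal (F k z.1) ≤
      ENNReal.ofReal (3 / 2) * volume (Metric.closedBall (0:E) 1) := by
    refine le_trans (le_of_eq ?_) (hFint k)
    rw [hBx, Measure.volume_eq_prod, ← Measure.prod_restrict,
      lintegral_prod _ (by fun_prop)]
    simp only [lintegral_const, Measure.restrict_apply MeasurableSet.univ, univ_inter,
      Real.volume_Icc]
    norm_num
  have h2 := (hsumle.trans (lintegral_mono_set (union_subset inter_subset_left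
    inter_subset_left))).trans h1
  rw [Measure.volume_eq_prod, Measure.prod_prod, Real.volume_Icc,
    Measure.addHaar_closedBall_eq_addHaar_ball, Measure.addHaar_closedBall_eq_addHaar_ball,
    Measure.addHaar_ball_of_pos _ _ (show 0 < 1 - δ by linarith)] at h2
  set b := volume (Metric.ball (0:E) 1) with hb
  have hb0 : b ≠ 0 := (Metric.measure_ball_pos volume (0:E) one_pos).ne'
  have hbt : b ≠ ⊤ := measure_ball_lt_top.ne
  have h3 : ENNReal.ofReal (2 * ((1 - δ) ^ Module.finrank ℝ E * (1 - 2 * δ))) * b ≤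
      ENNReal.ofReal (3 / 2) * b := by
    refine le_trans (le_of_eq ?_) h2
    have hp1 : 0 ≤ (1 - δ) ^ Module.finrank ℝ E := pow_nonneg (by linarith) _
    rw [show -2 - δ - (-3 + δ) = 1 - 2 * δ by ring, ENNReal.ofReal_mul (by norm_num),
      ENNReal.ofReal_mul hp1, ENNReal.ofReal_ofNat]
    ring
  rw [ENNReal.mul_le_mul_iff_left hb0 hbt, ENNReal.ofReal_le_ofReal_iff (by norm_num)] at h3
  linarith

/-- Oscillation decay for differences of solutions close to the model `½|x|² - t`. -/
theorem osc_decay (E : Type*) [NormedAddCommGroup E] [InnerProductSpace ℝ E]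
    [FiniteDimensional ℝ E] [MeasurableSpace E] [BorelSpace E] [Nontrivial E] (Λ : ℝ) :
    ∃ γ : ℝ, 0 < γ ∧ γ < 1 ∧ ∀ (F : E → ℝ) (u ũ : E → ℝ → ℝ) (p pt : E → ℝ → E)
      (H Ht : E → ℝ → E →L[ℝ] E) (w wt : E → ℝ → ℝ), Sol F u p H w → Sol F ũ pt Ht wt →
      (∀ x, F x ≤ Λ) →
      ∫⁻ x in Metric.closedBall (0:E) 1, ENNReal.ofReal (F x) ≤
        ENNReal.ofReal (3 / 2) * volume (Metric.closedBall (0:E) 1) →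
      (∀ z ∈ Dom E, |u z.1 z.2 - (‖z.1‖ ^ 2 / 2 - z.2)| ≤ γ) →
      (∀ z ∈ Dom E, |ũ z.1 z.2 - (‖z.1‖ ^ 2 / 2 - z.2)| ≤ γ) →
      ∀ c > 0, ∀ b : ℝ, (∀ z ∈ Dom E, (ũ z.1 z.2 - u z.1 z.2) / c + b ∈ Icc (0:ℝ) 2) →
      ∀ x x' : E, ∀ t t' : ℝ, ‖x‖ ≤ 1 → ‖x'‖ ≤ 1 → t ∈ Ico (-1:ℝ) 0 → t' ∈ Ico (-1:ℝ) 0 →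
        ((ũ x' t' - u x' t') / c + b) - ((ũ x t - u x t) / c + b) ≤ 2 - γ := by
  by_contra hcon
  push Not at hcon
  have hex : ∀ k : ℕ, ∃ (v v' : E → ℝ → ℝ) (F : E → ℝ) (x x' : E) (t t' : ℝ),
      ContactEstimate v F (1 / ((k:ℝ) + 2)) ∧ ContactEstimate v' F (1 / ((k:ℝ) + 2)) ∧
      (∀ x t, v x t + v' x t = 2) ∧ (∀ x, F x ≤ Λ) ∧
      ContinuousOn (fun z : E × ℝ => v z.1 z.2) (univ ×ˢ Iio 0) ∧
      ContinuousOn (fun z : E × ℝ => v' z.1 z.2) (univ ×ˢ Iio 0) ∧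
      Measurable F ∧ (∫⁻ x in Metric.closedBall (0:E) 1, ENNReal.ofReal (F x) ≤
        ENNReal.ofReal (3 / 2) * volume (Metric.closedBall (0:E) 1)) ∧
      ‖x‖ ≤ 1 ∧ t ∈ Ico (-1:ℝ) 0 ∧ ‖x'‖ ≤ 1 ∧ t' ∈ Ico (-1:ℝ) 0 ∧
      (0 ≤ v x t ∧ v x t ≤ 1 / ((k:ℝ) + 2)) ∧ (0 ≤ v' x' t' ∧ v' x' t' ≤ 1 / ((k:ℝ) + 2)) := by
    intro k
    have hpos : 0 < 1 / ((k:ℝ) + 2) := by positivity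
    have hlt : 1 / ((k:ℝ) + 2) < 1 := by
      rw [div_lt_one (by positivity)]
      have : (0:ℝ) ≤ k := by positivity
      linarith
    obtain ⟨F, u, ũ, p, pt, H, Ht, w, wt, h, ht, hF, hFi, hu, hũ, c, hc, b, hv, x, x', t, t',
      hx, hx', htm, htm', hgt⟩ := hcon _ hpos hlt
    have hD : ∀ {x : E} {t : ℝ}, ‖x‖ ≤ 1 → t ∈ Ico (-1:ℝ) 0 → (x, t) ∈ Dom E := fun h1 h2 =>
      ⟨h1.trans (by norm_num), (by norm_num : (-16:ℝ) ≤ -1).trans h2.1, h2.2⟩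
    have h1 := hv _ (hD hx htm)
    have h2 := hv _ (hD hx' htm')
    simp only [mem_Icc] at h1 h2
    have hswap : ∀ x t, (u x t - ũ x t) / c + (2 - b) = 2 - ((ũ x t - u x t) / c + b) := by
      intro x t; ring
    refine ⟨fun x t => (ũ x t - u x t) / c + b, fun x t => (u x t - ũ x t) / c + (2 - b), F,
      x, x', t, t', contactEstimate h ht hc b hpos hũ fun z hz => (hv z hz).1,
      contactEstimate ht h hc (2 - b) hpos hu fun z hz => ?_, fun x t => ?_, hF, ?_, ?_,
      h.cont_F.measurable, hFi, hx, htm, hx', htm', ⟨h1.1, by linarith⟩, ?_, ?_⟩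
    · rw [hswap]; linarith [(hv z hz).2]
    · simp only [hswap]; ring
    · exact ((ht.cont_u.sub h.cont_u).div_const c).add continuousOn_const
    · exact ((h.cont_u.sub ht.cont_u).div_const c).add continuousOn_const
    · simp only [hswap]; linarith
    · simp only [hswap]; linarith
  choose v v' F x x' t t' h1 h2 h3 h4 h5 h6 h7 h8 h9 h10 h11 h12 h13 h14 using hex
  have hlim : Filter.Tendsto (fun k : ℕ => 1 / ((k:ℝ) + 2)) (Filter.hyperfilter ℕ : Filter ℕ)
      (nhds 0) := by
    have : Filter.Tendsto (fun k : ℕ => 1 / ((k:ℝ) + 2)) Filter.atTop (nhds 0) :=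
      tendsto_const_nhds.div_atTop
        (Filter.tendsto_atTop_add_const_right _ _ tendsto_natCast_atTop_atTop)
    refine this.mono_left ?_
    rw [← Nat.cofinite_eq_atTop]
    exact Filter.hyperfilter_le_cofinite
  exact false_of_limit (𝒰 := Filter.hyperfilter ℕ) h1 h2 h3 h4 hlim h5 h6 h7 h8 h9 h10 h11 h12
    (squeeze_zero (fun k => (h13 k).1) (fun k => (h13 k).2) hlim)
    (squeeze_zero (fun k => (h14 k).1) (fun k => (h14 k).2) hlim)

end Osc

section Transform

variable {E : Type*} [NormedAddCommGroup E] [InnerProductSpace ℝ E] [FiniteDimensional ℝ E]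
  [MeasurableSpace E] [BorelSpace E]
variable {F : E → ℝ} {u ũ : E → ℝ → ℝ} {p pt : E → ℝ → E} {H Ht : E → ℝ → E →L[ℝ] E}
  {w wt : E → ℝ → ℝ}

theorem affine_time_neg {ρ h t : ℝ} (hρ : 0 < ρ) (hh : 0 ≤ h) (ht : t < 0) :
    ρ ^ 2 * t - h < 0 := by
  have : ρ ^ 2 * t < 0 := mul_neg_of_pos_of_neg (by positivity) ht
  linarith

theorem continuousOn_comp_affine {Y : Type*} [TopologicalSpace Y] {f : E → ℝ → Y}
    (hf : ContinuousOn (fun z : E × ℝ => f z.1 z.2) (univ ×ˢ Iio 0)) (X₀ : E) {ρ h : ℝ}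
    (hρ : 0 < ρ) (hh : 0 ≤ h) :
    ContinuousOn (fun z : E × ℝ => f (X₀ + ρ • z.1) (ρ ^ 2 * z.2 - h)) (univ ×ˢ Iio 0) :=
  hf.comp (f := fun z : E × ℝ => (X₀ + ρ • z.1, ρ ^ 2 * z.2 - h)) (by fun_prop)
    (fun _ hz => ⟨mem_univ _, affine_time_neg hρ hh hz.2⟩)

theorem Sol.transform (hs : Sol F u p H w) (X₀ : E) {ρ h : ℝ} (hρ : 0 < ρ) (hh : 0 ≤ h)
    (a : E) (b : ℝ) :
    Sol (fun x => F (X₀ + ρ • x))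
      (fun x t => (ρ ^ 2)⁻¹ * (u (X₀ + ρ • x) (ρ ^ 2 * t - h) - inner ℝ a x - b))
      (fun x t => ρ⁻¹ • p (X₀ + ρ • x) (ρ ^ 2 * t - h) - (ρ ^ 2)⁻¹ • a)
      (fun x t => H (X₀ + ρ • x) (ρ ^ 2 * t - h))
      (fun x t => w (X₀ + ρ • x) (ρ ^ 2 * t - h)) := by
  have hneg : ∀ {t : ℝ}, t < 0 → ρ ^ 2 * t - h < 0 := fun ht => affine_time_neg hρ hh ht
  have haff : ∀ x : E, HasFDerivAt (fun x : E => X₀ + ρ • x) (ρ • ContinuousLinearMap.id ℝ E) x :=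
    fun x => ((hasFDerivAt_id x).const_smul ρ).const_add X₀
  refine ⟨?_, ?_, continuousOn_comp_affine hs.cont_H X₀ hρ hh, continuousOn_comp_affine hs.cont_w X₀ hρ hh, ?_, ?_, ?_, fun t ht x => hs.symm _ (hneg ht) _,
    fun t ht x => hs.pos _ (hneg ht) _, fun t ht x => hs.wpos _ (hneg ht) _,
    fun t ht x => hs.eq _ (hneg ht) _⟩
  · refine continuousOn_const.mul ((ContinuousOn.sub ?_ ?_).sub continuousOn_const)
    · exact continuousOn_comp_affine hs.cont_u X₀ hρ hh
    · fun_prop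
  · exact ((continuousOn_comp_affine hs.cont_p X₀ hρ hh).const_smul ρ⁻¹).sub continuousOn_const
  · intro t ht x
    have h1 := hs.grad _ (hneg ht) (X₀ + ρ • x)
    rw [hasGradientAt_iff_hasFDerivAt] at h1 ⊢
    have h2 := h1.comp x (haff x)
    have h3 : HasFDerivAt (fun y : E => inner ℝ a y) (innerSL ℝ a : E →L[ℝ] ℝ) x :=
      (innerSL ℝ a : E →L[ℝ] ℝ).hasFDerivAt
    refine (((h2.sub h3).sub_const b).const_mul (ρ ^ 2)⁻¹).congr_fderiv ?_
    ext v
    simp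
    field_simp
  · intro t ht x
    have h1 := (hs.hess _ (hneg ht) (X₀ + ρ • x)).comp x (haff x)
    refine ((h1.const_smul ρ⁻¹).sub_const _).congr_fderiv ?_
    ext v
    simp [smul_smul, inv_mul_cancel₀ hρ.ne']
  · intro t ht x
    have h1 : HasDerivAt (fun t : ℝ => ρ ^ 2 * t - h) (ρ ^ 2) t := by
      simpa using ((hasDerivAt_id t).const_mul (ρ ^ 2)).sub_const h
    have h2 := (hs.tder _ (hneg ht) (X₀ + ρ • x)).comp t h1
    refine (((h2.sub_const (inner ℝ a x)).sub_const b).const_mul (ρ ^ 2)⁻¹).congr_deriv ?_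
    field_simp

/-- Oscillation decay at scale `ρ` around `X₀`. -/
theorem osc_decay_scaled (E : Type*) [NormedAddCommGroup E] [InnerProductSpace ℝ E]
    [FiniteDimensional ℝ E] [MeasurableSpace E] [BorelSpace E] [Nontrivial E] (Λ : ℝ) :
    ∃ γ : ℝ, 0 < γ ∧ γ < 1 ∧ ∀ (F : E → ℝ) (u ũ : E → ℝ → ℝ) (p pt : E → ℝ → E)
      (H Ht : E → ℝ → E →L[ℝ] E) (w wt : E → ℝ → ℝ), Sol F u p H w → Sol F ũ pt Ht wt →
      (∀ x, F x ≤ Λ) → ∀ (X₀ a : E) (b ρ : ℝ), 0 < ρ →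
      ∫⁻ x in Metric.closedBall X₀ ρ, ENNReal.ofReal (F x) ≤
        ENNReal.ofReal (3 / 2) * volume (Metric.closedBall X₀ ρ) →
      (∀ y t, ‖y - X₀‖ ≤ 4 * ρ → -(16 * ρ ^ 2) ≤ t → t < 0 →
        |u y t - (‖y - X₀‖ ^ 2 / 2 - t + inner ℝ a (y - X₀) + b)| ≤ γ * ρ ^ 2) →
      (∀ y t, ‖y - X₀‖ ≤ 4 * ρ → -(16 * ρ ^ 2) ≤ t → t < 0 →
        |ũ y t - (‖y - X₀‖ ^ 2 / 2 - t + inner ℝ a (y - X₀) + b)| ≤ γ * ρ ^ 2) →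
      ∀ m o : ℝ, 0 < o → (∀ y t, ‖y - X₀‖ ≤ 4 * ρ → -(16 * ρ ^ 2) ≤ t → t < 0 →
        m ≤ ũ y t - u y t ∧ ũ y t - u y t ≤ m + o) →
      ∀ y y' t t', ‖y - X₀‖ ≤ ρ → ‖y' - X₀‖ ≤ ρ → t ∈ Ico (-ρ ^ 2) 0 → t' ∈ Ico (-ρ ^ 2) 0 →
        (ũ y' t' - u y' t') - (ũ y t - u y t) ≤ (1 - γ / 2) * o := by
  obtain ⟨γ, hγ0, hγ1, hγ⟩ := osc_decay E Λ
  refine ⟨γ, hγ0, hγ1, ?_⟩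
  intro F u ũ p pt H Ht w wt hu hũ hF X₀ a b ρ hρ havg hcu hcũ m o ho hosc y y' t t' hy hy' ht ht'
  have hρ2 : 0 < ρ ^ 2 := by positivity
  have hD : ∀ z ∈ Dom E, ‖X₀ + ρ • z.1 - X₀‖ ≤ 4 * ρ ∧ -(16 * ρ ^ 2) ≤ ρ ^ 2 * z.2 - 0 ∧
      ρ ^ 2 * z.2 - 0 < 0 := by
    intro z hz
    refine ⟨?_, ?_, ?_⟩
    · rw [add_sub_cancel_left, norm_smul, Real.norm_of_nonneg hρ.le]
      nlinarith [hz.1]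
    · nlinarith [hz.2.1]
    · rw [sub_zero]; exact mul_neg_of_pos_of_neg hρ2 hz.2.2
  have hclose : ∀ g : E → ℝ → ℝ, (∀ y t, ‖y - X₀‖ ≤ 4 * ρ → -(16 * ρ ^ 2) ≤ t → t < 0 →
        |g y t - (‖y - X₀‖ ^ 2 / 2 - t + inner ℝ a (y - X₀) + b)| ≤ γ * ρ ^ 2) →
      ∀ z ∈ Dom E, |(ρ ^ 2)⁻¹ * (g (X₀ + ρ • z.1) (ρ ^ 2 * z.2 - 0) - inner ℝ (ρ • a) z.1 - b) -
        (‖z.1‖ ^ 2 / 2 - z.2)| ≤ γ := by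
    intro g hg z hz
    obtain ⟨h1, h2, h3⟩ := hD z hz
    have h4 := hg _ _ h1 h2 h3
    rw [add_sub_cancel_left, norm_smul, Real.norm_of_nonneg hρ.le, inner_smul_right] at h4
    rw [inner_smul_left]
    have e : (ρ ^ 2)⁻¹ * (g (X₀ + ρ • z.1) (ρ ^ 2 * z.2 - 0) -
        (starRingEnd ℝ) ρ * inner ℝ a z.1 - b) - (‖z.1‖ ^ 2 / 2 - z.2) =
        (ρ ^ 2)⁻¹ * (g (X₀ + ρ • z.1) (ρ ^ 2 * z.2 - 0) - ((ρ * ‖z.1‖) ^ 2 / 2 -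
          (ρ ^ 2 * z.2 - 0) + ρ * inner ℝ a z.1 + b)) := by
      simp only [conj_trivial]
      field_simp
      ring
    rw [e, abs_mul, abs_of_pos (inv_pos.mpr hρ2), inv_mul_le_iff₀ hρ2]
    linarith
  have hball : ∫⁻ x in Metric.closedBall (0:E) 1, ENNReal.ofReal (F (X₀ + ρ • x)) ≤
      ENNReal.ofReal (3 / 2) * volume (Metric.closedBall (0:E) 1) := by
    have himg : (fun x : E => X₀ + ρ • x) '' Metric.closedBall (0:E) 1 =
        Metric.closedBall X₀ ρ := by
      have := affinity_unitClosedBall hρ.le X₀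
      rw [← this]
      ext z
      simp [Set.mem_smul_set, Set.mem_vadd_set]
    have hder : ∀ x ∈ Metric.closedBall (0:E) 1, HasFDerivWithinAt (fun x : E => X₀ + ρ • x)
        (ρ • ContinuousLinearMap.id ℝ E) (Metric.closedBall (0:E) 1) x := fun x _ =>
      (((hasFDerivAt_id x).const_smul ρ).const_add X₀).hasFDerivWithinAt
    have hinj : InjOn (fun x : E => X₀ + ρ • x) (Metric.closedBall (0:E) 1) := by
      intro x _ y _ hxy
      exact smul_right_injective E hρ.ne' (add_left_cancel hxy)
    have hcv := lintegral_image_eq_lintegral_abs_det_fderiv_mul volume measurableSet_closedBall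
      hder hinj (fun x => ENNReal.ofReal (F x))
    have hdet : |(ρ • ContinuousLinearMap.id ℝ E).det| = ρ ^ Module.finrank ℝ E := by
      have : (ρ • ContinuousLinearMap.id ℝ E).det =
          LinearMap.det (ρ • (LinearMap.id : E →ₗ[ℝ] E)) := rfl
      rw [this, LinearMap.det_smul, LinearMap.det_id, mul_one, abs_of_pos (by positivity)]
    rw [himg] at hcv
    simp only [hdet] at hcv
    rw [lintegral_const_mul _ (by
      exact (hu.cont_F.comp (by fun_prop)).measurable.ennreal_ofReal)] at hcv
    rw [hcv, Measure.addHaar_closedBall _ _ hρ.le,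
      ← Measure.addHaar_closedBall_eq_addHaar_ball, mul_left_comm] at havg
    rwa [ENNReal.mul_le_mul_iff_right (ENNReal.ofReal_pos.mpr (by positivity)).ne'
      ENNReal.ofReal_ne_top] at havg
  have hdiff : ∀ x t, ((ρ ^ 2)⁻¹ * (ũ (X₀ + ρ • x) (ρ ^ 2 * t - 0) - inner ℝ (ρ • a) x - b) -
      (ρ ^ 2)⁻¹ * (u (X₀ + ρ • x) (ρ ^ 2 * t - 0) - inner ℝ (ρ • a) x - b)) /
      ((ρ ^ 2)⁻¹ * o / 2) + -(2 * m / o) =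
      2 * (ũ (X₀ + ρ • x) (ρ ^ 2 * t - 0) - u (X₀ + ρ • x) (ρ ^ 2 * t - 0) - m) / o := by
    intro x t
    field_simp
    ring
  have main := hγ _ _ _ _ _ _ _ _ _ (hu.transform X₀ hρ le_rfl (ρ • a) b)
    (hũ.transform X₀ hρ le_rfl (ρ • a) b) (fun x => hF _) hball (hclose u hcu) (hclose ũ hcũ)
    ((ρ ^ 2)⁻¹ * o / 2) (by positivity) (-(2 * m / o)) ?_ (ρ⁻¹ • (y - X₀)) (ρ⁻¹ • (y' - X₀))
    ((ρ ^ 2)⁻¹ * t) ((ρ ^ 2)⁻¹ * t') ?_ ?_ ?_ ?_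
  · rw [hdiff, hdiff] at main
    have e1 : ∀ y : E, X₀ + ρ • ρ⁻¹ • (y - X₀) = y := by
      intro y
      rw [smul_smul, mul_inv_cancel₀ hρ.ne', one_smul]; abel
    have e2 : ∀ t : ℝ, ρ ^ 2 * ((ρ ^ 2)⁻¹ * t) - 0 = t := by
      intro t; field_simp; ring
    rw [e1, e1, e2, e2, ← sub_div, div_le_iff₀ ho] at main
    linarith
  · intro z hz
    obtain ⟨h1, h2, h3⟩ := hD z hz
    obtain ⟨h4, h5⟩ := hosc _ _ h1 h2 h3
    rw [hdiff]
    refine ⟨div_nonneg (by linarith) ho.le, ?_⟩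
    rw [div_le_iff₀ ho]
    linarith
  · rw [norm_smul, norm_inv, Real.norm_of_nonneg hρ.le, inv_mul_le_iff₀ hρ, mul_one]; exact hy
  · rw [norm_smul, norm_inv, Real.norm_of_nonneg hρ.le, inv_mul_le_iff₀ hρ, mul_one]; exact hy'
  · refine ⟨?_, mul_neg_of_pos_of_neg (by positivity) ht.2⟩
    rw [le_inv_mul_iff₀ hρ2]; linarith [ht.1]
  · refine ⟨?_, mul_neg_of_pos_of_neg (by positivity) ht'.2⟩
    rw [le_inv_mul_iff₀ hρ2]; linarith [ht'.1]

/-- `u` is subquadratically close to the model solution `½|x|² - t`. -/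
def Asymp (u : E → ℝ → ℝ) : Prop :=
  ∀ γ > 0, ∃ ρ₀ : ℝ, ∀ ρ ≥ ρ₀, ∀ x t, ‖x‖ ≤ ρ → -ρ ^ 2 ≤ t → t < 0 →
    |u x t - (‖x‖ ^ 2 / 2 - t)| ≤ γ * ρ ^ 2

/-- The mass of `F` on large balls is almost that of Lebesgue measure. -/
def BallMass (F : E → ℝ) : Prop :=
  ∃ ρ₀ : ℝ, ∀ ρ ≥ ρ₀, ∀ X₀ : E, ∫⁻ x in Metric.closedBall X₀ ρ, ENNReal.ofReal (F x) ≤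
        ENNReal.ofReal (3 / 2) * volume (Metric.closedBall X₀ ρ)

theorem liouville_difference [Nontrivial E] (hu : Sol F u p H w) (hũ : Sol F ũ pt Ht wt) {Λ : ℝ}
    (hF : ∀ x, F x ≤ Λ) (hm : BallMass F) (hau : Asymp u) (haũ : Asymp ũ) {C : ℝ}
    (hb : ∀ x, ∀ t < 0, |ũ x t - u x t| ≤ C) {x x' : E} {t t' : ℝ} (ht : t < 0) (ht' : t' < 0) :
    ũ x t - u x t = ũ x' t' - u x' t' := by
  obtain ⟨γ, hγ0, hγ1, hγ⟩ := osc_decay_scaled E Λ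
  obtain ⟨ρ₀, hρ₀⟩ := hm
  obtain ⟨ρ₁, hρ₁⟩ := hau (γ / 16) (by positivity)
  obtain ⟨ρ₂, hρ₂⟩ := haũ (γ / 16) (by positivity)
  set z : {q : E × ℝ // q.2 < 0} → ℝ := fun q => ũ q.1.1 q.1.2 - u q.1.1 q.1.2 with hz
  have hbb : BddBelow (range z) := ⟨-C, by
    rintro _ ⟨q, rfl⟩; exact (abs_le.mp (hb q.1.1 q.1.2 q.2)).1⟩
  have hba : BddAbove (range z) := ⟨C, by
    rintro _ ⟨q, rfl⟩; exact (abs_le.mp (hb q.1.1 q.1.2 q.2)).2⟩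
  have : Nonempty {q : E × ℝ // q.2 < 0} := ⟨⟨(x, t), ht⟩⟩
  set m := ⨅ q, z q with hmdef
  set M := ⨆ q, z q with hMdef
  have hmM : ∀ y s, s < 0 → m ≤ ũ y s - u y s ∧ ũ y s - u y s ≤ M := fun y s hs =>
    ⟨ciInf_le hbb ⟨(y, s), hs⟩, le_ciSup hba ⟨(y, s), hs⟩⟩
  rcases le_or_gt M m with hle | hlt
  · have h1 := hmM x t ht
    have h2 := hmM x' t' ht'
    linarith
  exfalso
  have key : ∀ q q', z q' - z q ≤ (1 - γ / 2) * (M - m) := by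
    rintro ⟨⟨y, s⟩, hs⟩ ⟨⟨y', s'⟩, hs'⟩
    simp only at hs hs'
    set ρ := max (max ρ₀ (max ρ₁ ρ₂)) (max (max ‖y‖ ‖y'‖) (max 1 (max (-s) (-s')))) with hρ
    have h0 : ρ₀ ≤ ρ := (le_max_left _ _).trans (le_max_left _ _)
    have h1 : ρ₁ ≤ ρ := ((le_max_left _ _).trans (le_max_right _ _)).trans (le_max_left _ _)
    have h2 : ρ₂ ≤ ρ := ((le_max_right _ _).trans (le_max_right _ _)).trans (le_max_left _ _)
    have h3 : ‖y‖ ≤ ρ := ((le_max_left _ _).trans (le_max_left _ _)).trans (le_max_right _ _)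
    have h4 : ‖y'‖ ≤ ρ := ((le_max_right _ _).trans (le_max_left _ _)).trans (le_max_right _ _)
    have h5 : 1 ≤ ρ := ((le_max_left _ _).trans (le_max_right _ _)).trans (le_max_right _ _)
    have h6 : -s ≤ ρ := (((le_max_left _ _).trans (le_max_right _ _)).trans
      (le_max_right _ _)).trans (le_max_right _ _)
    have h7 : -s' ≤ ρ := (((le_max_right _ _).trans (le_max_right _ _)).trans
      (le_max_right _ _)).trans (le_max_right _ _)
    clear_value ρ
    have hρρ : ρ ≤ ρ ^ 2 := by rw [sq]; exact le_mul_of_one_le_left (by linarith) h5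
    have hcl : ∀ g : E → ℝ → ℝ, ∀ r : ℝ, r ≤ ρ → (∀ ρ ≥ r, ∀ x t, ‖x‖ ≤ ρ → -ρ ^ 2 ≤ t → t < 0 →
        |g x t - (‖x‖ ^ 2 / 2 - t)| ≤ γ / 16 * ρ ^ 2) → ∀ y t, ‖y - 0‖ ≤ 4 * ρ →
        -(16 * ρ ^ 2) ≤ t → t < 0 →
        |g y t - (‖y - 0‖ ^ 2 / 2 - t + inner ℝ (0:E) (y - 0) + 0)| ≤ γ * ρ ^ 2 := by
      intro g r hr hg y t hy hty ht0
      rw [sub_zero] at hy ⊢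
      have := hg (4 * ρ) (by linarith) y t hy (by linarith [show (4 * ρ) ^ 2 = 16 * ρ ^ 2 by ring])
        ht0
      rw [inner_zero_left, add_zero, add_zero]
      linarith [show γ / 16 * (4 * ρ) ^ 2 = γ * ρ ^ 2 by ring]
    have := hγ F u ũ p pt H Ht w wt hu hũ hF 0 0 0 ρ (by linarith) (hρ₀ ρ h0 0)
      (hcl u ρ₁ h1 hρ₁) (hcl ũ ρ₂ h2 hρ₂) m (M - m) (by linarith)
      (fun y t _ _ ht => ⟨(hmM y t ht).1, by linarith [(hmM y t ht).2]⟩) y y' s s'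
      (by simpa using h3) (by simpa using h4) ⟨by linarith, hs⟩ ⟨by linarith, hs'⟩
    exact this
  have h1 : M ≤ m + (1 - γ / 2) * (M - m) := by
    refine ciSup_le fun q' => ?_
    have : z q' - (1 - γ / 2) * (M - m) ≤ m := le_ciInf fun q => by linarith [key q q']
    linarith
  have : 0 < γ / 2 * (M - m) := by
    have : 0 < M - m := by linarith
    positivity
  linarith

end Transform

section Averaging

variable {E : Type*} [NormedAddCommGroup E] [InnerProductSpace ℝ E] [FiniteDimensional ℝ E]
  [MeasurableSpace E] [BorelSpace E]

/-- `F` is continuous, takes values in `(0, Λ]`, and all its averages against the compactly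
supported probability measure `ν` equal one. -/
structure Averaged (F : E → ℝ) (Λ : ℝ) (ν : Measure E) (d : ℝ) : Prop where
  cont : Continuous F
  pos : ∀ x, 0 < F x
  le : ∀ x, F x ≤ Λ
  prob : IsProbabilityMeasure ν
  supp : ∀ᵐ k ∂ν, ‖k‖ ≤ d
  avg : ∀ x, ∫ k, F (x + k) ∂ν = 1

variable {F : E → ℝ} {Λ d : ℝ} {ν : Measure E}

theorem Averaged.Λ_pos (h : Averaged F Λ ν d) : 0 < Λ := (h.pos 0).trans_le (h.le 0)

theorem Averaged.integrable (h : Averaged F Λ ν d) (x : E) : Integrable (fun k => F (x + k)) ν := by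
  have := h.prob
  refine Integrable.of_bound (h.cont.comp (by fun_prop)).aestronglyMeasurable Λ ?_
  exact Filter.Eventually.of_forall fun k => by
    rw [Real.norm_of_nonneg (h.pos _).le]; exact h.le _

theorem Averaged.lavg (h : Averaged F Λ ν d) (x : E) :
    ∫⁻ k, ENNReal.ofReal (F (x + k)) ∂ν = 1 := by
  rw [← ofReal_integral_eq_lintegral_ofReal (h.integrable x)
    (Filter.Eventually.of_forall fun k => (h.pos _).le), h.avg, ENNReal.ofReal_one]

theorem Averaged.lintegral_closedBall_le (h : Averaged F Λ ν d) (X₀ : E) (ρ : ℝ) :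
    ∫⁻ x in Metric.closedBall X₀ ρ, ENNReal.ofReal (F x) ≤
      volume (Metric.closedBall X₀ (ρ + d)) := by
  have := h.prob
  have hFm : Measurable (fun x => ENNReal.ofReal (F x)) := h.cont.measurable.ennreal_ofReal
  have h1 : ∀ k : E, ‖k‖ ≤ d → ∫⁻ x in Metric.closedBall X₀ ρ, ENNReal.ofReal (F x) ≤
      ∫⁻ x in Metric.closedBall X₀ (ρ + d), ENNReal.ofReal (F (x + k)) := by
    intro k hk
    rw [← lintegral_indicator measurableSet_closedBall,
      ← lintegral_indicator measurableSet_closedBall,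
      ← lintegral_add_right_eq_self (fun x => (Metric.closedBall X₀ ρ).indicator
        (fun x => ENNReal.ofReal (F x)) x) k]
    refine lintegral_mono fun x => ?_
    by_cases hx : x + k ∈ Metric.closedBall X₀ ρ
    · have hx' : x ∈ Metric.closedBall X₀ (ρ + d) := by
        rw [mem_closedBall_iff_norm] at hx ⊢
        calc ‖x - X₀‖ = ‖(x + k - X₀) - k‖ := by congr 1; abel
          _ ≤ _ := (norm_sub_le _ _).trans (by linarith)
      simp [indicator_of_mem hx, indicator_of_mem hx']
    · simp [indicator_of_notMem hx]
  calc ∫⁻ x in Metric.closedBall X₀ ρ, ENNReal.ofReal (F x)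
      = ∫⁻ _k : E, (∫⁻ x in Metric.closedBall X₀ ρ, ENNReal.ofReal (F x)) ∂ν := by simp
    _ ≤ ∫⁻ k : E, (∫⁻ x in Metric.closedBall X₀ (ρ + d), ENNReal.ofReal (F (x + k))) ∂ν :=
        lintegral_mono_ae (h.supp.mono h1)
    _ = ∫⁻ x in Metric.closedBall X₀ (ρ + d), ∫⁻ k : E, ENNReal.ofReal (F (x + k)) ∂ν := by
        refine lintegral_lintegral_swap ?_
        exact (hFm.comp (by fun_prop : Measurable fun z : E × E => z.2 + z.1)).aemeasurable
    _ = _ := by simp [h.lavg]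

theorem Averaged.ballMass [Nontrivial E] (h : Averaged F Λ ν d) : BallMass F := by
  have hd : Filter.Tendsto (fun ρ : ℝ => (1 + d / ρ) ^ Module.finrank ℝ E) Filter.atTop
      (nhds ((1 + 0) ^ Module.finrank ℝ E)) :=
    ((tendsto_const_nhds.div_atTop Filter.tendsto_id).const_add 1).pow _
  have h1 : ∀ᶠ ρ : ℝ in Filter.atTop, (1 + d / ρ) ^ Module.finrank ℝ E < 3 / 2 :=
    hd.eventually_lt_const (by norm_num)
  have h2 : ∀ᶠ ρ : ℝ in Filter.atTop, 0 < ρ := Filter.eventually_gt_atTop 0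
  have h3 : ∀ᶠ ρ : ℝ in Filter.atTop, 0 < ρ + d :=
    (Filter.eventually_gt_atTop (-d)).mono fun ρ hρ => by linarith
  obtain ⟨ρ₀, hρ₀⟩ := Filter.eventually_atTop.mp (h1.and (h2.and h3))
  refine ⟨ρ₀, fun ρ hρ X₀ => ?_⟩
  obtain ⟨ha, hb, hc⟩ := hρ₀ ρ hρ
  refine (h.lintegral_closedBall_le X₀ ρ).trans ?_
  rw [Measure.addHaar_closedBall _ _ hb.le, Measure.addHaar_closedBall _ _ hc.le, ← mul_assoc,
    ← ENNReal.ofReal_mul (by norm_num)]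
  gcongr
  have : ρ + d = ρ * (1 + d / ρ) := by field_simp
  rw [this, mul_pow, mul_comm]
  gcongr

/-- Against a slowly varying weight, `F` integrates almost like the constant `1`. -/
theorem Averaged.abs_integral_sub_le (h : Averaged F Λ ν d) {g : E → ℝ} (hg : Continuous g)
    (hgc : HasCompactSupport g) (X₀ : E) {ρ δ : ℝ} (hρ : 0 < ρ)
    (hδ : ∀ k : E, ‖k‖ ≤ d / ρ → ∫ x, |g (x + k) - g x| ≤ δ) :
    |(∫ x, g x) - ∫ x, g x * F (X₀ + ρ • x)| ≤ Λ * δ := by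
  have := h.prob
  have hFc := h.cont
  have hgi : Integrable g := hg.integrable_of_hasCompactSupport hgc
  have hgFi : Integrable (fun x => g x * F (X₀ + ρ • x)) :=
    (hg.mul (hFc.comp (by fun_prop))).integrable_of_hasCompactSupport hgc.mul_right
  have hI : ∀ k : E, ‖k‖ ≤ d →
      ‖(∫ x, g x * F (X₀ + ρ • x + k)) - ∫ x, g x * F (X₀ + ρ • x)‖ ≤ Λ * δ := by
    intro k hk
    have hk' : ‖-(ρ⁻¹ • k)‖ ≤ d / ρ := by
      rw [norm_neg, norm_smul, norm_inv, Real.norm_of_nonneg hρ.le, inv_mul_eq_div]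
      gcongr
    have hshift : Continuous (fun x => g (x + -(ρ⁻¹ • k))) := hg.comp (by fun_prop)
    have hshiftc : HasCompactSupport (fun x => g (x + -(ρ⁻¹ • k))) :=
      hgc.comp_homeomorph (Homeomorph.addRight (-(ρ⁻¹ • k)))
    have e1 : (∫ x, g x * F (X₀ + ρ • x + k)) =
        ∫ x, g (x + -(ρ⁻¹ • k)) * F (X₀ + ρ • x) := by
      rw [← integral_add_right_eq_self (fun x => g (x + -(ρ⁻¹ • k)) * F (X₀ + ρ • x)) (ρ⁻¹ • k)]
      refine integral_congr_ae (Filter.Eventually.of_forall fun x => ?_)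
      simp only
      rw [add_neg_cancel_right, smul_add, smul_smul, mul_inv_cancel₀ hρ.ne', one_smul, add_assoc]
    have hsi : Integrable (fun x => g (x + -(ρ⁻¹ • k)) * F (X₀ + ρ • x)) :=
      (hshift.mul (hFc.comp (by fun_prop))).integrable_of_hasCompactSupport hshiftc.mul_right
    rw [e1, ← integral_sub hsi hgFi]
    have hdi : Integrable (fun x => |g (x + -(ρ⁻¹ • k)) - g x|) :=
      ((hshift.integrable_of_hasCompactSupport hshiftc).sub hgi).abs
    refine (norm_integral_le_of_norm_le (hdi.const_mul Λ)
      (Filter.Eventually.of_forall fun x => ?_)).trans ?_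
    · rw [← sub_mul, norm_mul, Real.norm_of_nonneg (h.pos _).le, mul_comm, Real.norm_eq_abs]
      exact mul_le_mul_of_nonneg_right (h.le _) (abs_nonneg _)
    · rw [integral_const_mul]
      exact mul_le_mul_of_nonneg_left (hδ _ hk') h.Λ_pos.le
  have hprod : Integrable (fun z : E × E => g z.1 * F (X₀ + ρ • z.1 + z.2))
      ((volume : Measure E).prod ν) := by
    refine ((hgi.abs.mul_const Λ).comp_fst ν).mono' ?_ (Filter.Eventually.of_forall fun z => ?_)
    · exact ((hg.comp continuous_fst).mul (hFc.comp (by fun_prop))).aestronglyMeasurable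
    · rw [norm_mul, Real.norm_of_nonneg (h.pos _).le, Real.norm_eq_abs]
      exact mul_le_mul_of_nonneg_left (h.le _) (abs_nonneg _)
  have hswap : (∫ x, g x) = ∫ k, (∫ x, g x * F (X₀ + ρ • x + k)) ∂ν := by
    rw [← integral_integral_swap (f := fun x k => g x * F (X₀ + ρ • x + k)) hprod]
    simp only [integral_const_mul, h.avg, mul_one]
  have hconst : (∫ x, g x * F (X₀ + ρ • x)) = ∫ _k : E, (∫ x, g x * F (X₀ + ρ • x)) ∂ν := by simp
  rw [hswap, hconst, ← integral_sub hprod.integral_prod_right (integrable_const _),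
    ← Real.norm_eq_abs]
  refine (norm_integral_le_of_norm_le_const (h.supp.mono hI)).trans ?_
  simp

end Averaging

section TimeIndependence

variable {E : Type*} [NormedAddCommGroup E] [InnerProductSpace ℝ E] [FiniteDimensional ℝ E]
  [MeasurableSpace E] [BorelSpace E]
variable {F : E → ℝ} {u ũ : E → ℝ → ℝ} {p : E → ℝ → E} {H : E → ℝ → E →L[ℝ] E}
  {w : E → ℝ → ℝ}

theorem Asymp.of_bounded_sub (hu : Asymp u) {C : ℝ} (hb : ∀ x, ∀ t < 0, |ũ x t - u x t| ≤ C) :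
    Asymp ũ := by
  intro γ hγ
  obtain ⟨ρ₀, h₀⟩ := hu (γ / 2) (by positivity)
  refine ⟨max ρ₀ (max 1 (2 * C / γ)), fun ρ hρ x t hx ht ht0 => ?_⟩
  have h1 := h₀ ρ ((le_max_left _ _).trans hρ) x t hx ht ht0
  have h2 : 1 ≤ ρ := ((le_max_left _ _).trans (le_max_right _ _)).trans hρ
  have h3 : 2 * C / γ ≤ ρ := ((le_max_right _ _).trans (le_max_right _ _)).trans hρ
  have h4 : ρ ≤ ρ ^ 2 := by rw [sq]; exact le_mul_of_one_le_left (by linarith) h2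
  rw [div_le_iff₀ hγ] at h3
  have h5 := mul_le_mul_of_nonneg_right h4 hγ.le
  have h6 := abs_add_le (ũ x t - u x t) (u x t - (‖x‖ ^ 2 / 2 - t))
  rw [show ũ x t - u x t + (u x t - (‖x‖ ^ 2 / 2 - t)) = ũ x t - (‖x‖ ^ 2 / 2 - t) by ring] at h6
  linarith [hb x t ht0]

theorem Sol.abs_shift_sub_le (hs : Sol F u p H w) {m₂ : ℝ} (hw : ∀ x, ∀ t < 0, w x t ≤ m₂)
    {h : ℝ} (hh : 0 ≤ h) (x : E) {t : ℝ} (ht : t < 0) : |u x (t - h) - u x t| ≤ m₂ * h := by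
  have := (convex_Iio (0:ℝ)).norm_image_sub_le_of_norm_hasDerivWithin_le (f := u x)
    (f' := fun s => -(w x s)) (C := m₂)
    (fun s hs' => (hs.tder s hs' x).hasDerivWithinAt)
    (fun s hs' => by
      rw [norm_neg, Real.norm_of_nonneg (hs.wpos s hs' x).le]; exact hw x s hs')
    (mem_Iio.mpr ht) (mem_Iio.mpr (show t - h < 0 by linarith))
  rwa [Real.norm_eq_abs, Real.norm_eq_abs, show t - h - t = -h by ring, abs_neg,
    abs_of_nonneg hh] at this

theorem Sol.time_shift [Nontrivial E] (hs : Sol F u p H w) {m₂ Λ : ℝ}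
    (hw : ∀ x, ∀ t < 0, w x t ≤ m₂) (hF : ∀ x, F x ≤ Λ) (hm : BallMass F) (ha : Asymp u)
    {h : ℝ} (hh : 0 ≤ h) (x : E) {t : ℝ} (ht : t < 0) : u x (t - h) = u x t + h := by
  have hsol := hs.transform 0 one_pos hh 0 h
  simp only [one_pow, inv_one, one_mul, one_smul, zero_add, inner_zero_left, sub_zero] at hsol
  have hbd : ∀ x, ∀ t < 0, |(u x (t - h) - h) - u x t| ≤ m₂ * h + h := by
    intro x t ht
    have h1 := hs.abs_shift_sub_le hw hh x ht
    rw [show (u x (t - h) - h) - u x t = (u x (t - h) - u x t) - h by ring]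
    refine (abs_sub _ _).trans ?_
    rw [abs_of_nonneg hh]; linarith
  have hcon : ∀ x' t', t' < 0 → (u x' (t' - h) - h) - u x' t' = (u x (t - h) - h) - u x t :=
    fun x' t' ht' => liouville_difference hs hsol hF hm ha (ha.of_bounded_sub hbd) hbd ht' ht
  set c := (u x (t - h) - h) - u x t with hc
  suffices c = 0 by linarith
  have hiter : ∀ j : ℕ, u x (t - j * h) = u x t + j * (h + c) := by
    intro j
    induction j with
    | zero => simp
    | succ j ih =>
      have h1 : t - j * h < 0 := by nlinarith [mul_nonneg (Nat.cast_nonneg (α := ℝ) j) hh]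
      have h2 := hcon x (t - j * h) h1
      push_cast
      rw [show t - (j + 1) * h = t - j * h - h by ring]
      linarith
  by_contra hc0
  have hcpos : 0 < |c| := abs_pos.mpr hc0
  obtain ⟨ρ₀, hρ₀⟩ := ha (|c| / (2 * (h + 1))) (by positivity)
  set K := |u x t - (‖x‖ ^ 2 / 2 - t)| + |c| / (2 * (h + 1)) * (ρ₀ ^ 2 + 1 + ‖x‖ ^ 2 - t) with hK
  have hbound : ∀ j : ℕ, j * |c| ≤ K + |c| / 2 * j := by
    intro j
    have hj : 0 ≤ j * h := mul_nonneg (Nat.cast_nonneg (α := ℝ) j) hh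
    set ρ := Real.sqrt (ρ₀ ^ 2 + ‖x‖ ^ 2 + (j * h - t)) with hρ
    have hin : 0 ≤ ρ₀ ^ 2 + ‖x‖ ^ 2 + (j * h - t) := by nlinarith [sq_nonneg ρ₀, sq_nonneg ‖x‖]
    have hsq : ρ ^ 2 = ρ₀ ^ 2 + ‖x‖ ^ 2 + (j * h - t) := Real.sq_sqrt hin
    have h1 := hρ₀ ρ (Real.le_sqrt_of_sq_le (by nlinarith [sq_nonneg ‖x‖])) x (t - j * h)
      (Real.le_sqrt_of_sq_le (by nlinarith [sq_nonneg ρ₀])) (by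
        nlinarith [sq_nonneg ρ₀, sq_nonneg ‖x‖]) (by linarith)
    rw [hiter j, hsq] at h1
    have h2 : j * c = (u x t + j * (h + c) - (‖x‖ ^ 2 / 2 - (t - j * h))) -
      (u x t - (‖x‖ ^ 2 / 2 - t)) := by ring
    have h3 : j * |c| = |j * c| := by rw [abs_mul, Nat.abs_cast]
    have h4 : |c| / (2 * (h + 1)) * (j * h) ≤ |c| / 2 * j := by
      have : |c| / (2 * (h + 1)) * (j * h) = |c| / 2 * j * (h / (h + 1)) := by field_simp
      rw [this]
      refine mul_le_of_le_one_right (by positivity) ?_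
      rw [div_le_one (by positivity)]; linarith
    rw [h3, h2]
    refine (abs_sub _ _).trans ?_
    have h5 : |c| / (2 * (h + 1)) * (ρ₀ ^ 2 + ‖x‖ ^ 2 + (j * h - t)) =
      |c| / (2 * (h + 1)) * (ρ₀ ^ 2 + 1 + ‖x‖ ^ 2 - t) + |c| / (2 * (h + 1)) * (j * h)
        - |c| / (2 * (h + 1)) := by ring
    have h6 : 0 ≤ |c| / (2 * (h + 1)) := by positivity
    linarith
  obtain ⟨j, hj⟩ := exists_nat_gt (2 * K / |c|)
  rw [div_lt_iff₀ hcpos] at hj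
  linarith [hbound j]

/-- Classical strictly convex solutions of the elliptic equation `det D²U = F`. -/
structure Ell (F : E → ℝ) (U : E → ℝ) (P : E → E) (T : E → E →L[ℝ] E) : Prop where
  grad : ∀ x, HasGradientAt U (P x) x
  hess : ∀ x, HasFDerivAt P (T x) x
  cont_T : Continuous T
  symm : ∀ x, SymmOp (T x)
  pos : ∀ x v, v ≠ 0 → 0 < inner ℝ (T x v) v
  det : ∀ x, (T x).det = F x

theorem Sol.eq_sub_time [Nontrivial E] (hs : Sol F u p H w) {m₂ Λ : ℝ}
    (hw : ∀ x, ∀ t < 0, w x t ≤ m₂) (hF : ∀ x, F x ≤ Λ) (hm : BallMass F) (ha : Asymp u)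
    (x : E) {t : ℝ} (ht : t < 0) : u x t = (u x (-1) - 1) - t := by
  rcases le_total t (-1) with h | h
  · have := hs.time_shift hw hF hm ha (h := -1 - t) (by linarith) x (t := -1) (by norm_num)
    rw [show -1 - (-1 - t) = t by ring] at this
    linarith
  · have := hs.time_shift hw hF hm ha (h := t + 1) (by linarith) x ht
    rw [show t - (t + 1) = -1 by ring] at this
    linarith

theorem Sol.ell [Nontrivial E] (hs : Sol F u p H w) {m₂ Λ : ℝ}
    (hw : ∀ x, ∀ t < 0, w x t ≤ m₂) (hF : ∀ x, F x ≤ Λ) (hm : BallMass F) (ha : Asymp u) :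
    Ell F (fun x => u x (-1) - 1) (fun x => p x (-1)) (fun x => H x (-1)) where
  grad x := by
    have := hs.grad (-1) (by norm_num) x
    rw [hasGradientAt_iff_hasFDerivAt] at this ⊢
    exact this.sub_const 1
  hess x := hs.hess (-1) (by norm_num) x
  cont_T := continuous_slice hs.cont_H (by norm_num)
  symm x := hs.symm (-1) (by norm_num) x
  pos x := hs.pos (-1) (by norm_num) x
  det x := by
    have h1 := hs.tder (-1) (by norm_num) x
    have h2 : HasDerivAt (fun t => (u x (-1) - 1) - t) (-1) (-1) := by
      simpa using (hasDerivAt_id (-1 : ℝ)).const_sub (u x (-1) - 1)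
    have h3 : u x =ᶠ[nhds (-1)] fun t => (u x (-1) - 1) - t := by
      filter_upwards [Iio_mem_nhds (show (-1:ℝ) < 0 by norm_num)] with t ht
      exact hs.eq_sub_time hw hF hm ha x ht
    have h4 := h1.unique (h2.congr_of_eventuallyEq h3)
    have h5 := hs.eq (-1) (by norm_num) x
    rw [neg_inj.mp h4, one_mul] at h5
    exact h5

end TimeIndependence

section Elliptic

variable {E : Type*} [NormedAddCommGroup E] [InnerProductSpace ℝ E] [FiniteDimensional ℝ E]
  [MeasurableSpace E] [BorelSpace E]
variable {F U : E → ℝ} {P : E → E} {T : E → E →L[ℝ] E}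

/-- The deviation of `U` from the model `½|x|²`. -/
def pert (U : E → ℝ) (x : E) : ℝ := U x - ‖x‖ ^ 2 / 2

/-- The deviation of the gradient map `P` from the identity. -/
def pertGrad (P : E → E) (x : E) : E := P x - x

theorem Ell.sol (h : Ell F U P T) :
    Sol F (fun x t => U x - t) (fun x _ => P x) (fun x _ => T x) (fun _ _ => 1) := by
  have hP : Continuous P := continuous_iff_continuousAt.mpr fun x => (h.hess x).continuousAt
  have hU : Continuous U := continuous_iff_continuousAt.mpr fun x => (h.grad x).continuousAt
  refine ⟨?_, ?_, ?_, continuousOn_const, ?_, fun t _ x => h.hess x, ?_, fun t _ x => h.symm x,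
    fun t _ x => h.pos x, fun t _ x => one_pos, fun t _ x => by rw [h.det, one_mul]⟩
  · exact ((hU.comp continuous_fst).sub continuous_snd).continuousOn
  · exact (hP.comp continuous_fst).continuousOn
  · exact (h.cont_T.comp continuous_fst).continuousOn
  · intro t _ x
    have := h.grad x
    rw [hasGradientAt_iff_hasFDerivAt] at this ⊢
    exact this.sub_const t
  · intro t _ x
    simpa using (hasDerivAt_id t).const_sub (U x)

theorem Ell.continuous_P (h : Ell F U P T) : Continuous P :=
  continuous_iff_continuousAt.mpr fun x => (h.hess x).continuousAt

theorem Ell.continuous_U (h : Ell F U P T) : Continuous U :=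
  continuous_iff_continuousAt.mpr fun x => (h.grad x).continuousAt

theorem Ell.continuous_pertGrad (h : Ell F U P T) : Continuous (pertGrad P) :=
  h.continuous_P.sub continuous_id

theorem Ell.hasGradientAt_pert (h : Ell F U P T) (x : E) :
    HasGradientAt (pert U) (pertGrad P x) x := by
  have h1 := h.grad x
  rw [hasGradientAt_iff_hasFDerivAt] at h1 ⊢
  have h2 : HasFDerivAt (fun y : E => ‖y‖ ^ 2 / 2) (innerSL ℝ x : E →L[ℝ] ℝ) x := by
    have := (hasStrictFDerivAt_norm_sq x).hasFDerivAt.mul_const (1 / 2 : ℝ)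
    simp only [mul_one_div] at this
    refine this.congr_fderiv ?_
    ext v; simp
  refine (h1.sub h2).congr_fderiv ?_
  ext v; simp [pertGrad]

theorem hasDerivAt_line {f : E → ℝ} {g : E} {x v : E} {s : ℝ}
    (hf : HasGradientAt f g (x + s • v)) :
    HasDerivAt (fun s : ℝ => f (x + s • v)) (inner ℝ g v) s := by
  rw [hasGradientAt_iff_hasFDerivAt] at hf
  have h1 : HasDerivAt (fun s : ℝ => x + s • v) v s := by
    simpa using ((hasDerivAt_id s).smul_const v).const_add x
  refine (hf.comp_hasDerivAt s h1).congr_deriv ?_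
  simp

theorem exists_mean_value {f : E → ℝ} {g : E → E} (hf : ∀ x, HasGradientAt f (g x) x) (x v : E) :
    ∃ s ∈ Ioo (0:ℝ) 1, f (x + v) - f x = inner ℝ (g (x + s • v)) v := by
  obtain ⟨s, hs, he⟩ := exists_hasDerivAt_eq_slope (fun s : ℝ => f (x + s • v))
    (fun s => inner ℝ (g (x + s • v)) v) zero_lt_one
    (fun s _ => (hasDerivAt_line (hf _)).continuousAt.continuousWithinAt)
    (fun s _ => hasDerivAt_line (hf _))
  refine ⟨s, hs, ?_⟩
  simpa using he.symm

theorem Ell.inner_sub_pos (h : Ell F U P T) {x v : E} (hv : v ≠ 0) :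
    0 < inner ℝ (P (x + v) - P x) v := by
  have hd : ∀ s : ℝ, HasDerivAt (fun s : ℝ => inner ℝ (P (x + s • v)) v)
      (inner ℝ (T (x + s • v) v) v) s := by
    intro s
    have h1 : HasDerivAt (fun s : ℝ => x + s • v) v s := by
      simpa using ((hasDerivAt_id s).smul_const v).const_add x
    have h2 := (h.hess (x + s • v)).comp_hasDerivAt s h1
    simpa using h2.inner ℝ (hasDerivAt_const s v)
  obtain ⟨s, hs, he⟩ := exists_hasDerivAt_eq_slope (fun s : ℝ => inner ℝ (P (x + s • v)) v)
    (fun s => inner ℝ (T (x + s • v) v) v) zero_lt_one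
    (fun s _ => (hd s).continuousAt.continuousWithinAt) (fun s _ => hd s)
  have h3 := h.pos (x + s • v) v hv
  rw [inner_sub_left]
  simp only [one_smul, zero_smul, add_zero, sub_zero, div_one] at he
  linarith

theorem Ell.convex_le (h : Ell F U P T) (x v : E) : U x + inner ℝ (P x) v ≤ U (x + v) := by
  obtain ⟨s, hs, he⟩ := exists_mean_value h.grad x v
  rcases eq_or_ne v 0 with rfl | hv
  · simp
  have h1 := h.inner_sub_pos (x := x) (smul_ne_zero hs.1.ne' hv)
  rw [inner_smul_right, inner_sub_left] at h1
  have h2 := pos_of_mul_pos_right h1 hs.1.le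
  linarith

theorem Ell.inner_pertGrad_le (h : Ell F U P T) (x v : E) :
    inner ℝ (pertGrad P x) v ≤ pert U (x + v) - pert U x + ‖v‖ ^ 2 / 2 := by
  have h1 := h.convex_le x v
  have h2 := norm_add_sq_real x v
  simp only [pert, pertGrad, inner_sub_left]
  linarith

theorem Ell.injective (h : Ell F U P T) : Function.Injective P := by
  intro x y hxy
  by_contra hne
  have h1 := h.inner_sub_pos (x := x) (v := y - x) (sub_ne_zero.mpr (Ne.symm hne))
  rw [add_sub_cancel, hxy, sub_self, inner_zero_left] at h1
  exact lt_irrefl _ h1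

theorem Ell.surjective (h : Ell F U P T) {K : ℝ} (hK : ∀ x, |pert U x| ≤ ‖x‖ ^ 2 / 8 + K) :
    Function.Surjective P := by
  intro y
  have hlow : ∀ x, ‖x‖ ^ 2 / 8 - (K + ‖y‖ ^ 2) ≤ U x - inner ℝ y x := by
    intro x
    have h1 := (abs_le.mp (hK x)).1
    have h2 := real_inner_le_norm y x
    simp only [pert] at h1
    nlinarith [sq_nonneg (‖x‖ / 2 - ‖y‖)]
  have htend : Filter.Tendsto (fun x => U x - inner ℝ y x) (Filter.cocompact E) Filter.atTop := by
    refine Filter.tendsto_atTop_mono hlow ?_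
    refine Filter.tendsto_atTop_add_const_right _ _ ?_
    exact ((Filter.tendsto_pow_atTop two_ne_zero).comp
      (tendsto_norm_cocompact_atTop (E := E))).atTop_div_const (by norm_num)
  have hcont : Continuous (fun x => U x - inner ℝ y x) := h.continuous_U.sub (by fun_prop)
  obtain ⟨x, hx⟩ := hcont.exists_forall_le htend
  refine ⟨x, ?_⟩
  have h1 := h.grad x
  rw [hasGradientAt_iff_hasFDerivAt] at h1
  have h2 : HasFDerivAt (fun x => U x - inner ℝ y x)
      (InnerProductSpace.toDual ℝ E (P x) - innerSL ℝ y) x :=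
    h1.sub (innerSL ℝ y : E →L[ℝ] ℝ).hasFDerivAt
  have h3 : IsLocalMin (fun x => U x - inner ℝ y x) x := Filter.Eventually.of_forall hx
  have h4 := h3.hasFDerivAt_eq_zero h2
  refine ext_inner_right ℝ fun v => ?_
  have := congrArg (fun L : E →L[ℝ] ℝ => L v) h4
  simp only [sub_apply, InnerProductSpace.toDual_apply_apply, innerSL_apply_apply,
    zero_apply] at this
  linarith

/-- Change of variables for the gradient map, at scale `ρ` around `X₀`. -/
theorem Ell.integral_comp (h : Ell F U P T) (hs : Function.Surjective P) (hF : ∀ x, 0 < F x)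
    (X₀ : E) {ρ : ℝ} (hρ : 0 < ρ) (ψ : E → ℝ) :
    ∫ x, F (X₀ + ρ • x) * ψ (x + ρ⁻¹ • pertGrad P (X₀ + ρ • x)) = ∫ x, ψ x := by
  set q : E → E := fun x => ρ⁻¹ • (P (X₀ + ρ • x) - X₀) with hq
  have hqe : ∀ x, x + ρ⁻¹ • pertGrad P (X₀ + ρ • x) = q x := by
    intro x
    simp only [hq, pertGrad, smul_sub, smul_add, smul_smul, inv_mul_cancel₀ hρ.ne', one_smul]
    abel
  have hder : ∀ x ∈ (univ : Set E), HasFDerivWithinAt q (T (X₀ + ρ • x)) univ x := by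
    intro x _
    have haff : HasFDerivAt (fun x : E => X₀ + ρ • x) (ρ • ContinuousLinearMap.id ℝ E) x :=
      ((hasFDerivAt_id x).const_smul ρ).const_add X₀
    have h1 := (((h.hess (X₀ + ρ • x)).comp x haff).sub_const X₀).const_smul ρ⁻¹
    refine (h1.congr_fderiv ?_).hasFDerivWithinAt
    ext v
    simp [smul_smul, inv_mul_cancel₀ hρ.ne']
  have hinj : InjOn q univ := by
    intro x _ y _ hxy
    have h1 := smul_right_injective E (inv_ne_zero hρ.ne') hxy
    have h2 := h.injective (sub_left_injective h1)
    exact smul_right_injective E hρ.ne' (add_left_cancel h2)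
  have himg : q '' univ = univ := by
    rw [image_univ, range_eq_univ]
    intro y
    obtain ⟨x, hx⟩ := hs (X₀ + ρ • y)
    refine ⟨ρ⁻¹ • (x - X₀), ?_⟩
    simp only [hq, smul_smul, mul_inv_cancel₀ hρ.ne', one_smul, add_sub_cancel, hx,
      add_sub_cancel_left, inv_mul_cancel₀ hρ.ne']
  have := integral_image_eq_integral_abs_det_fderiv_smul volume MeasurableSet.univ hder hinj ψ
  rw [himg, Measure.restrict_univ] at this
  rw [this]
  refine integral_congr_ae (Filter.Eventually.of_forall fun x => ?_)
  simp only [hqe, smul_eq_mul]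
  rw [h.det, abs_of_pos (hF _)]

/-- Sublinear growth of the gradient perturbation. -/
theorem Ell.norm_pertGrad_le (h : Ell F U P T) {C σ : ℝ} (hσ0 : 0 ≤ σ) (hσ : σ ≤ 1)
    (hC : 0 ≤ C) (hg : ∀ x, |pert U x| ≤ C * ((1 + ‖x‖) ^ σ) ^ 2) (x : E) :
    ‖pertGrad P x‖ ≤ (5 * C + 1) * (1 + ‖x‖) ^ σ := by
  have hx1 : 1 ≤ 1 + ‖x‖ := by linarith [norm_nonneg x]
  set s := (1 + ‖x‖) ^ σ with hs
  have hs1 : 1 ≤ s := Real.one_le_rpow hx1 hσ0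
  rcases eq_or_ne (pertGrad P x) 0 with h0 | h0
  · rw [h0, norm_zero]; positivity
  have hn : 0 < ‖pertGrad P x‖ := norm_pos_iff.mpr h0
  set v := (s / ‖pertGrad P x‖) • pertGrad P x with hv
  have hvn : ‖v‖ = s := by
    rw [hv, norm_smul, Real.norm_of_nonneg (by positivity)]; field_simp
  have h1 := h.inner_pertGrad_le x v
  have h2 : inner ℝ (pertGrad P x) v = s * ‖pertGrad P x‖ := by
    rw [hv, inner_smul_right, real_inner_self_eq_norm_sq]; field_simp
  have hsle : s ≤ 1 + ‖x‖ := by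
    calc s ≤ (1 + ‖x‖) ^ (1:ℝ) := Real.rpow_le_rpow_of_exponent_le hx1 hσ
      _ = _ := Real.rpow_one _
  have h3 : (1 + ‖x + v‖) ^ σ ≤ 2 * s := by
    calc (1 + ‖x + v‖) ^ σ ≤ (2 * (1 + ‖x‖)) ^ σ := by
          refine Real.rpow_le_rpow (by positivity) ?_ hσ0
          linarith [norm_add_le x v]
      _ = 2 ^ σ * s := Real.mul_rpow (by norm_num) (by positivity)
      _ ≤ 2 * s := by
          refine mul_le_mul_of_nonneg_right ?_ (by linarith)
          calc (2:ℝ) ^ σ ≤ 2 ^ (1:ℝ) := Real.rpow_le_rpow_of_exponent_le (by norm_num) hσ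
            _ = 2 := Real.rpow_one _
  have h4 : ((1 + ‖x + v‖) ^ σ) ^ 2 ≤ 4 * s ^ 2 := by
    calc ((1 + ‖x + v‖) ^ σ) ^ 2 ≤ (2 * s) ^ 2 := pow_le_pow_left₀ (by positivity) h3 2
      _ = _ := by ring
  have h5 := (abs_le.mp (hg (x + v))).2
  have h6 := (abs_le.mp (hg x)).1
  have h7 := mul_le_mul_of_nonneg_left h4 hC
  rw [h2, hvn] at h1
  have h8 : s * ‖pertGrad P x‖ ≤ s * ((5 * C + 1) * s) := by nlinarith [sq_nonneg s]
  exact le_of_mul_le_mul_left h8 (by linarith)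

end Elliptic

section Equicontinuity

variable {E : Type*} [NormedAddCommGroup E] [InnerProductSpace ℝ E] [FiniteDimensional ℝ E]
  [MeasurableSpace E] [BorelSpace E]
variable {F U : E → ℝ} {P : E → E} {T : E → E →L[ℝ] E}

/-- The increment of `U` along `e`, corrected so that it is constant for the model `½|x|²`. -/
def incr (U : E → ℝ) (e x : E) : ℝ := U (x + e) - inner ℝ e x - U x

theorem Ell.shift (h : Ell F U P T) {e : E} (he : ∀ x, F (x + e) = F x) :
    Ell F (fun x => U (x + e) - inner ℝ e x) (fun x => P (x + e) - e) (fun x => T (x + e)) where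
  grad x := by
    have h1 := h.grad (x + e)
    rw [hasGradientAt_iff_hasFDerivAt] at h1 ⊢
    have h2 := (hasFDerivAt_comp_add_right e).mpr h1
    refine (h2.sub (innerSL ℝ e : E →L[ℝ] ℝ).hasFDerivAt).congr_fderiv ?_
    ext v; simp
  hess x := ((hasFDerivAt_comp_add_right e).mpr (h.hess (x + e))).sub_const e
  cont_T := h.cont_T.comp (by fun_prop)
  symm x := h.symm _
  pos x := h.pos _
  det x := by rw [h.det, he]

theorem incr_eq (U : E → ℝ) (e x : E) : incr U e x = pert U (x + e) - pert U x + ‖e‖ ^ 2 / 2 := by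
  have := norm_add_sq_real x e
  simp only [incr, pert]
  rw [real_inner_comm]
  linarith

theorem Ell.abs_pert_sub_le (h : Ell F U P T) {M : ℝ} {x v : E}
    (hM : ∀ s ∈ Icc (0:ℝ) 1, ‖pertGrad P (x + s • v)‖ ≤ M) :
    |pert U (x + v) - pert U x| ≤ M * ‖v‖ := by
  obtain ⟨s, hs, he⟩ := exists_mean_value h.hasGradientAt_pert x v
  rw [he]
  exact (abs_real_inner_le_norm _ _).trans
    (mul_le_mul_of_nonneg_right (hM s ⟨hs.1.le, hs.2.le⟩) (norm_nonneg _))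

theorem Ell.abs_affine_sub_le (h : Ell F U P T) {M : ℝ} {x y : E}
    (hM : ∀ s ∈ Icc (0:ℝ) 1, ‖pertGrad P (x + s • (y - x))‖ ≤ M) :
    |U y - (‖y - x‖ ^ 2 / 2 + inner ℝ (P x) (y - x) + U x)| ≤ 2 * M * ‖y - x‖ := by
  have h1 := h.abs_pert_sub_le hM
  have h2 : |inner ℝ (pertGrad P x) (y - x)| ≤ M * ‖y - x‖ :=
    (abs_real_inner_le_norm _ _).trans (mul_le_mul_of_nonneg_right
      (by simpa using hM 0 ⟨le_rfl, zero_le_one⟩) (norm_nonneg _))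
  have h3 := norm_add_sq_real x (y - x)
  rw [add_sub_cancel] at h1 h3
  have e : U y - (‖y - x‖ ^ 2 / 2 + inner ℝ (P x) (y - x) + U x) =
      (pert U y - pert U x) - inner ℝ (pertGrad P x) (y - x) := by
    simp only [pert, pertGrad, inner_sub_left (P x) x]
    linarith
  rw [e]
  refine (abs_sub _ _).trans ?_
  linarith

theorem norm_add_smul_sub_le {x v y : E} {s r : ℝ} (hs : s ∈ Icc (0:ℝ) 1) (hx : ‖x - y‖ ≤ r)
    (hxv : ‖x + v - y‖ ≤ r) : ‖x + s • v - y‖ ≤ r := by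
  have e : x + s • v - y = (1 - s) • (x - y) + s • (x + v - y) := by
    simp only [sub_smul, smul_sub, smul_add, one_smul]; abel
  rw [e]
  refine (norm_add_le _ _).trans ?_
  rw [norm_smul, norm_smul, Real.norm_of_nonneg hs.1, Real.norm_of_nonneg (by linarith [hs.2])]
  nlinarith [hs.1, hs.2]

theorem Ell.osc_incr [Nontrivial E] (h : Ell F U P T) {Λ d : ℝ} {ν : Measure E}
    (hav : Averaged F Λ ν d) {D L δ : ℝ} (hD : 0 ≤ D) (hL : 0 ≤ L) (hδ : 0 < δ) :
    ∃ κ : ℝ, 0 < κ ∧ κ ≤ 1 ∧ ∃ K : ℝ, 1 ≤ K ∧ ∀ e, ‖e‖ ≤ D → (∀ x, F (x + e) = F x) →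
      ∀ R N : ℝ, K ≤ R → K ≤ N → K * N ≤ R →
      (∀ x, ‖pertGrad P x‖ ≤ N * (1 + ‖x‖ / R)) → ∀ X₀ : E, ‖X₀‖ ≤ L * R →
      ∀ y y', ‖y - X₀‖ ≤ κ * R → ‖y' - X₀‖ ≤ κ * R → incr U e y' - incr U e y ≤ δ * N := by
  obtain ⟨γ, hγ0, hγ1, hγ⟩ := osc_decay_scaled E Λ
  obtain ⟨ρ₀, hρ₀⟩ := hav.ballMass
  set c₀ := 4 * (L + 3) * (D + 1) with hc₀
  have hc₀pos : 0 < c₀ := by positivity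
  obtain ⟨J, hJ⟩ := exists_pow_lt_of_lt_one (show 0 < δ / c₀ by positivity)
    (show 1 - γ / 2 < 1 by linarith)
  rw [lt_div_iff₀ hc₀pos] at hJ
  set κ : ℝ := (1 / 4) ^ J with hκ
  have hκ0 : 0 < κ := by positivity
  have hκ1 : κ ≤ 1 := pow_le_one₀ (by norm_num) (by norm_num)
  refine ⟨κ, hκ0, hκ1, max (max 1 D) (max (max (ρ₀ / κ) (D / κ)) (10 * (L + 3) / (γ * κ))),
    (le_max_left _ _).trans (le_max_left _ _), ?_⟩
  intro e heD he R N hKR hKN hKNR hV X₀ hX₀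
  set K := max (max 1 D) (max (max (ρ₀ / κ) (D / κ)) (10 * (L + 3) / (γ * κ))) with hK
  have hK1 : 1 ≤ K := (le_max_left _ _).trans (le_max_left _ _)
  have hKD : D ≤ K := (le_max_right _ _).trans (le_max_left _ _)
  have hKρ : ρ₀ / κ ≤ K := ((le_max_left _ _).trans (le_max_left _ _)).trans (le_max_right _ _)
  have hKDκ : D / κ ≤ K := ((le_max_right _ _).trans (le_max_left _ _)).trans (le_max_right _ _)
  have hKM : 10 * (L + 3) / (γ * κ) ≤ K := (le_max_right _ _).trans (le_max_right _ _)
  clear_value K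
  have hR0 : 0 < R := by linarith
  have hN0 : 0 < N := by linarith
  have hκR1 : ρ₀ ≤ κ * R := by
    rw [div_le_iff₀ hκ0] at hKρ
    have := mul_le_mul_of_nonneg_left hKR hκ0.le
    linarith
  have hκR2 : D ≤ κ * R := by
    rw [div_le_iff₀ hκ0] at hKDκ
    have := mul_le_mul_of_nonneg_left hKR hκ0.le
    linarith
  set M := N * (L + 3) with hM
  have hM0 : 0 < M := by positivity
  have hκR3 : 10 * M ≤ γ * (κ * R) := by
    rw [div_le_iff₀ (by positivity)] at hKM
    have h1 := mul_le_mul_of_nonneg_right hKM hN0.le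
    have h2 := mul_le_mul_of_nonneg_right hKNR (mul_pos hγ0 hκ0).le
    linarith [show 10 * (L + 3) * N = 10 * M by rw [hM]; ring,
      show K * (γ * κ) * N = K * N * (γ * κ) by ring, show R * (γ * κ) = γ * (κ * R) by ring]
  have hVM : ∀ x, ‖x - X₀‖ ≤ R + D → ‖pertGrad P x‖ ≤ M := by
    intro x hx
    refine (hV x).trans ?_
    rw [hM]
    refine mul_le_mul_of_nonneg_left ?_ hN0.le
    have h1 : ‖x‖ ≤ ‖x - X₀‖ + ‖X₀‖ := by simpa using norm_add_le (x - X₀) X₀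
    have h2 : ‖x‖ / R ≤ L + 2 := by
      rw [div_le_iff₀ hR0]; linarith
    linarith
  have hincr : ∀ x, ‖x - X₀‖ ≤ R → |incr U e x| ≤ 2 * M * (D + 1) := by
    intro x hx
    rw [incr_eq]
    have h1 := h.abs_pert_sub_le (M := M) (x := x) (v := e) (fun s hs =>
      hVM _ (norm_add_smul_sub_le hs (by linarith) (by
        rw [show x + e - X₀ = (x - X₀) + e by abel]
        exact (norm_add_le _ _).trans (by linarith))))
    have h2 : M * ‖e‖ ≤ M * D := mul_le_mul_of_nonneg_left heD hM0.le
    have h3 : ‖e‖ ^ 2 ≤ M * D := by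
      rw [sq]
      refine mul_le_mul ?_ heD (norm_nonneg _) hM0.le
      have : N * 1 ≤ M := mul_le_mul_of_nonneg_left (by linarith) hN0.le
      linarith
    refine (abs_add_le _ _).trans ?_
    rw [abs_of_nonneg (show 0 ≤ ‖e‖ ^ 2 / 2 by positivity)]
    nlinarith
  have hcont : Continuous (incr U e) :=
    ((h.continuous_U.comp (by fun_prop)).sub (by fun_prop)).sub h.continuous_U
  have claim : ∀ j ≤ J, ∀ y y', ‖y - X₀‖ ≤ (1 / 4) ^ j * R → ‖y' - X₀‖ ≤ (1 / 4) ^ j * R →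
      incr U e y' - incr U e y ≤ (1 - γ / 2) ^ j * (N * c₀) := by
    intro j
    induction j with
    | zero =>
      intro _ y y' hy hy'
      rw [pow_zero, one_mul] at hy hy'
      have h1 := abs_le.mp (hincr y hy)
      have h2 := abs_le.mp (hincr y' hy')
      rw [pow_zero, one_mul]
      have : N * c₀ = 4 * M * (D + 1) := by rw [hc₀, hM]; ring
      linarith
    | succ j ih =>
      intro hj y y' hy hy'
      specialize ih (by omega)
      set ρ := (1 / 4 : ℝ) ^ (j + 1) * R with hρ
      have h4ρ : (1 / 4 : ℝ) ^ j * R = 4 * ρ := by rw [hρ, pow_succ]; ring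
      have hρ0 : 0 < ρ := by positivity
      have hκρ : κ * R ≤ ρ := mul_le_mul_of_nonneg_right
        (pow_le_pow_of_le_one (by norm_num) (by norm_num) hj) hR0.le
      have h4R : 4 * ρ ≤ R := by
        rw [← h4ρ]
        exact mul_le_of_le_one_left hR0.le (pow_le_one₀ (by norm_num) (by norm_num))
      rw [h4ρ] at ih
      clear_value ρ
      obtain ⟨ym, hym, hmin⟩ := (isCompact_closedBall X₀ (4 * ρ)).exists_isMinOn
        ⟨X₀, Metric.mem_closedBall_self (by positivity)⟩ hcont.continuousOn
      rw [mem_closedBall_iff_norm] at hym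
      have hMρ : 10 * M ≤ γ * ρ := hκR3.trans (mul_le_mul_of_nonneg_left hκρ hγ0.le)
      have hMρ2 : 10 * M * ρ ≤ γ * ρ ^ 2 := by
        linarith [mul_le_mul_of_nonneg_right hMρ hρ0.le, show γ * ρ * ρ = γ * ρ ^ 2 by ring]
      have hclose : ∀ y, ‖y - X₀‖ ≤ 4 * ρ →
          |U y - (‖y - X₀‖ ^ 2 / 2 + inner ℝ (P X₀) (y - X₀) + U X₀)| ≤ 8 * M * ρ := by
        intro y hy
        refine (h.abs_affine_sub_le (M := M) fun s hs => hVM _ (norm_add_smul_sub_le hs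
          (by rw [sub_self, norm_zero]; positivity) (by rw [add_sub_cancel]; linarith))).trans ?_
        have := mul_le_mul_of_nonneg_left hy (show 0 ≤ 2 * M by positivity)
        linarith
      have hD' : ∀ y, ‖y - X₀‖ ≤ 4 * ρ → |incr U e y| ≤ 2 * M * ρ := by
        intro y hy
        rw [incr_eq]
        have hDρ : D ≤ ρ := hκR2.trans hκρ
        have h1 := h.abs_pert_sub_le (M := M) (x := y) (v := e) (fun s hs =>
          hVM _ (norm_add_smul_sub_le hs (by linarith) (by
            rw [show y + e - X₀ = (y - X₀) + e by abel]
            exact (norm_add_le _ _).trans (by linarith))))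
        have h2 : M * ‖e‖ ≤ M * ρ := mul_le_mul_of_nonneg_left (heD.trans hDρ) hM0.le
        have h3 : ‖e‖ ^ 2 ≤ M * ρ := by
          rw [sq]
          refine mul_le_mul ?_ (heD.trans hDρ) (norm_nonneg _) hM0.le
          have : N * 1 ≤ M := mul_le_mul_of_nonneg_left (by linarith) hN0.le
          linarith
        refine (abs_add_le _ _).trans ?_
        rw [abs_of_nonneg (show 0 ≤ ‖e‖ ^ 2 / 2 by positivity)]
        linarith [mul_pos hM0 hρ0]
      have hsub : ∀ y t, U (y + e) - inner ℝ e y - t - (U y - t) = incr U e y := by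
        intro y t; simp only [incr]; ring
      have key := hγ F _ _ _ _ _ _ _ _ h.sol (h.shift he).sol hav.le X₀ (P X₀) (U X₀) ρ hρ0
        (hρ₀ ρ (hκR1.trans hκρ) X₀)
        (by
          intro y t hy _ _
          rw [show U y - t - (‖y - X₀‖ ^ 2 / 2 - t + inner ℝ (P X₀) (y - X₀) + U X₀) =
            U y - (‖y - X₀‖ ^ 2 / 2 + inner ℝ (P X₀) (y - X₀) + U X₀) by ring]
          linarith [hclose y hy, mul_pos hM0 hρ0])
        (by
          intro y t hy _ _
          rw [show U (y + e) - inner ℝ e y - t -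
            (‖y - X₀‖ ^ 2 / 2 - t + inner ℝ (P X₀) (y - X₀) + U X₀) =
            (U y - (‖y - X₀‖ ^ 2 / 2 + inner ℝ (P X₀) (y - X₀) + U X₀)) + incr U e y by
              simp only [incr]; ring]
          refine (abs_add_le _ _).trans ?_
          linarith [hclose y hy, hD' y hy])
        (incr U e ym) ((1 - γ / 2) ^ j * (N * c₀))
        (mul_pos (pow_pos (by linarith) _) (by positivity))
        (by
          intro y t hy _ _
          rw [hsub]
          refine ⟨hmin (by rwa [mem_closedBall_iff_norm]), ?_⟩
          linarith [ih ym y hym hy])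
        y y' (-ρ ^ 2) (-ρ ^ 2) hy hy' ⟨le_rfl, by nlinarith⟩ ⟨le_rfl, by nlinarith⟩
      rw [hsub, hsub] at key
      rw [pow_succ]
      linarith
  intro y y' hy hy'
  have h1 := claim J le_rfl y y' hy hy'
  have h2 := mul_le_mul_of_nonneg_right hJ.le hN0.le
  linarith

/-- Uniform equicontinuity of the normalized gradient perturbation. -/
theorem Ell.osc_pertGrad [Nontrivial E] (h : Ell F U P T) {Λ d : ℝ} {ν : Measure E}
    (hav : Averaged F Λ ν d) {ι : Type*} {b : ι → E} (hper : ∀ i x, F (x + b i) = F x) {D Cb : ℝ}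
    (hbD : ∀ i, ‖b i‖ ≤ D) (hD : 0 ≤ D) (hCb : 0 < Cb)
    (hb : ∀ v η, (∀ i, |inner ℝ v (b i)| ≤ η) → ‖v‖ ≤ Cb * η) {L δ : ℝ} (hL : 0 ≤ L)
    (hδ : 0 < δ) :
    ∃ κ : ℝ, 0 < κ ∧ κ ≤ 1 ∧ ∃ K : ℝ, 1 ≤ K ∧
      ∀ R N : ℝ, K ≤ R → K ≤ N → K * N ≤ R →
      (∀ x, ‖pertGrad P x‖ ≤ N * (1 + ‖x‖ / R)) → ∀ X₀ : E, ‖X₀‖ ≤ L * R →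
      ∀ y, ‖y - X₀‖ ≤ κ * R → ‖pertGrad P y - pertGrad P X₀‖ ≤ δ * N := by
  obtain ⟨κ, hκ0, hκ1, K, hK1, hK⟩ := h.osc_incr hav (D := D) (L := L) (δ := δ / (2 * Cb)) hD hL
    (by positivity)
  refine ⟨κ / 2, by positivity, by linarith, max K (max (2 * D / κ) (2 * Cb * D ^ 2 / δ)),
    hK1.trans (le_max_left _ _), ?_⟩
  intro R N hKR hKN hKNR hV X₀ hX₀ y hy
  have hN0 : 0 < N := by linarith [le_max_left K (max (2 * D / κ) (2 * Cb * D ^ 2 / δ))]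
  have hR0 : 0 < R := by linarith [le_max_left K (max (2 * D / κ) (2 * Cb * D ^ 2 / δ))]
  have hR2 : 2 * D / κ ≤ R := ((le_max_left _ _).trans (le_max_right _ _)).trans hKR
  have hN2 : 2 * Cb * D ^ 2 / δ ≤ N := ((le_max_right _ _).trans (le_max_right _ _)).trans hKN
  rw [div_le_iff₀ hκ0] at hR2
  rw [div_le_iff₀ hδ] at hN2
  have hKNR' : K * N ≤ R := (mul_le_mul_of_nonneg_right (le_max_left _ _) hN0.le).trans hKNR
  have hlow : ∀ x e, inner ℝ (pertGrad P x) e ≤ incr U e x := by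
    intro x e
    rw [incr_eq]
    exact h.inner_pertGrad_le x e
  have hup : ∀ x e, incr U e (x - e) - ‖e‖ ^ 2 ≤ inner ℝ (pertGrad P x) e := by
    intro x e
    have := h.inner_pertGrad_le x (-e)
    rw [inner_neg_right, norm_neg, ← sub_eq_add_neg] at this
    rw [incr_eq, sub_add_cancel]
    linarith
  have main : ∀ x x', ‖x - X₀‖ ≤ κ / 2 * R → ‖x' - X₀‖ ≤ κ / 2 * R → ∀ i,
      inner ℝ (pertGrad P x) (b i) - inner ℝ (pertGrad P x') (b i) ≤ δ / Cb * N := by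
    intro x x' hx hx' i
    have h1 := hK (b i) (hbD i) (hper i) R N ((le_max_left _ _).trans hKR)
      ((le_max_left _ _).trans hKN) hKNR' hV X₀ hX₀ (x' - b i) x (by
        rw [show x' - b i - X₀ = (x' - X₀) - b i by abel]
        refine (norm_sub_le _ _).trans ?_
        linarith [hbD i]) (hx.trans (by nlinarith [mul_pos hκ0 hR0]))
    have h2 := hlow x (b i)
    have h3 := hup x' (b i)
    have h4 : ‖b i‖ ^ 2 ≤ δ / (2 * Cb) * N := by
      have h5 : ‖b i‖ ^ 2 ≤ D ^ 2 := pow_le_pow_left₀ (norm_nonneg _) (hbD i) 2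
      have h6 : δ / (2 * Cb) * N = N * δ / (2 * Cb) := by ring
      rw [h6, le_div_iff₀ (by positivity)]
      nlinarith
    have h5 : δ / Cb * N = δ / (2 * Cb) * N + δ / (2 * Cb) * N := by field_simp; ring
    linarith
  have h0 : ‖X₀ - X₀‖ ≤ κ / 2 * R := by rw [sub_self, norm_zero]; positivity
  have := hb (pertGrad P y - pertGrad P X₀) (δ / Cb * N) (fun i => by
    rw [inner_sub_left, abs_le]
    exact ⟨by linarith [main X₀ y h0 hy i], main y X₀ hy h0 i⟩)
  refine this.trans (le_of_eq ?_)
  field_simp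

end Equicontinuity

section TestFunction

variable {E : Type*} [NormedAddCommGroup E] [InnerProductSpace ℝ E] [FiniteDimensional ℝ E]
  [MeasurableSpace E] [BorelSpace E]
variable {F U : E → ℝ} {P : E → E} {T : E → E →L[ℝ] E}

open scoped ContDiff

/-- A radial cutoff `ψ` together with the weight `φ` for which `∇ψ = -φ x`. -/
structure Cutoff (ψ φ : E → ℝ) : Prop where
  smooth : ContDiff ℝ ∞ ψ
  smooth' : ContDiff ℝ ∞ φ
  zero : ∀ x, 2 ≤ ‖x‖ → ψ x = 0
  zero' : ∀ x, 2 ≤ ‖x‖ → φ x = 0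
  grad : ∀ x, HasGradientAt ψ (-(φ x) • x) x
  nonneg : ∀ x, 0 ≤ φ x
  integral_pos : 0 < ∫ x, φ x

theorem hasCompactSupport_of_zero {Y : Type*} [Zero Y] {f : E → Y} {r : ℝ}
    (hf : ∀ x, r ≤ ‖x‖ → f x = 0) : HasCompactSupport f :=
  HasCompactSupport.intro (isCompact_closedBall (0:E) r) fun x hx => hf x (by
    rw [mem_closedBall_zero_iff, not_le] at hx; exact hx.le)

theorem exists_cutoff [Nontrivial E] : ∃ ψ φ : E → ℝ, Cutoff ψ φ := by
  set g := Real.smoothTransition with hg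
  have hgs : ContDiff ℝ ∞ g := Real.smoothTransition.contDiff
  have hg's : ContDiff ℝ ∞ (deriv g) := (contDiff_infty_iff_deriv.mp hgs).2
  have hin : ContDiff ℝ ∞ (fun x : E => 2 - ‖x‖ ^ 2) := contDiff_const.sub (contDiff_norm_sq ℝ)
  have hmono : Monotone g := Real.smoothTransition.monotone
  have hneg : ∀ x : E, 2 ≤ ‖x‖ → 2 - ‖x‖ ^ 2 < 0 := fun x hx => by nlinarith
  have hg'0 : ∀ s < 0, deriv g s = 0 := by
    intro s hs
    have : g =ᶠ[nhds s] fun _ => 0 := by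
      filter_upwards [Iio_mem_nhds hs] with r hr
      exact Real.smoothTransition.zero_of_nonpos (le_of_lt hr)
    rw [this.deriv_eq, deriv_const]
  have hφ0 : ∀ x : E, 2 ≤ ‖x‖ → 2 * deriv g (2 - ‖x‖ ^ 2) = 0 := fun x hx => by
    rw [hg'0 _ (hneg x hx), mul_zero]
  have hφnn : ∀ x : E, 0 ≤ 2 * deriv g (2 - ‖x‖ ^ 2) := fun x =>
    mul_nonneg zero_le_two (hmono.deriv_nonneg)
  have hφs : ContDiff ℝ ∞ (fun x : E => 2 * deriv g (2 - ‖x‖ ^ 2)) :=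
    contDiff_const.mul (hg's.comp hin)
  refine ⟨fun x => g (2 - ‖x‖ ^ 2), fun x => 2 * deriv g (2 - ‖x‖ ^ 2), hgs.comp hin, hφs,
    fun x hx => Real.smoothTransition.zero_of_nonpos (hneg x hx).le, hφ0, ?_, hφnn, ?_⟩
  · intro x
    rw [hasGradientAt_iff_hasFDerivAt]
    have h1 : HasDerivAt g (deriv g (2 - ‖x‖ ^ 2)) (2 - ‖x‖ ^ 2) :=
      (hgs.differentiable (by simp)).differentiableAt.hasDerivAt
    have h2 := (hasStrictFDerivAt_norm_sq x).hasFDerivAt.const_sub 2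
    refine (h1.comp_hasFDerivAt x h2).congr_fderiv ?_
    ext v
    simp
    ring
  · obtain ⟨s, hs, he⟩ := exists_deriv_eq_slope g zero_lt_one hgs.continuous.continuousOn
      (hgs.differentiable (by simp)).differentiableOn
    have h1 : deriv g s = 1 := by
      rw [he]; simp [hg]
    obtain ⟨x, hx⟩ := exists_norm_eq E (Real.sqrt_nonneg (2 - s))
    refine hφs.continuous.integral_pos_of_hasCompactSupport_nonneg_nonzero
      (hasCompactSupport_of_zero hφ0) hφnn (x := x) ?_
    rw [hx, Real.sq_sqrt (by linarith [hs.2]), show 2 - (2 - s) = s by ring, h1]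
    norm_num

theorem abs_integral_le_of_zero_outside {f : E → ℝ} {c r : ℝ} (h0 : ∀ x, r < ‖x‖ → f x = 0)
    (hc : ∀ x, ‖x‖ ≤ r → |f x| ≤ c) :
    |∫ x, f x| ≤ c * volume.real (Metric.closedBall (0:E) r) := by
  rw [← setIntegral_eq_integral_of_forall_compl_eq_zero (s := Metric.closedBall (0:E) r)
    (fun x hx => h0 x (by rwa [mem_closedBall_zero_iff, not_le] at hx)), ← Real.norm_eq_abs]
  exact norm_setIntegral_le_of_norm_le_const measure_closedBall_lt_top (fun x hx => by
    rw [Real.norm_eq_abs]; exact hc x (by rwa [mem_closedBall_zero_iff] at hx))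

theorem Ell.abs_integral_radial_le (h : Ell F U P T) {Λ d : ℝ} {ν : Measure E}
    (hav : Averaged F Λ ν d) (hs : Function.Surjective P) {ψ φ : E → ℝ} (hc : Cutoff ψ φ) :
    ∃ C : ℝ, 0 ≤ C ∧ ∀ (X₀ : E) (ρ M om : ℝ), 0 < ρ → d ≤ ρ → 0 ≤ M → M ≤ ρ → 0 ≤ om →
      (∀ x, ‖x‖ ≤ 3 → ‖pertGrad P (X₀ + ρ • x)‖ ≤ M) →
      (∀ x, 3 ≤ ‖x‖ → ‖pertGrad P (X₀ + ρ • x)‖ ≤ ρ * (‖x‖ - 2)) →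
      (∀ x k, ‖x‖ ≤ 3 → ‖k‖ ≤ d → ‖pertGrad P (X₀ + ρ • x + k) - pertGrad P (X₀ + ρ • x)‖ ≤ om) →
      |∫ x, φ x * inner ℝ (pertGrad P (X₀ + ρ • x)) x| ≤ C * (1 + M ^ 2 / ρ + om) := by
  set G : E → E := fun x => -(φ x) • x with hG
  have hGs : ContDiff ℝ ∞ G := (hc.smooth'.neg).smul contDiff_id
  have hG0 : ∀ x, 2 ≤ ‖x‖ → G x = 0 := fun x hx => by simp [hG, hc.zero' x hx]
  obtain ⟨LG, hLG⟩ := hGs.lipschitzWith_of_hasCompactSupport (hasCompactSupport_of_zero hG0)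
    (by simp)
  obtain ⟨Lψ, hLψ⟩ := hc.smooth.lipschitzWith_of_hasCompactSupport
    (hasCompactSupport_of_zero hc.zero) (by simp)
  obtain ⟨Gm, hGm⟩ := hGs.continuous.bounded_above_of_compact_support
    (hasCompactSupport_of_zero hG0)
  have hGm0 : 0 ≤ Gm := (norm_nonneg _).trans (hGm 0)
  have hLG' : ∀ x k, ‖G (x + k) - G x‖ ≤ LG * ‖k‖ := fun x k => by
    simpa using hLG.norm_sub_le (x + k) x
  have hLψ' : ∀ x k, |ψ (x + k) - ψ x| ≤ Lψ * ‖k‖ := fun x k => by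
    simpa using hLψ.norm_sub_le (x + k) x
  have hTaylor : ∀ x k, |ψ (x + k) - ψ x - inner ℝ (G x) k| ≤ LG * ‖k‖ ^ 2 := by
    intro x k
    obtain ⟨s, hs, he⟩ := exists_mean_value hc.grad x k
    rw [he, ← inner_sub_left]
    refine (abs_real_inner_le_norm _ _).trans ?_
    have h1 := hLG' x (s • k)
    rw [norm_smul, Real.norm_of_nonneg hs.1.le] at h1
    have h2 : s * ‖k‖ ≤ ‖k‖ := mul_le_of_le_one_left (norm_nonneg _) hs.2.le
    calc ‖G (x + s • k) - G x‖ * ‖k‖ ≤ (LG * ‖k‖) * ‖k‖ :=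
          mul_le_mul_of_nonneg_right (h1.trans (mul_le_mul_of_nonneg_left h2 LG.2)) (norm_nonneg _)
      _ = _ := by ring
  set vol := volume.real (Metric.closedBall (0:E) 3) with hvol
  have hvol0 : 0 ≤ vol := measureReal_nonneg
  have hΛ := hav.Λ_pos
  refine ⟨Λ * vol * (Lψ * |d| + LG + Gm + LG * |d|), by positivity, ?_⟩
  intro X₀ ρ M om hρ hdρ hM hMρ hom hV hVfar hosc
  set Vρ : E → E := fun x => pertGrad P (X₀ + ρ • x) with hVρ
  set Fρ : E → ℝ := fun x => F (X₀ + ρ • x) with hFρ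
  have hVc : Continuous Vρ := h.continuous_pertGrad.comp (by fun_prop)
  have hFc : Continuous Fρ := hav.cont.comp (by fun_prop)
  set g : E → ℝ := fun x => inner ℝ (G x) (Vρ x) with hg
  have hgc : Continuous g := hGs.continuous.inner hVc
  have hg0 : ∀ x, 2 ≤ ‖x‖ → g x = 0 := fun x hx => by
    simp only [hg]; rw [hG0 x hx, inner_zero_left]
  have hgcs := hasCompactSupport_of_zero hg0
  have hψcs := hasCompactSupport_of_zero hc.zero
  have hgoal : (∫ x, φ x * inner ℝ (pertGrad P (X₀ + ρ • x)) x) = -∫ x, g x := by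
    rw [← integral_neg]
    refine integral_congr_ae (Filter.Eventually.of_forall fun x => ?_)
    simp only [hg, hG, hVρ, inner_smul_left, conj_trivial]
    rw [real_inner_comm]; ring
  have hfar : ∀ x k : E, 3 < ‖x‖ → ‖k‖ ≤ d / ρ → 2 ≤ ‖x + k‖ := by
    intro x k hx hk
    have h1 : d / ρ ≤ 1 := by rw [div_le_one hρ]; exact hdρ
    have h2 : ‖x‖ ≤ ‖x + k‖ + ‖k‖ := by simpa using norm_sub_le (x + k) k
    linarith
  have hdabs : d / ρ ≤ |d| / ρ := by gcongr; exact le_abs_self d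
  have hI1 : |(∫ x, g x) - ∫ x, g x * Fρ x| ≤ Λ * ((Gm * om + LG * |d|) * vol) := by
    refine hav.abs_integral_sub_le hgc hgcs X₀ hρ fun k hk => ?_
    refine (le_abs_self _).trans (abs_integral_le_of_zero_outside (r := 3) ?_ ?_)
    · intro x hx
      rw [hg0 x (by linarith), hg0 _ (hfar x k hx hk), sub_zero, abs_zero]
    · intro x hx
      rw [abs_abs]
      have e : g (x + k) - g x = inner ℝ (G (x + k)) (Vρ (x + k) - Vρ x) +
          inner ℝ (G (x + k) - G x) (Vρ x) := by
        simp only [hg, inner_sub_left, inner_sub_right]; ring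
      rw [e]
      refine (abs_add_le _ _).trans (add_le_add ?_ ?_)
      · refine (abs_real_inner_le_norm _ _).trans (mul_le_mul (hGm _) ?_ (norm_nonneg _) hGm0)
        have := hosc x (ρ • k) hx (by
          rw [norm_smul, Real.norm_of_nonneg hρ.le, mul_comm]; exact (le_div_iff₀ hρ).mp hk)
        simpa only [hVρ, smul_add, add_assoc] using this
      · refine (abs_real_inner_le_norm _ _).trans ?_
        calc ‖G (x + k) - G x‖ * ‖Vρ x‖ ≤ (LG * (|d| / ρ)) * M :=
              mul_le_mul ((hLG' x k).trans (mul_le_mul_of_nonneg_left (hk.trans hdabs) LG.2))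
                (hV x hx) (norm_nonneg _) (by positivity)
          _ ≤ (LG * (|d| / ρ)) * ρ := by gcongr
          _ = LG * |d| := by field_simp
  have hI2 : |(∫ x, ψ x) - ∫ x, ψ x * Fρ x| ≤ Λ * ((Lψ * (|d| / ρ)) * vol) := by
    refine hav.abs_integral_sub_le hc.smooth.continuous hψcs X₀ hρ fun k hk => ?_
    refine (le_abs_self _).trans (abs_integral_le_of_zero_outside (r := 3) ?_ ?_)
    · intro x hx
      rw [hc.zero x (by linarith), hc.zero _ (hfar x k hx hk), sub_zero, abs_zero]
    · intro x hx
      rw [abs_abs]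
      exact (hLψ' x k).trans (mul_le_mul_of_nonneg_left (hk.trans hdabs) Lψ.2)
  have hfar2 : ∀ x, 3 ≤ ‖x‖ → ψ (x + ρ⁻¹ • Vρ x) = 0 := by
    intro x hx
    refine hc.zero _ ?_
    have h1 : ‖x‖ ≤ ‖x + ρ⁻¹ • Vρ x‖ + ‖ρ⁻¹ • Vρ x‖ := by
      simpa using norm_sub_le (x + ρ⁻¹ • Vρ x) (ρ⁻¹ • Vρ x)
    have h2 : ‖ρ⁻¹ • Vρ x‖ ≤ ‖x‖ - 2 := by
      rw [norm_smul, norm_inv, Real.norm_of_nonneg hρ.le, inv_mul_le_iff₀ hρ]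
      exact hVfar x hx
    linarith
  have hcv : (∫ x, Fρ x * ψ (x + ρ⁻¹ • Vρ x)) = ∫ x, ψ x :=
    h.integral_comp hs hav.pos X₀ hρ ψ
  have hi1 : Integrable (fun x => Fρ x * ψ (x + ρ⁻¹ • Vρ x)) :=
    (hFc.mul (hc.smooth.continuous.comp
      (continuous_id.add (hVc.const_smul ρ⁻¹)))).integrable_of_hasCompactSupport
      (hasCompactSupport_of_zero (r := 3) fun x hx => by
        show Fρ x * ψ (x + ρ⁻¹ • Vρ x) = 0
        rw [hfar2 x hx, mul_zero])
  have hi2 : Integrable (fun x => ψ x * Fρ x) :=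
    (hc.smooth.continuous.mul hFc).integrable_of_hasCompactSupport hψcs.mul_right
  have hi3 : Integrable (fun x => g x * Fρ x) :=
    (hgc.mul hFc).integrable_of_hasCompactSupport hgcs.mul_right
  have hi12 : Integrable (fun x => Fρ x * ψ (x + ρ⁻¹ • Vρ x) - ψ x * Fρ x) := hi1.sub hi2
  have hI3 : |(∫ x, ψ x) - (∫ x, ψ x * Fρ x) - ρ⁻¹ * ∫ x, g x * Fρ x| ≤
      Λ * (LG * (M / ρ) ^ 2) * vol := by
    rw [← hcv, ← integral_const_mul, ← integral_sub hi1 hi2,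
      ← integral_sub hi12 (hi3.const_mul _)]
    refine abs_integral_le_of_zero_outside (r := 3) ?_ ?_
    · intro x hx
      rw [hfar2 x hx.le, hc.zero x (by linarith), hg0 x (by linarith)]
      simp
    · intro x hx
      have e : Fρ x * ψ (x + ρ⁻¹ • Vρ x) - ψ x * Fρ x - ρ⁻¹ * (g x * Fρ x) =
          Fρ x * (ψ (x + ρ⁻¹ • Vρ x) - ψ x - inner ℝ (G x) (ρ⁻¹ • Vρ x)) := by
        simp only [hg, inner_smul_right]; ring
      rw [e, abs_mul, abs_of_pos (hav.pos _)]
      refine mul_le_mul (hav.le _) ((hTaylor _ _).trans ?_) (abs_nonneg _) hΛ.le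
      refine mul_le_mul_of_nonneg_left (pow_le_pow_left₀ (norm_nonneg _) ?_ 2) LG.2
      rw [norm_smul, norm_inv, Real.norm_of_nonneg hρ.le, inv_mul_eq_div]
      exact div_le_div_of_nonneg_right (hV x hx) hρ.le
  set A := (∫ x, ψ x) - ∫ x, ψ x * Fρ x with hA
  set B := ∫ x, g x * Fρ x with hB
  have hB2 : |B| ≤ Λ * vol * (Lψ * |d| + LG * (M ^ 2 / ρ)) := by
    have h1 : B = ρ * (A - (A - ρ⁻¹ * B)) := by field_simp; ring
    rw [h1, abs_mul, abs_of_pos hρ]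
    calc ρ * |A - (A - ρ⁻¹ * B)| ≤ ρ * (Λ * ((Lψ * (|d| / ρ)) * vol) +
          Λ * (LG * (M / ρ) ^ 2) * vol) :=
          mul_le_mul_of_nonneg_left ((abs_sub _ _).trans (add_le_add hI2 hI3)) hρ.le
      _ = _ := by field_simp
  have hfin : |∫ x, g x| ≤ Λ * ((Gm * om + LG * |d|) * vol) +
      Λ * vol * (Lψ * |d| + LG * (M ^ 2 / ρ)) := by
    have := abs_add_le ((∫ x, g x) - B) B
    rw [sub_add_cancel] at this
    linarith
  rw [hgoal, abs_neg]
  refine hfin.trans ?_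
  have hq : 0 ≤ M ^ 2 / ρ := by positivity
  have hLG0 : (0:ℝ) ≤ LG := LG.2
  have hLψ0 : (0:ℝ) ≤ Lψ := Lψ.2
  have e : Λ * vol * (Lψ * |d| + LG + Gm + LG * |d|) * (1 + M ^ 2 / ρ + om) -
      (Λ * ((Gm * om + LG * |d|) * vol) + Λ * vol * (Lψ * |d| + LG * (M ^ 2 / ρ))) =
      Λ * vol * ((Lψ * |d| + LG * |d|) * (M ^ 2 / ρ + om) + LG * (1 + om) + Gm * (1 + M ^ 2 / ρ)) := by
    ring
  have : 0 ≤ Λ * vol * ((Lψ * |d| + LG * |d|) * (M ^ 2 / ρ + om) + LG * (1 + om) +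
    Gm * (1 + M ^ 2 / ρ)) := by positivity
  linarith

end TestFunction

section RadialMean

variable {E : Type*} [NormedAddCommGroup E] [InnerProductSpace ℝ E] [FiniteDimensional ℝ E]
  [MeasurableSpace E] [BorelSpace E]
variable {W : E → ℝ} {V : E → E} {ψ φ : E → ℝ}

/-- The weighted radial mean of `W` about `X` at scale `ρ`. -/
def radialMean (φ W : E → ℝ) (X : E) (ρ : ℝ) : ℝ := ∫ x, φ x * W (X + ρ • x)

theorem abs_sub_le_of_hasGradientAt (hW : ∀ x, HasGradientAt W (V x) x) {x v : E} {M : ℝ}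
    (hM : ∀ s ∈ Icc (0:ℝ) 1, ‖V (x + s • v)‖ ≤ M) : |W (x + v) - W x| ≤ M * ‖v‖ := by
  obtain ⟨s, hs, he⟩ := exists_mean_value hW x v
  rw [he]
  exact (abs_real_inner_le_norm _ _).trans
    (mul_le_mul_of_nonneg_right (hM s ⟨hs.1.le, hs.2.le⟩) (norm_nonneg _))

theorem continuous_of_hasGradientAt (hW : ∀ x, HasGradientAt W (V x) x) : Continuous W :=
  continuous_iff_continuousAt.mpr fun x => (hW x).continuousAt

theorem Cutoff.hasCompactSupport (hc : Cutoff ψ φ) : HasCompactSupport φ :=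
  hasCompactSupport_of_zero hc.zero'

theorem Cutoff.integrable_mul (hc : Cutoff ψ φ) {f : E → ℝ} (hf : Continuous f) :
    Integrable (fun x => φ x * f x) :=
  (hc.smooth'.continuous.mul hf).integrable_of_hasCompactSupport hc.hasCompactSupport.mul_right

theorem Cutoff.hasDerivAt_radialMean (hc : Cutoff ψ φ) (hW : ∀ x, HasGradientAt W (V x) x)
    (hV : Continuous V) (X : E) (ρ : ℝ) :
    HasDerivAt (radialMean φ W X) (∫ x, φ x * inner ℝ (V (X + ρ • x)) x) ρ := by
  have hWc := continuous_of_hasGradientAt hW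
  have hcont : Continuous (fun q : ℝ × E => φ q.2 * inner ℝ (V (X + q.1 • q.2)) q.2) :=
    (hc.smooth'.continuous.comp continuous_snd).mul
      ((hV.comp (by fun_prop)).inner continuous_snd)
  obtain ⟨c, hcb⟩ := ((isCompact_closedBall ρ 1).prod
    (isCompact_closedBall (0:E) 2)).exists_bound_of_continuousOn hcont.continuousOn
  refine (hasDerivAt_integral_of_dominated_loc_of_deriv_le (μ := volume)
    (F := fun r x => φ x * W (X + r • x)) (F' := fun r x => φ x * inner ℝ (V (X + r • x)) x)
    (bound := (Metric.closedBall (0:E) 2).indicator fun _ => c) (s := Metric.ball ρ 1)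
    (Metric.ball_mem_nhds ρ one_pos) ?_ ?_ ?_ ?_ ?_ ?_).2
  · exact Filter.Eventually.of_forall fun r =>
      (hc.integrable_mul (hWc.comp (by fun_prop))).aestronglyMeasurable
  · exact hc.integrable_mul (hWc.comp (by fun_prop))
  · exact (hc.integrable_mul ((hV.comp (by fun_prop)).inner continuous_id)).aestronglyMeasurable
  · refine Filter.Eventually.of_forall fun x r hr => ?_
    by_cases hx : x ∈ Metric.closedBall (0:E) 2
    · rw [indicator_of_mem hx]
      exact hcb (r, x) ⟨Metric.ball_subset_closedBall hr, hx⟩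
    · rw [indicator_of_notMem hx]
      rw [mem_closedBall_zero_iff, not_le] at hx
      simp [hc.zero' x hx.le]
  · exact (integrable_indicator_iff measurableSet_closedBall).mpr
      (integrableOn_const measure_closedBall_lt_top.ne)
  · refine Filter.Eventually.of_forall fun x r _ => ?_
    refine HasDerivAt.const_mul _ ?_
    have h1 : HasDerivAt (fun r : ℝ => X + r • x) x r := by
      simpa using ((hasDerivAt_id r).smul_const x).const_add X
    have h2 := (hW (X + r • x)).hasFDerivAt.comp_hasDerivAt r h1
    exact h2.congr_deriv (by simp)

theorem Cutoff.abs_radialMean_sub_le (hc : Cutoff ψ φ) (hW : ∀ x, HasGradientAt W (V x) x)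
    (hV : Continuous V) {X : E} {ρ₀ ρ₁ c : ℝ} (hρ : ρ₀ ≤ ρ₁)
    (hb : ∀ ρ ∈ Icc ρ₀ ρ₁, |∫ x, φ x * inner ℝ (V (X + ρ • x)) x| ≤ c) :
    |radialMean φ W X ρ₁ - radialMean φ W X ρ₀| ≤ c * (ρ₁ - ρ₀) := by
  have := (convex_Icc ρ₀ ρ₁).norm_image_sub_le_of_norm_hasDerivWithin_le
    (f := radialMean φ W X) (C := c)
    (fun ρ _ => (hc.hasDerivAt_radialMean hW hV X ρ).hasDerivWithinAt)
    (fun ρ hρ => by rw [Real.norm_eq_abs]; exact hb ρ hρ) (left_mem_Icc.mpr hρ)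
    (right_mem_Icc.mpr hρ)
  simpa [abs_of_nonneg (sub_nonneg.mpr hρ)] using this

theorem Cutoff.abs_radialMean_sub_mul_le (hc : Cutoff ψ φ) (hW : ∀ x, HasGradientAt W (V x) x)
    {X : E} {ρ M : ℝ} (hρ : 0 ≤ ρ) (hM : ∀ x, ‖x‖ ≤ 2 → ‖V (X + ρ • x)‖ ≤ M) :
    |radialMean φ W X ρ - (∫ x, φ x) * W X| ≤ (∫ x, φ x) * (2 * ρ * M) := by
  have hWc := continuous_of_hasGradientAt hW
  have hM0 : 0 ≤ M := (norm_nonneg _).trans (hM 0 (by simp))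
  have hi : Integrable φ := hc.smooth'.continuous.integrable_of_hasCompactSupport
    hc.hasCompactSupport
  have hi1 : Integrable (fun x => φ x * W (X + ρ • x)) :=
    hc.integrable_mul (hWc.comp (by fun_prop))
  rw [radialMean, ← integral_mul_const, ← integral_mul_const,
    ← integral_sub hi1 (hi.mul_const _)]
  rw [← Real.norm_eq_abs]
  refine norm_integral_le_of_norm_le (hi.mul_const _) (Filter.Eventually.of_forall fun x => ?_)
  rw [← mul_sub, norm_mul, Real.norm_of_nonneg (hc.nonneg x)]
  by_cases hx : 2 ≤ ‖x‖
  · simp [hc.zero' x hx]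
  push Not at hx
  refine mul_le_mul_of_nonneg_left ?_ (hc.nonneg x)
  rw [Real.norm_eq_abs]
  refine (abs_sub_le_of_hasGradientAt hW (M := M) fun s hs => ?_).trans ?_
  · rw [smul_comm]
    refine hM _ ?_
    rw [norm_smul, Real.norm_of_nonneg hs.1]
    nlinarith [norm_nonneg x, hs.1, hs.2]
  · rw [norm_smul, Real.norm_of_nonneg hρ]
    have : ρ * ‖x‖ ≤ ρ * 2 := mul_le_mul_of_nonneg_left hx.le hρ
    nlinarith

theorem Cutoff.exists_second_difference (hc : Cutoff ψ φ) :
    ∃ C : ℝ, 0 ≤ C ∧ ∀ y k, |φ (y - k) + φ (y + k) - 2 * φ y| ≤ C * ‖k‖ ^ 2 := by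
  have hsm := hc.smooth'
  have hd := (contDiff_infty_iff_fderiv.mp hsm).2
  obtain ⟨L, hL⟩ := hd.lipschitzWith_of_hasCompactSupport (hc.hasCompactSupport.fderiv ℝ)
    (by simp)
  have hg : ∀ x, HasGradientAt φ (gradient φ x) x := fun x =>
    (hsm.differentiable (by simp) x).hasGradientAt
  have hgL : ∀ x y, ‖gradient φ x - gradient φ y‖ ≤ L * ‖x - y‖ := by
    intro x y
    rw [gradient, gradient, ← map_sub, LinearIsometryEquiv.norm_map]
    exact hL.norm_sub_le x y
  refine ⟨L * 2, mul_nonneg L.2 zero_le_two, fun y k => ?_⟩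
  obtain ⟨s, hs, he⟩ := exists_mean_value hg y k
  obtain ⟨r, hr, hre⟩ := exists_mean_value hg y (-k)
  have e : φ (y - k) + φ (y + k) - 2 * φ y =
      inner ℝ (gradient φ (y + s • k) - gradient φ (y + r • -k)) k := by
    rw [inner_sub_left, ← he, sub_eq_add_neg y k]
    rw [inner_neg_right] at hre
    linarith
  rw [e]
  refine (abs_real_inner_le_norm _ _).trans ?_
  have h1 : ‖(y + s • k) - (y + r • -k)‖ ≤ 2 * ‖k‖ := by
    have : (y + s • k) - (y + r • -k) = (s + r) • k := by module
    rw [this, norm_smul, Real.norm_of_nonneg (by linarith [hs.1, hr.1])]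
    exact mul_le_mul_of_nonneg_right (by linarith [hs.2, hr.2]) (norm_nonneg _)
  calc _ ≤ (L * (2 * ‖k‖)) * ‖k‖ := mul_le_mul_of_nonneg_right
        ((hgL _ _).trans (mul_le_mul_of_nonneg_left h1 L.2)) (norm_nonneg _)
    _ = _ := by ring

theorem radialMean_shift (W : E → ℝ) (m k : E) {ρ : ℝ} (hρ : 0 < ρ) :
    radialMean φ W (m + k) ρ = ∫ x, φ (x - ρ⁻¹ • k) * W (m + ρ • x) := by
  rw [radialMean, ← integral_sub_right_eq_self (μ := volume) _ (ρ⁻¹ • k)]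
  refine integral_congr_ae (Filter.Eventually.of_forall fun x => ?_)
  simp only [smul_sub, smul_inv_smul₀ hρ.ne']
  congr 2
  abel

theorem Cutoff.exists_radialMean_second_difference (hc : Cutoff ψ φ) :
    ∃ C : ℝ, 0 ≤ C ∧ ∀ (W : E → ℝ) (V : E → E), (∀ x, HasGradientAt W (V x) x) →
      ∀ (m k : E) (ρ M : ℝ), 0 < ρ → ‖k‖ ≤ ρ → (∀ x, ‖x‖ ≤ 3 → ‖V (m + ρ • x)‖ ≤ M) →
      |radialMean φ W (m + k) ρ + radialMean φ W (m - k) ρ - 2 * radialMean φ W m ρ| ≤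
        C * (M * ‖k‖ ^ 2 / ρ) := by
  obtain ⟨C, hC, hCb⟩ := hc.exists_second_difference
  refine ⟨C * 3 * volume.real (Metric.closedBall (0:E) 3), by positivity, ?_⟩
  intro W V hW m k ρ M hρ hk hM
  have hWc := continuous_of_hasGradientAt hW
  have hM0 : 0 ≤ M := (norm_nonneg _).trans (hM 0 (by simp))
  set κ := ρ⁻¹ • k with hκ
  have hκn : ‖κ‖ = ‖k‖ / ρ := by
    rw [hκ, norm_smul, norm_inv, Real.norm_of_nonneg hρ.le, inv_mul_eq_div]
  have hκ1 : ‖κ‖ ≤ 1 := by rw [hκn, div_le_one hρ]; exact hk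
  set w : E → ℝ := fun x => W (m + ρ • x) with hw
  have hwc : Continuous w := hWc.comp (by fun_prop)
  have hφc := hc.smooth'.continuous
  have hcs : ∀ v : E, HasCompactSupport fun x => φ (x - v) := fun v =>
    hc.hasCompactSupport.comp_homeomorph (Homeomorph.subRight v)
  have hi : ∀ v : E, Integrable fun x => φ (x - v) := fun v =>
    (hφc.comp (by fun_prop)).integrable_of_hasCompactSupport (hcs v)
  have hiw : ∀ v : E, Integrable fun x => φ (x - v) * w x := fun v =>
    ((hφc.comp (by fun_prop)).mul hwc).integrable_of_hasCompactSupport (hcs v).mul_right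
  have key : radialMean φ W (m + k) ρ + radialMean φ W (m - k) ρ - 2 * radialMean φ W m ρ =
      ∫ x, (φ (x - κ) + φ (x + κ) - 2 * φ x) * (w x - w 0) := by
    have h1 := radialMean_shift (φ := φ) W m k hρ
    have h2 := radialMean_shift (φ := φ) W m (-k) hρ
    have h3 : radialMean φ W m ρ = ∫ x, φ (x - 0) * w x := by simp [radialMean, hw]
    rw [← sub_eq_add_neg, smul_neg] at h2
    have hz : ∀ v : E, ∫ x, φ (x - v) = ∫ x, φ x := fun v => integral_sub_right_eq_self φ v
    have e : ∀ x, (φ (x - κ) + φ (x + κ) - 2 * φ x) * (w x - w 0) =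
        (φ (x - κ) * w x - φ (x - κ) * w 0) + (φ (x - -κ) * w x - φ (x - -κ) * w 0) -
          2 * (φ (x - 0) * w x - φ (x - 0) * w 0) := by
      intro x; rw [sub_neg_eq_add, sub_zero]; ring
    have hd : ∀ v : E, Integrable fun x => φ (x - v) * w x - φ (x - v) * w 0 := fun v =>
      (hiw v).sub ((hi v).mul_const _)
    have hdi : ∀ v : E, ∫ x, (φ (x - v) * w x - φ (x - v) * w 0) =
        (∫ x, φ (x - v) * w x) - (∫ x, φ x) * w 0 := fun v => by
      rw [integral_sub (hiw v) ((hi v).mul_const _), integral_mul_const, hz]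
    have hs : Integrable fun x => (φ (x - κ) * w x - φ (x - κ) * w 0) +
        (φ (x - -κ) * w x - φ (x - -κ) * w 0) := (hd κ).add (hd (-κ))
    rw [h1, h2, h3]
    simp_rw [e]
    rw [integral_sub hs ((hd 0).const_mul 2), integral_add (hd κ) (hd (-κ)), integral_const_mul,
      hdi, hdi, hdi]
    ring
  rw [key]
  have hb := abs_integral_le_of_zero_outside (E := E) (r := 3) (c := C * ‖κ‖ ^ 2 * (M * (3 * ρ)))
    (f := fun x => (φ (x - κ) + φ (x + κ) - 2 * φ x) * (w x - w 0)) ?_ ?_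
  · refine hb.trans (le_of_eq ?_)
    rw [hκn]; field_simp
  · intro x hx
    have h1 : 2 ≤ ‖x - κ‖ := by linarith [norm_sub_norm_le x κ]
    have h2 : 2 ≤ ‖x + κ‖ := by
      have := norm_sub_norm_le x (-κ)
      rw [norm_neg, sub_neg_eq_add] at this; linarith
    simp [hc.zero' _ h1, hc.zero' _ h2, hc.zero' x (by linarith)]
  · intro x hx
    rw [abs_mul]
    refine mul_le_mul (hCb x κ) ?_ (abs_nonneg _) (by positivity)
    have h1 : |W (m + ρ • x) - W m| ≤ M * ‖ρ • x‖ :=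
      abs_sub_le_of_hasGradientAt hW fun s hs => by
        rw [smul_comm]
        refine hM _ ?_
        rw [norm_smul, Real.norm_of_nonneg hs.1]
        nlinarith [norm_nonneg x, hs.1, hs.2]
    rw [norm_smul, Real.norm_of_nonneg hρ.le] at h1
    have h2 : M * (ρ * ‖x‖) ≤ M * (3 * ρ) := mul_le_mul_of_nonneg_left (by nlinarith) hM0
    simpa [hw] using h1.trans h2

theorem Cutoff.exists_abs_second_difference_le (hc : Cutoff ψ φ) :
    ∃ C : ℝ, 0 ≤ C ∧ ∀ (W : E → ℝ) (V : E → E), (∀ x, HasGradientAt W (V x) x) → Continuous V →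
      ∀ (m k : E) (ρ₀ ρ₁ M₀ M₁ c : ℝ), 0 < ρ₀ → ρ₀ ≤ ρ₁ → ‖k‖ ≤ ρ₁ →
      (∀ x, ‖x‖ ≤ 3 → ‖V (m + ρ₁ • x)‖ ≤ M₁) →
      (∀ X ∈ ({m + k, m - k, m} : Set E), ∀ x, ‖x‖ ≤ 2 → ‖V (X + ρ₀ • x)‖ ≤ M₀) →
      (∀ X ∈ ({m + k, m - k, m} : Set E), ∀ ρ ∈ Icc ρ₀ ρ₁,
        |∫ x, φ x * inner ℝ (V (X + ρ • x)) x| ≤ c) →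
      (∫ x, φ x) * |W (m + k) + W (m - k) - 2 * W m| ≤
        C * (M₁ * ‖k‖ ^ 2 / ρ₁) + 4 * (c * (ρ₁ - ρ₀)) + 4 * ((∫ x, φ x) * (2 * ρ₀ * M₀)) := by
  obtain ⟨C, hC, hCb⟩ := hc.exists_radialMean_second_difference
  refine ⟨C, hC, ?_⟩
  intro W V hW hV m k ρ₀ ρ₁ M₀ M₁ c hρ₀ hρ hk hM₁ hM₀ hcb
  have h0 := hCb W V hW m k ρ₁ M₁ (hρ₀.trans_le hρ) hk hM₁
  have h1 : ∀ X ∈ ({m + k, m - k, m} : Set E),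
      |radialMean φ W X ρ₁ - (∫ x, φ x) * W X| ≤
        c * (ρ₁ - ρ₀) + (∫ x, φ x) * (2 * ρ₀ * M₀) := by
    intro X hX
    have a := hc.abs_radialMean_sub_le hW hV hρ (hcb X hX)
    have b := hc.abs_radialMean_sub_mul_le hW hρ₀.le (hM₀ X hX)
    exact (abs_sub_le _ _ _).trans (add_le_add a b)
  have a1 := h1 (m + k) (by simp)
  have a2 := h1 (m - k) (by simp)
  have a3 := h1 m (by simp)
  rw [← abs_of_pos hc.integral_pos, ← abs_mul, abs_of_pos hc.integral_pos]
  set I := ∫ x, φ x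
  rw [abs_le] at h0 a1 a2 a3 ⊢
  constructor <;> linarith [h0.1, h0.2, a1.1, a1.2, a2.1, a2.2, a3.1, a3.2]

end RadialMean

section SecondDifference

variable {E : Type*} [NormedAddCommGroup E] [InnerProductSpace ℝ E] [FiniteDimensional ℝ E]
  [MeasurableSpace E] [BorelSpace E]
variable {F U : E → ℝ} {P : E → E} {T : E → E →L[ℝ] E}

theorem norm_add_smul_le {X x : E} {R ρ L : ℝ} (hX : ‖X‖ ≤ 2 * R) (hρ0 : 0 ≤ ρ)
    (hρ : ρ ≤ L * R) : ‖X + ρ • x‖ ≤ (2 + L * ‖x‖) * R := by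
  refine (norm_add_le _ _).trans ?_
  rw [norm_smul, Real.norm_of_nonneg hρ0]
  nlinarith [mul_le_mul_of_nonneg_right hρ (norm_nonneg x)]

theorem Ell.abs_integral_radial_small [Nontrivial E] (h : Ell F U P T) {Λ d : ℝ} {ν : Measure E}
    (hav : Averaged F Λ ν d) {ι : Type*} {b : ι → E} (hper : ∀ i x, F (x + b i) = F x) {D Cb : ℝ}
    (hbD : ∀ i, ‖b i‖ ≤ D) (hD : 0 ≤ D) (hCb : 0 < Cb)
    (hb : ∀ v η, (∀ i, |inner ℝ v (b i)| ≤ η) → ‖v‖ ≤ Cb * η)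
    (hs : Function.Surjective P) {ψ φ : E → ℝ} (hc : Cutoff ψ φ) {r L η : ℝ} (hr : 0 < r)
    (hL : 0 ≤ L) (hη : 0 < η) :
    ∃ K : ℝ, 1 ≤ K ∧ ∀ R N : ℝ, K ≤ R → K ≤ N → K * N ≤ R →
      (∀ x, ‖pertGrad P x‖ ≤ N * (1 + ‖x‖ / R)) → ∀ X : E, ‖X‖ ≤ 2 * R →
      ∀ ρ ∈ Icc (r * R) (L * R), |∫ x, φ x * inner ℝ (pertGrad P (X + ρ • x)) x| ≤ η * N := by
  obtain ⟨C, hC0, hC⟩ := h.abs_integral_radial_le hav hs hc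
  obtain ⟨κ, hκ0, hκ1, K₀, hK₀, hosc⟩ := h.osc_pertGrad hav hper hbD hD hCb hb
    (L := 2 + L * 3) (δ := η / (3 * (C + 1))) (by positivity) (by positivity)
  set a := 3 * (1 + L) with ha
  have ha0 : 0 < a := by positivity
  clear_value a
  have p1 : 0 ≤ 3 * (C + 1) / η := by positivity
  have p2 : 0 ≤ 3 * (C + 1) * a ^ 2 / (r * η) := by positivity
  have p3 : 0 ≤ a / r := by positivity
  have p4 : 0 ≤ |d| / r := by positivity
  have p5 : 0 ≤ |d| / κ := by positivity
  refine ⟨K₀ + 3 * (C + 1) / η + 3 * (C + 1) * a ^ 2 / (r * η) + a / r + |d| / r + |d| / κ,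
    by linarith, ?_⟩
  set K := K₀ + 3 * (C + 1) / η + 3 * (C + 1) * a ^ 2 / (r * η) + a / r + |d| / r + |d| / κ
    with hK
  have q0 : K₀ ≤ K := by linarith
  have q1 : 3 * (C + 1) / η ≤ K := by linarith
  have q2 : 3 * (C + 1) * a ^ 2 / (r * η) ≤ K := by linarith
  have q3 : a / r ≤ K := by linarith
  have q4 : |d| / r ≤ K := by linarith
  have q5 : |d| / κ ≤ K := by linarith
  clear_value K
  intro R N hR hN hNR hV X hX ρ hρ
  have hN0 : 0 < N := by linarith
  have hR0 : 0 < R := by linarith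
  have hrR : 0 < r * R := by positivity
  have hρ0 : 0 < ρ := hrR.trans_le hρ.1
  have s1 : 3 * (C + 1) ≤ η * N := by
    have := q1.trans hN; rw [div_le_iff₀ hη] at this; linarith
  have s2 : 3 * (C + 1) * (a * N) ^ 2 ≤ η * N * (r * R) := by
    have h1 : 3 * (C + 1) * a ^ 2 / (r * η) * N ≤ R :=
      (mul_le_mul_of_nonneg_right q2 hN0.le).trans hNR
    rw [div_mul_eq_mul_div, div_le_iff₀ (by positivity)] at h1
    have h2 := mul_le_mul_of_nonneg_right h1 hN0.le
    calc _ = 3 * (C + 1) * a ^ 2 * N * N := by ring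
      _ ≤ _ := h2
      _ = _ := by ring
  have s3 : a * N ≤ r * R := by
    have h1 : a / r * N ≤ R := (mul_le_mul_of_nonneg_right q3 hN0.le).trans hNR
    rw [div_mul_eq_mul_div, div_le_iff₀ hr] at h1; linarith
  have s4 : |d| ≤ r * R := by
    have h1 := q4.trans hR
    rw [div_le_iff₀ hr] at h1; linarith
  have s5 : |d| ≤ κ * R := by
    have h1 := q5.trans hR
    rw [div_le_iff₀ hκ0] at h1; linarith
  have hVb : ∀ x, ‖pertGrad P (X + ρ • x)‖ ≤ N * (3 + L * ‖x‖) := by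
    intro x
    refine (hV _).trans (mul_le_mul_of_nonneg_left ?_ hN0.le)
    have := norm_add_smul_le (x := x) hX hρ0.le hρ.2
    rw [← div_le_iff₀ hR0] at this
    linarith
  have hfin := hC X ρ (a * N) (η / (3 * (C + 1)) * N) hρ0
    ((le_abs_self d).trans (s4.trans hρ.1)) (by positivity) (s3.trans hρ.1) (by positivity)
    ?_ ?_ ?_
  · refine hfin.trans ?_
    have t1 : (a * N) ^ 2 / ρ ≤ η * N / (3 * (C + 1)) := by
      rw [div_le_div_iff₀ hρ0 (by positivity)]
      have := mul_le_mul_of_nonneg_left hρ.1 (show 0 ≤ η * N by positivity)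
      linarith
    have t2 : 1 ≤ η * N / (3 * (C + 1)) := by rw [le_div_iff₀ (by positivity)]; linarith
    have t3 : 1 + (a * N) ^ 2 / ρ + η / (3 * (C + 1)) * N ≤ η * N / (C + 1) := by
      have e : η * N / (C + 1) = η * N / (3 * (C + 1)) + η * N / (3 * (C + 1)) +
        η / (3 * (C + 1)) * N := by field_simp; ring
      rw [e]; linarith
    calc _ ≤ C * (η * N / (C + 1)) := mul_le_mul_of_nonneg_left t3 hC0
      _ = C / (C + 1) * (η * N) := by ring
      _ ≤ 1 * (η * N) := by
        refine mul_le_mul_of_nonneg_right ?_ (by positivity)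
        rw [div_le_one (by positivity)]; linarith
      _ = η * N := one_mul _
  · intro x hx
    refine (hVb x).trans ?_
    rw [ha, mul_comm]
    refine mul_le_mul_of_nonneg_right ?_ hN0.le
    nlinarith
  · intro x hx
    refine (hVb x).trans ?_
    have h1 : a * N ≤ ρ := s3.trans hρ.1
    have h2 : a * N * (‖x‖ / 3) ≤ ρ * (‖x‖ - 2) :=
      mul_le_mul h1 (by linarith) (by positivity) hρ0.le
    have h3 : N * (3 + L * ‖x‖) ≤ a * N * (‖x‖ / 3) := by
      rw [ha]
      have : a * N * (‖x‖ / 3) = N * (‖x‖ + L * ‖x‖) := by rw [ha]; ring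
      rw [← ha, this]
      exact mul_le_mul_of_nonneg_left (by linarith) hN0.le
    linarith
  · intro x k hx hk
    refine hosc R N (q0.trans hR) (q0.trans hN)
      ((mul_le_mul_of_nonneg_right q0 hN0.le).trans hNR) hV _ ?_ _ ?_
    · refine (norm_add_smul_le hX hρ0.le hρ.2).trans (mul_le_mul_of_nonneg_right ?_ hR0.le)
      linarith [mul_le_mul_of_nonneg_left hx hL]
    · rw [add_sub_cancel_left]
      exact (hk.trans (le_abs_self d)).trans s5

theorem exists_rpow_le_mul {β γ : ℝ} (hβ : β < 1) (hγ : 0 < γ) :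
    ∃ L : ℝ, 1 ≤ L ∧ (5 * L) ^ β ≤ γ * L := by
  have h1 := (tendsto_rpow_neg_atTop (sub_pos.mpr hβ)).eventually (gt_mem_nhds
    (show (0:ℝ) < γ / 5 by positivity))
  obtain ⟨L, hL, hL1⟩ := (h1.and (Filter.eventually_ge_atTop 1)).exists
  have hL0 : 0 < L := by linarith
  refine ⟨L, hL1, ?_⟩
  rw [Real.mul_rpow (by norm_num) hL0.le]
  have h2 : (5:ℝ) ^ β ≤ 5 := by
    simpa using Real.rpow_le_rpow_of_exponent_le (by norm_num : (1:ℝ) ≤ 5) hβ.le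
  have h3 : L ^ β = L ^ (-(1 - β)) * L := by
    rw [← Real.rpow_add_one hL0.ne']; congr 1; ring
  rw [h3]
  have h4 : 0 ≤ L ^ (-(1 - β)) * L := by positivity
  calc _ ≤ 5 * (L ^ (-(1 - β)) * L) := mul_le_mul_of_nonneg_right h2 h4
    _ ≤ 5 * (γ / 5 * L) := by gcongr
    _ = γ * L := by ring

theorem Ell.abs_second_difference_le [Nontrivial E] (h : Ell F U P T) {Λ d : ℝ} {ν : Measure E}
    (hav : Averaged F Λ ν d) {ι : Type*} {b : ι → E} (hper : ∀ i x, F (x + b i) = F x) {D Cb : ℝ}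
    (hbD : ∀ i, ‖b i‖ ≤ D) (hD : 0 ≤ D) (hCb : 0 < Cb)
    (hb : ∀ v η, (∀ i, |inner ℝ v (b i)| ≤ η) → ‖v‖ ≤ Cb * η)
    (hs : Function.Surjective P) {β η : ℝ} (hβ0 : 0 ≤ β) (hβ : β < 1) (hη : 0 < η) :
    ∃ K : ℝ, 1 ≤ K ∧ ∀ R N : ℝ, K ≤ R → K ≤ N → K * N ≤ R →
      (∀ x, ‖pertGrad P x‖ ≤ N * (1 + ‖x‖ / R) ^ β) → ∀ m k : E, ‖m‖ ≤ R → ‖k‖ ≤ R →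
      |pert U (m + k) + pert U (m - k) - 2 * pert U m| ≤ η * (N * R) := by
  obtain ⟨ψ, φ, hc⟩ := exists_cutoff (E := E)
  obtain ⟨C, hC0, hC⟩ := hc.exists_abs_second_difference_le
  set I := ∫ x, φ x with hI
  have hI0 : 0 < I := hc.integral_pos
  clear_value I
  obtain ⟨L, hL1, hL⟩ := exists_rpow_le_mul hβ (γ := I * η / (3 * (C + 1))) (by positivity)
  have hL0 : 0 < L := by linarith
  set r := min 1 (η / 120) with hr
  have hr0 : 0 < r := by positivity
  have hr1 : r ≤ 1 := min_le_left _ _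
  have hr2 : r ≤ η / 120 := min_le_right _ _
  clear_value r
  obtain ⟨K, hK1, hK⟩ := h.abs_integral_radial_small hav hper hbD hD hCb hb hs hc hr0 hL0.le
    (η := I * η / (12 * L)) (by positivity)
  refine ⟨K, hK1, ?_⟩
  intro R N hR hN hNR hV m k hm hk
  have hN0 : 0 < N := by linarith
  have hR0 : 0 < R := by linarith
  have hV1 : ∀ x, ‖pertGrad P x‖ ≤ N * (1 + ‖x‖ / R) := fun x =>
    (hV x).trans (mul_le_mul_of_nonneg_left (by
      have h1 : 1 ≤ 1 + ‖x‖ / R := by have : 0 ≤ ‖x‖ / R := by positivity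
                                      linarith
      simpa using Real.rpow_le_rpow_of_exponent_le h1 hβ.le) hN0.le)
  have hX : ∀ X ∈ ({m + k, m - k, m} : Set E), ‖X‖ ≤ 2 * R := by
    intro X hX
    simp only [mem_insert_iff, mem_singleton_iff] at hX
    rcases hX with rfl | rfl | rfl
    · linarith [norm_add_le m k]
    · linarith [norm_sub_le m k]
    · linarith
  have key := hC (pert U) (pertGrad P) h.hasGradientAt_pert h.continuous_pertGrad m k (r * R)
    (L * R) (5 * N) (N * (5 * L) ^ β) (I * η / (12 * L) * N) (by positivity)
    (mul_le_mul_of_nonneg_right (hr1.trans hL1) hR0.le)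
    (hk.trans (le_mul_of_one_le_left hR0.le hL1)) ?_ ?_
    (fun X hX' => hK R N hR hN hNR hV1 X (hX X hX'))
  · have t1 : C * (N * (5 * L) ^ β * ‖k‖ ^ 2 / (L * R)) ≤ I * η / 3 * (N * R) := by
      have h1 : ‖k‖ ^ 2 ≤ R ^ 2 := pow_le_pow_left₀ (norm_nonneg _) hk 2
      have h2 : N * (5 * L) ^ β * ‖k‖ ^ 2 / (L * R) ≤
          N * (I * η / (3 * (C + 1)) * L) * R ^ 2 / (L * R) := by gcongr
      have h3 : N * (I * η / (3 * (C + 1)) * L) * R ^ 2 / (L * R) =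
          (I * η / 3 * (N * R)) / (C + 1) := by field_simp
      rw [h3] at h2
      calc _ ≤ C * ((I * η / 3 * (N * R)) / (C + 1)) := mul_le_mul_of_nonneg_left h2 hC0
        _ = C / (C + 1) * (I * η / 3 * (N * R)) := by ring
        _ ≤ 1 * (I * η / 3 * (N * R)) := by
          refine mul_le_mul_of_nonneg_right ?_ (by positivity)
          rw [div_le_one (by positivity)]; linarith
        _ = _ := one_mul _
    have t2 : 4 * (I * η / (12 * L) * N * (L * R - r * R)) ≤ I * η / 3 * (N * R) := by
      have h1 : L * R - r * R ≤ L * R := by linarith [mul_pos hr0 hR0]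
      calc _ ≤ 4 * (I * η / (12 * L) * N * (L * R)) := by gcongr
        _ = _ := by field_simp; ring
    have t3 : 4 * (I * (2 * (r * R) * (5 * N))) ≤ I * η / 3 * (N * R) := by
      calc _ = 40 * r * (I * (N * R)) := by ring
        _ ≤ 40 * (η / 120) * (I * (N * R)) := by gcongr
        _ = _ := by ring
    have : I * |pert U (m + k) + pert U (m - k) - 2 * pert U m| ≤ I * (η * (N * R)) := by
      calc _ ≤ _ := key
        _ ≤ I * η / 3 * (N * R) + I * η / 3 * (N * R) + I * η / 3 * (N * R) := by linarith
        _ = _ := by ring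
    exact le_of_mul_le_mul_left this hI0
  · intro x hx
    refine (hV _).trans (mul_le_mul_of_nonneg_left ?_ hN0.le)
    refine Real.rpow_le_rpow (by positivity) ?_ hβ0
    have h1 : ‖m + (L * R) • x‖ ≤ (1 + 3 * L) * R := by
      refine (norm_add_le _ _).trans ?_
      rw [norm_smul, Real.norm_of_nonneg (by positivity)]
      nlinarith [mul_le_mul_of_nonneg_left hx (show 0 ≤ L * R by positivity)]
    rw [← div_le_iff₀ hR0] at h1
    linarith
  · intro X hX' x hx
    refine (hV1 _).trans ?_
    have h1 := norm_add_smul_le (x := x) (hX X hX') (by positivity)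
      (mul_le_mul_of_nonneg_right hr1 hR0.le)
    rw [← div_le_iff₀ hR0] at h1
    nlinarith

end SecondDifference

section Periodicity

variable {E : Type*} [NormedAddCommGroup E] [InnerProductSpace ℝ E] [FiniteDimensional ℝ E]
  [MeasurableSpace E] [BorelSpace E]
variable {F U : E → ℝ} {P : E → E} {T : E → E →L[ℝ] E}

theorem exists_blowup {V : E → E} (hVc : Continuous V) {C σ β : ℝ} (hσ : 0 ≤ σ) (hσβ : σ < β)
    (hβ : β ≤ 1) (hC : 0 ≤ C) (hg : ∀ x, ‖V x‖ ≤ C * (1 + ‖x‖) ^ σ)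
    (hunb : ∀ B : ℝ, ∃ x, B < ‖V x‖) {K : ℝ} (hK : 1 ≤ K) :
    ∃ (X : E) (R N : ℝ), K ≤ R ∧ K ≤ N ∧ K * N ≤ R ∧ ‖X‖ ≤ R ∧ ‖V X‖ = N ∧
      ∀ x, ‖V x‖ ≤ N * (1 + ‖x‖ / R) ^ β := by
  have hβ0 : 0 ≤ β := hσ.trans hσβ.le
  obtain ⟨x₀, hx₀⟩ := hunb (2 * K)
  have hv0 : 0 < ‖V x₀‖ := by linarith
  obtain ⟨m₀, hm₀⟩ := Filter.eventually_atTop.mp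
    ((tendsto_rpow_atTop (sub_pos.mpr (hσβ.trans_le hβ))).eventually_ge_atTop (K * C))
  set m := max m₀ (max K ‖x₀‖) with hm
  have hm1 : m₀ ≤ m := le_max_left _ _
  have hm2 : K ≤ m := (le_max_left _ _).trans (le_max_right _ _)
  have hm3 : ‖x₀‖ ≤ m := (le_max_right _ _).trans (le_max_right _ _)
  clear_value m
  have hmp : ∀ x : E, 0 < m + ‖x‖ := fun x => by linarith [norm_nonneg x]
  set g : E → ℝ := fun x => ‖V x‖ / (m + ‖x‖) ^ β with hgdef
  have hgc : Continuous g := hVc.norm.div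
    ((continuous_const.add continuous_norm).rpow_const fun x => Or.inl (hmp x).ne')
    fun x => (Real.rpow_pos_of_pos (hmp x) _).ne'
  have hg0 : 0 < g x₀ := div_pos hv0 (Real.rpow_pos_of_pos (hmp _) _)
  have hlim : Filter.Tendsto (fun x : E => C * (1 + ‖x‖) ^ (-(β - σ))) (Filter.cocompact E)
      (nhds 0) := by
    have h1 : Filter.Tendsto (fun x : E => 1 + ‖x‖) (Filter.cocompact E) Filter.atTop :=
      Filter.tendsto_atTop_add_const_left _ _ (tendsto_norm_cocompact_atTop (E := E))
    have := ((tendsto_rpow_neg_atTop (sub_pos.mpr hσβ)).comp h1).const_mul C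
    simpa using this
  have hev : ∀ᶠ x in Filter.cocompact E, g x ≤ g x₀ := by
    filter_upwards [hlim.eventually (gt_mem_nhds hg0)] with x hx
    refine le_trans ?_ hx.le
    have hp : 0 < 1 + ‖x‖ := by positivity
    rw [hgdef]
    simp only
    rw [div_le_iff₀ (Real.rpow_pos_of_pos (hmp x) _)]
    have h1 : (1 + ‖x‖) ^ β ≤ (m + ‖x‖) ^ β := Real.rpow_le_rpow hp.le (by linarith) hβ0
    have h2 : (1 + ‖x‖) ^ σ = (1 + ‖x‖) ^ (-(β - σ)) * (1 + ‖x‖) ^ β := by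
      rw [← Real.rpow_add hp]; congr 1; ring
    calc ‖V x‖ ≤ C * (1 + ‖x‖) ^ σ := hg x
      _ = C * (1 + ‖x‖) ^ (-(β - σ)) * (1 + ‖x‖) ^ β := by rw [h2]; ring
      _ ≤ _ := mul_le_mul_of_nonneg_left h1 (by positivity)
  obtain ⟨X, hX⟩ := hgc.exists_forall_ge' x₀ hev
  have hRp := hmp X
  set R := m + ‖X‖ with hR
  have hmR : m ≤ R := by linarith [norm_nonneg X]
  have hbound : ∀ x, ‖V x‖ ≤ ‖V X‖ * ((m + ‖x‖) / R) ^ β := by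
    intro x
    have h1 := hX x
    simp only [hgdef] at h1
    rw [div_le_iff₀ (Real.rpow_pos_of_pos (hmp x) _)] at h1
    rw [Real.div_rpow (hmp x).le hRp.le]
    calc _ ≤ _ := h1
      _ = _ := by ring
  have hN0 : 0 ≤ ‖V X‖ := norm_nonneg _
  refine ⟨X, R, ‖V X‖, by linarith, ?_, ?_, by linarith, rfl, fun x => (hbound x).trans ?_⟩
  · have h1 := hbound x₀
    have h2 : ((m + ‖x₀‖) / R) ^ β ≤ 2 := by
      have h3 : (m + ‖x₀‖) / R ≤ 2 := by rw [div_le_iff₀ hRp]; linarith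
      calc _ ≤ (2:ℝ) ^ β := Real.rpow_le_rpow (div_nonneg (hmp _).le hRp.le) h3 hβ0
        _ ≤ 2 ^ (1:ℝ) := Real.rpow_le_rpow_of_exponent_le (by norm_num) hβ
        _ = 2 := Real.rpow_one 2
    nlinarith [mul_le_mul_of_nonneg_left h2 hN0]
  · have h1 : (1 + ‖X‖) ^ σ ≤ R ^ σ := Real.rpow_le_rpow (by positivity) (by linarith) hσ
    have h2 := hm₀ R (by linarith)
    have h3 : R = R ^ (1 - σ) * R ^ σ := by
      rw [← Real.rpow_add hRp]; simp
    calc K * ‖V X‖ ≤ K * (C * R ^ σ) := by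
          refine mul_le_mul_of_nonneg_left ((hg X).trans ?_) (by linarith)
          exact mul_le_mul_of_nonneg_left h1 hC
      _ = K * C * R ^ σ := by ring
      _ ≤ R ^ (1 - σ) * R ^ σ := mul_le_mul_of_nonneg_right h2 (by positivity)
      _ = R := h3.symm
  · refine mul_le_mul_of_nonneg_left (Real.rpow_le_rpow (div_nonneg (hmp _).le hRp.le) ?_ hβ0) hN0
    rw [div_le_iff₀ hRp, add_mul, div_mul_cancel₀ _ hRp.ne']
    linarith

theorem Ell.exists_norm_pertGrad_le [Nontrivial E] (h : Ell F U P T) {Λ d : ℝ} {ν : Measure E}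
    (hav : Averaged F Λ ν d) {ι : Type*} {b : ι → E} (hper : ∀ i x, F (x + b i) = F x) {D Cb : ℝ}
    (hbD : ∀ i, ‖b i‖ ≤ D) (hD : 0 ≤ D) (hCb : 0 < Cb)
    (hb : ∀ v η, (∀ i, |inner ℝ v (b i)| ≤ η) → ‖v‖ ≤ Cb * η)
    (hs : Function.Surjective P) {C σ : ℝ} (hσ : 0 ≤ σ) (hσ1 : σ < 1) (hC : 0 ≤ C)
    (hg : ∀ x, ‖pertGrad P x‖ ≤ C * (1 + ‖x‖) ^ σ) : ∃ B : ℝ, ∀ x, ‖pertGrad P x‖ ≤ B := by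
  by_contra hunb
  push Not at hunb
  obtain ⟨κ, hκ0, hκ1, K₁, hK₁, hosc⟩ := h.osc_pertGrad hav hper hbD hD hCb hb
    (L := 1) (δ := 1 / 8) zero_le_one (by norm_num)
  obtain ⟨β, hσβ, hβ1⟩ := exists_between hσ1
  obtain ⟨K₂, hK₂, hsec⟩ := h.abs_second_difference_le hav hper hbD hD hCb hb hs
    (hσ.trans hσβ.le) hβ1 (η := κ / 16) (by positivity)
  have hv0 := norm_nonneg (pertGrad P 0)
  obtain ⟨X, R, N, hR, hN, hNR, hXR, hXN, hV⟩ := exists_blowup h.continuous_pertGrad hσ hσβ hβ1.le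
    hC hg hunb (K := K₁ + K₂ + 8 * ‖pertGrad P 0‖) (by linarith)
  have hN0 : 0 < N := by linarith
  have hR0 : 0 < R := by linarith
  have hNR1 : K₁ * N ≤ R := (mul_le_mul_of_nonneg_right (by linarith) hN0.le).trans hNR
  have hNR2 : K₂ * N ≤ R := (mul_le_mul_of_nonneg_right (by linarith) hN0.le).trans hNR
  have hV1 : ∀ x, ‖pertGrad P x‖ ≤ N * (1 + ‖x‖ / R) := fun x =>
    (hV x).trans (mul_le_mul_of_nonneg_left (by
      have h1 : 0 ≤ ‖x‖ / R := by positivity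
      simpa using Real.rpow_le_rpow_of_exponent_le (show 1 ≤ 1 + ‖x‖ / R by linarith) hβ1.le)
      hN0.le)
  have hosc' := hosc R N (by linarith) (by linarith) hNR1 hV1
  have hsec' := hsec R N (by linarith) (by linarith) hNR2 hV
  set q := (κ * R / N) • pertGrad P X with hq
  have hqn : ‖q‖ = κ * R := by
    rw [hq, norm_smul, Real.norm_of_nonneg (by positivity), hXN]; field_simp
  have hqR : ‖q‖ ≤ R := by rw [hqn]; nlinarith
  have hqV : inner ℝ (pertGrad P X) q = κ * R * N := by
    rw [hq, inner_smul_right, real_inner_self_eq_norm_sq, hXN]; field_simp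
  clear_value q
  have half : ∀ y : E, ‖y‖ ≤ 2 * R → ‖(1 / 2 : ℝ) • y‖ ≤ R := fun y hy => by
    rw [norm_smul, Real.norm_of_nonneg (by norm_num)]; linarith
  have n1 : ‖X + q‖ ≤ 2 * R := by linarith [norm_add_le X q]
  have n2 : ‖X - q‖ ≤ 2 * R := by linarith [norm_sub_le X q]
  have d1 := hsec' ((1 / 2 : ℝ) • (X + q)) ((1 / 2 : ℝ) • (X + q)) (half _ n1) (half _ n1)
  have d2 := hsec' ((1 / 2 : ℝ) • (X + q)) ((1 / 2 : ℝ) • (X - q)) (half _ n1) (half _ n2)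
  rw [show (1 / 2 : ℝ) • (X + q) + (1 / 2 : ℝ) • (X + q) = X + q by module, sub_self] at d1
  rw [show (1 / 2 : ℝ) • (X + q) + (1 / 2 : ℝ) • (X - q) = X by module,
    show (1 / 2 : ℝ) • (X + q) - (1 / 2 : ℝ) • (X - q) = q by module] at d2
  obtain ⟨s, hs', hse⟩ := exists_mean_value h.hasGradientAt_pert X q
  obtain ⟨r, hr, hre⟩ := exists_mean_value h.hasGradientAt_pert 0 q
  rw [zero_add, zero_add] at hre
  have small : ∀ c ∈ Ioo (0:ℝ) 1, ‖c • q‖ ≤ κ * R := fun c hc => by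
    rw [norm_smul, Real.norm_of_nonneg hc.1.le, hqn]
    exact mul_le_of_le_one_left (by positivity) hc.2.le
  have o1 := hosc' X (by linarith) (X + s • q) (by rw [add_sub_cancel_left]; exact small s hs')
  have o2 := hosc' 0 (by simpa using hR0.le) (r • q) (by rw [sub_zero]; exact small r hr)
  have i1 := abs_real_inner_le_norm (pertGrad P (X + s • q) - pertGrad P X) q
  have i2 := abs_real_inner_le_norm (pertGrad P (r • q) - pertGrad P 0) q
  have i3 := real_inner_le_norm (pertGrad P 0) q
  rw [inner_sub_left, hqn] at i1 i2
  rw [hqn] at i3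
  have hκR : 0 < κ * R := by positivity
  have j1 := mul_le_mul_of_nonneg_right o1 hκR.le
  have j2 := mul_le_mul_of_nonneg_right o2 hκR.le
  have j3 : ‖pertGrad P 0‖ * (κ * R) ≤ 1 / 8 * N * (κ * R) :=
    mul_le_mul_of_nonneg_right (by linarith) hκR.le
  have k1 := (abs_le.mp i1).1
  have k2 := (abs_le.mp i2).2
  have hpos : 0 < κ * R * N := by positivity
  have e1 : 1 / 8 * N * (κ * R) = κ * R * N / 8 := by ring
  have e2 : κ / 16 * (N * R) = κ * R * N / 16 := by ring
  rw [e1] at j1 j2 j3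
  rw [e2] at d1 d2
  linarith [(abs_le.mp d1).1, (abs_le.mp d1).2, (abs_le.mp d2).1, (abs_le.mp d2).2]

theorem exists_rpow_le {σ g : ℝ} (hσ : σ < 1) (hg : 0 < g) :
    ∃ r₀ : ℝ, 1 ≤ r₀ ∧ ∀ r ≥ r₀, r ^ σ ≤ g * r := by
  have h1 := (tendsto_rpow_neg_atTop (sub_pos.mpr hσ)).eventually (gt_mem_nhds hg)
  obtain ⟨r₀, hr₀⟩ := Filter.eventually_atTop.mp (h1.and (Filter.eventually_ge_atTop 1))
  refine ⟨r₀, (hr₀ r₀ le_rfl).2, fun r hr => ?_⟩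
  have hr0 : 0 < r := by linarith [(hr₀ r hr).2]
  have h3 : r ^ σ = r ^ (-(1 - σ)) * r := by
    rw [← Real.rpow_add_one hr0.ne']; congr 1; ring
  rw [h3]
  exact mul_le_mul_of_nonneg_right (hr₀ r hr).1.le hr0.le

theorem exists_rpow_sq_le {σ C γ : ℝ} (hσ : σ < 1) (hC : 0 ≤ C) (hγ : 0 < γ) :
    ∃ r₀ : ℝ, 1 ≤ r₀ ∧ ∀ r ≥ r₀, C * (r ^ σ) ^ 2 ≤ γ * r ^ 2 := by
  obtain ⟨r₀, h1, h2⟩ := exists_rpow_le hσ (Real.sqrt_pos.mpr (show 0 < γ / (C + 1) by positivity))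
  refine ⟨r₀, h1, fun r hr => ?_⟩
  have hr0 : 0 < r := by linarith
  have h3 := pow_le_pow_left₀ (Real.rpow_nonneg hr0.le _) (h2 r hr) 2
  rw [mul_pow, Real.sq_sqrt (by positivity)] at h3
  calc _ ≤ C * (γ / (C + 1) * r ^ 2) := mul_le_mul_of_nonneg_left h3 hC
    _ = C / (C + 1) * (γ * r ^ 2) := by ring
    _ ≤ 1 * (γ * r ^ 2) := by
      refine mul_le_mul_of_nonneg_right ?_ (by positivity)
      rw [div_le_one (by positivity)]; linarith
    _ = _ := one_mul _

theorem exists_abs_pert_le {C σ : ℝ} (hσ0 : 0 ≤ σ) (hσ : σ < 1) (hC : 0 ≤ C)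
    (hg : ∀ x, |pert U x| ≤ C * ((1 + ‖x‖) ^ σ) ^ 2) :
    ∃ K : ℝ, ∀ x, |pert U x| ≤ ‖x‖ ^ 2 / 8 + K := by
  obtain ⟨r₀, h1, h2⟩ := exists_rpow_sq_le (γ := 1 / 16) hσ hC (by norm_num)
  refine ⟨1 / 8 + C * (r₀ ^ σ) ^ 2, fun x => (hg x).trans ?_⟩
  have hp : 0 ≤ C * (r₀ ^ σ) ^ 2 := by positivity
  rcases le_total r₀ (1 + ‖x‖) with hx | hx
  · have := h2 _ hx
    nlinarith [sq_nonneg (‖x‖ - 1)]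
  · have : C * ((1 + ‖x‖) ^ σ) ^ 2 ≤ C * (r₀ ^ σ) ^ 2 := by gcongr
    nlinarith [sq_nonneg ‖x‖]

theorem asymp_of_pert {C σ : ℝ} (hσ0 : 0 ≤ σ) (hσ : σ < 1) (hC : 0 ≤ C)
    (hg : ∀ x, |pert U x| ≤ C * ((1 + ‖x‖) ^ σ) ^ 2) : Asymp fun x t => U x - t := by
  intro γ hγ
  obtain ⟨r₀, h1, h2⟩ := exists_rpow_sq_le (γ := γ / 4) hσ hC (by positivity)
  refine ⟨r₀, fun ρ hρ x t hx _ _ => ?_⟩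
  rw [show U x - t - (‖x‖ ^ 2 / 2 - t) = pert U x by rw [pert]; ring]
  have h3 : C * ((1 + ‖x‖) ^ σ) ^ 2 ≤ C * ((1 + ρ) ^ σ) ^ 2 := by gcongr
  have h4 := h2 (1 + ρ) (by linarith)
  have h5 : (1 + ρ) ^ 2 ≤ 4 * ρ ^ 2 := by nlinarith
  have h6 : γ / 4 * (1 + ρ) ^ 2 ≤ γ / 4 * (4 * ρ ^ 2) := by gcongr
  linarith [hg x]

theorem Ell.add_period [Nontrivial E] (h : Ell F U P T) {Λ d : ℝ} {ν : Measure E}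
    (hav : Averaged F Λ ν d) {ι : Type*} {b : ι → E} (hper : ∀ i x, F (x + b i) = F x) {D Cb : ℝ}
    (hbD : ∀ i, ‖b i‖ ≤ D) (hD : 0 ≤ D) (hCb : 0 < Cb)
    (hb : ∀ v η, (∀ i, |inner ℝ v (b i)| ≤ η) → ‖v‖ ≤ Cb * η) {C σ : ℝ} (hσ : 0 ≤ σ)
    (hσ1 : σ < 1) (hC : 0 ≤ C) (hg : ∀ x, |pert U x| ≤ C * ((1 + ‖x‖) ^ σ) ^ 2) (i : ι) (x : E) :
    P (x + b i) = P x + b i := by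
  obtain ⟨K, hK⟩ := exists_abs_pert_le hσ hσ1 hC hg
  obtain ⟨B, hB⟩ := h.exists_norm_pertGrad_le hav hper hbD hD hCb hb (h.surjective hK) hσ hσ1
    (by positivity) (h.norm_pertGrad_le hσ hσ1.le hC hg)
  have hsh := h.shift (hper i)
  have hbd : ∀ x, ∀ t < (0:ℝ), |(U (x + b i) - inner ℝ (b i) x - t) - (U x - t)| ≤
      B * ‖b i‖ + ‖b i‖ ^ 2 / 2 := by
    intro x t _
    rw [show U (x + b i) - inner ℝ (b i) x - t - (U x - t) = incr U (b i) x by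
      rw [incr]; ring, incr_eq]
    refine (abs_add_le _ _).trans (add_le_add (h.abs_pert_sub_le fun s _ => hB _) ?_)
    rw [abs_of_nonneg (by positivity)]
  have ha := asymp_of_pert hσ hσ1 hC hg
  have hconst : ∀ y, incr U (b i) y = incr U (b i) 0 := by
    intro y
    have := liouville_difference h.sol hsh.sol hav.le hav.ballMass ha (ha.of_bounded_sub hbd) hbd
      (x := y) (x' := 0) (t := -1) (t' := -1) (by norm_num) (by norm_num)
    simp only [incr]
    linarith
  have h1 := hsh.grad x
  have h2 := h.grad x
  rw [hasGradientAt_iff_hasFDerivAt] at h1 h2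
  have h3 := h1.sub h2
  have h4 : HasFDerivAt ((fun x => U (x + b i) - inner ℝ (b i) x) - U) (0 : E →L[ℝ] ℝ) x := by
    have : ((fun x => U (x + b i) - inner ℝ (b i) x) - U) = fun _ => incr U (b i) 0 := by
      funext y; rw [← hconst y]; rfl
    rw [this]; exact hasFDerivAt_const _ _
  have h5 := h3.unique h4
  rw [← map_sub] at h5
  have h6 := (InnerProductSpace.toDual ℝ E).map_eq_zero_iff.mp h5
  rw [sub_eq_zero] at h6
  rw [← h6]; abel

end Periodicity

section UnitCell
open scoped Pointwise

variable {n : ℕ}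

/-- The half-open unit cell of the lattice `ℤⁿ`. -/
def unitCell (n : ℕ) : Set (En n) :=
  ZSpan.fundamentalDomain (EuclideanSpace.basisFun (Fin n) ℝ).toBasis

theorem eq_of_period {Y : Type*} {q : En n → Y}
    (hq : ∀ x (i : Fin n), q (x + EuclideanSpace.single i 1) = q x) {l : En n}
    (hl : l ∈ Submodule.span ℤ (range (EuclideanSpace.basisFun (Fin n) ℝ).toBasis)) (x : En n) :
    q (l + x) = q x := by
  induction hl using Submodule.span_induction generalizing x with
  | mem l hl =>
    obtain ⟨i, rfl⟩ := hl
    rw [add_comm]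
    simpa using hq x i
  | zero => simp
  | add a b _ _ ha hb => rw [add_assoc, ha, hb]
  | smul k a _ ha =>
    induction k using Int.induction_on generalizing x with
    | zero => simp
    | succ k ih => rw [add_smul, one_smul, add_assoc, ih, ha]
    | pred k ih =>
      rw [sub_smul, one_smul, ← ha, show a + (-(k:ℤ) • a - a + x) = -(k:ℤ) • a + x by abel, ih]

theorem exists_unitCell_eq {Y : Type*} {q : En n → Y}
    (hq : ∀ x (i : Fin n), q (x + EuclideanSpace.single i 1) = q x) (x : En n) :
    ∃ y ∈ unitCell n, q y = q x := by
  set b := (EuclideanSpace.basisFun (Fin n) ℝ).toBasis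
  refine ⟨ZSpan.fract b x, ZSpan.fract_mem_fundamentalDomain b x, ?_⟩
  rw [← eq_of_period hq (ZSpan.floor b x).2 (ZSpan.fract b x), ZSpan.fract_apply]
  congr 1
  abel

theorem isBounded_unitCell : Bornology.IsBounded (unitCell n) :=
  ZSpan.fundamentalDomain_isBounded _

theorem exists_norm_le_of_period {Y : Type*} [NormedAddCommGroup Y] {q : En n → Y}
    (hc : Continuous q) (hq : ∀ x (i : Fin n), q (x + EuclideanSpace.single i 1) = q x) :
    ∃ C : ℝ, ∀ x, ‖q x‖ ≤ C := by
  obtain ⟨C, hC⟩ := (isBounded_unitCell (n := n)).isCompact_closure.exists_bound_of_continuousOn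
    hc.continuousOn
  refine ⟨C, fun x => ?_⟩
  obtain ⟨y, hy, he⟩ := exists_unitCell_eq hq x
  rw [← he]
  exact hC y (subset_closure hy)

theorem unitCell_ae_eq : (unitCell n : Set (En n)) =ᵐ[volume] {x | ∀ i, x i ∈ Icc (0:ℝ) 1} := by
  have h := ZSpan.fundamentalDomain_ae_parallelepiped
    (EuclideanSpace.basisFun (Fin n) ℝ).toBasis (volume : Measure (En n))
  rw [parallelepiped_basis_eq] at h
  refine h.trans (Filter.EventuallyEq.of_eq ?_)
  ext x
  simp [OrthonormalBasis.coe_toBasis_repr_apply, EuclideanSpace.basisFun_repr]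

theorem volume_unitCell : volume (unitCell n) = 1 := by
  have h := ZSpan.fundamentalDomain_ae_parallelepiped
    (EuclideanSpace.basisFun (Fin n) ℝ).toBasis (volume : Measure (En n))
  rw [unitCell, measure_congr h, OrthonormalBasis.coe_toBasis,
    OrthonormalBasis.volume_parallelepiped]

theorem integral_unitCell_add {f : En n → ℝ}
    (hf : ∀ x (i : Fin n), f (x + EuclideanSpace.single i 1) = f x) (v : En n) :
    ∫ x in unitCell n, f (v + x) = ∫ x in unitCell n, f x := by
  set b := (EuclideanSpace.basisFun (Fin n) ℝ).toBasis with hb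
  have hD := ZSpan.isAddFundamentalDomain' b (volume : Measure (En n))
  have hD' := hD.vadd_of_comm v
  have hcount : Countable (Submodule.span ℤ (range b)).toAddSubgroup :=
    inferInstanceAs (Countable (Submodule.span ℤ (range b)))
  have h1 := hD'.setIntegral_eq hD (f := f) (fun g x => eq_of_period hf g.2 x)
  rw [unitCell, ← h1]
  have h2 := (measurePreserving_add_left (volume : Measure (En n)) v).setIntegral_preimage_emb
    (measurableEmbedding_addLeft v) f (v +ᵥ ZSpan.fundamentalDomain b)
  rw [← h2]
  congr 2
  ext x
  simp only [mem_preimage, Set.mem_vadd_set, vadd_eq_add, add_right_inj, exists_eq_right]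
  exact Iff.rfl

theorem averaged_of_period {f : En n → ℝ} {Λ : ℝ} (hc : Continuous f) (hpos : ∀ x, 0 < f x)
    (hle : ∀ x, f x ≤ Λ) (hf : ∀ x (i : Fin n), f (x + EuclideanSpace.single i 1) = f x)
    (havg : ∫ x in {x : En n | ∀ i, x i ∈ Icc (0:ℝ) 1}, f x = 1) (B : En n ≃L[ℝ] En n) :
    ∃ (ν : Measure (En n)) (d : ℝ), Averaged (fun y => f (B.symm y)) Λ ν d := by
  obtain ⟨d, hd⟩ := (B.toContinuousLinearMap.lipschitz.isBounded_image
    (isBounded_unitCell (n := n))).exists_norm_le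
  have hBm : Measurable B := B.continuous.measurable
  have hDm : MeasurableSet (unitCell n) := ZSpan.fundamentalDomain_measurableSet _
  refine ⟨(volume.restrict (unitCell n)).map B, d, hc.comp B.symm.continuous,
    fun y => hpos _, fun y => hle _, ?_, ?_, ?_⟩
  · have : IsProbabilityMeasure (volume.restrict (unitCell n)) :=
      ⟨by rw [Measure.restrict_apply_univ, volume_unitCell]⟩
    exact Measure.isProbabilityMeasure_map hBm.aemeasurable
  · rw [ae_map_iff hBm.aemeasurable (measurableSet_le measurable_norm measurable_const),
      ae_restrict_iff' hDm]
    exact Filter.Eventually.of_forall fun k hk => hd _ (mem_image_of_mem _ hk)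
  · intro y
    have hc' : Continuous fun k => f (B.symm (y + k)) := hc.comp (B.symm.continuous.comp (by fun_prop))
    rw [integral_map hBm.aemeasurable hc'.aestronglyMeasurable]
    simp only [map_add, ContinuousLinearEquiv.symm_apply_apply]
    rw [integral_unitCell_add hf, setIntegral_congr_set unitCell_ae_eq, havg]

end UnitCell

section TimeChange

/-- The change of the time variable that normalizes a periodic factor `f` of the right-hand side
to one. -/
theorem exists_timeChange {f : ℝ → ℝ} {c : ℝ} (hc : ContinuousOn f (Iic 0)) (hc0 : 0 < c)
    (hf : ∀ t ≤ 0, c ≤ f t) (hper : ∀ t ≤ 0, f (t - 1) = f t)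
    (havg : ∫ t in Icc (-1:ℝ) 0, f t = 1) :
    ∃ θ : ℝ → ℝ, Continuous θ ∧ θ 0 = 0 ∧ (∀ s < 0, θ s < 0) ∧
      (∀ s < 0, HasDerivAt θ (f (θ s))⁻¹ s) ∧ (∀ t < 0, ∃ s < 0, θ s = t) ∧
      ∃ C : ℝ, ∀ s ≤ 0, |θ s - s| ≤ C := by
  set F : ℝ → ℝ := fun t => f (min t 0) with hF
  have hFc : Continuous F :=
    hc.comp_continuous (by fun_prop) (fun t => min_le_right t 0)
  have hFle : ∀ t ≤ 0, F t = f t := fun t ht => by simp [hF, min_eq_left ht]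
  have hFpos : ∀ t, c ≤ F t := fun t => hf _ (min_le_right t 0)
  set g : ℝ → ℝ := fun t => ∫ s in (0:ℝ)..t, F s with hg
  have hgd : ∀ t, HasDerivAt g (F t) t := fun t => (hFc.integral_hasStrictDerivAt 0 t).hasDerivAt
  have hg0 : g 0 = 0 := by simp [hg]
  have hgc : Continuous g := continuous_iff_continuousAt.mpr fun t => (hgd t).continuousAt
  have hmono : StrictMono g := strictMono_of_hasDerivAt_pos hgd (fun t => hc0.trans_le (hFpos t))
  have hmono' : Monotone fun t => g t - c * t := by
    refine monotone_of_hasDerivAt_nonneg (f' := fun t => F t - c * 1)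
      (fun t => (hgd t).sub ((hasDerivAt_id t).const_mul c)) (fun t => ?_)
    simpa using hFpos t
  have htop : Filter.Tendsto g Filter.atTop Filter.atTop := by
    refine Filter.tendsto_atTop_mono' _ ?_ (Filter.tendsto_id.const_mul_atTop hc0)
    filter_upwards [Filter.eventually_ge_atTop 0] with t ht
    have := hmono' ht
    simp only [hg0, mul_zero, sub_zero, id] at this ⊢
    linarith
  have hbot : Filter.Tendsto g Filter.atBot Filter.atBot := by
    refine Filter.tendsto_atBot_mono' _ ?_ (Filter.tendsto_id.const_mul_atBot hc0)
    filter_upwards [Filter.eventually_le_atBot 0] with t ht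
    have := hmono' ht
    simp only [hg0, mul_zero, sub_zero, id] at this ⊢
    linarith
  set e := hmono.orderIsoOfSurjective g (hgc.surjective htop hbot) with he
  have hge : ∀ s, g (e.symm s) = s := fun s => e.apply_symm_apply s
  have heg : ∀ t, e.symm (g t) = t := fun t => e.symm_apply_apply t
  have he0 : e.symm 0 = 0 := by simpa [hg0] using heg 0
  have hneg : ∀ s < 0, e.symm s < 0 := fun s hs => by
    have := e.symm.strictMono hs
    rwa [he0] at this
  refine ⟨e.symm, e.symm.continuous, he0, hneg, fun s hs => ?_, fun t ht => ?_, ?_⟩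
  · rw [← hFle _ (hneg s hs).le]
    exact HasDerivAt.of_local_left_inverse e.symm.continuous.continuousAt (hgd _)
      (hc0.trans_le (hFpos _)).ne' (Filter.Eventually.of_forall hge)
  · exact ⟨g t, by simpa [hg0] using hmono ht, heg t⟩
  · have hstep : ∀ t ≤ 0, g (t - 1) = g t - 1 := by
      have h1 : g 0 - g (0 - 1) = 1 := by
        refine Eq.trans ?_ havg
        rw [integral_Icc_eq_integral_Ioc, ← intervalIntegral.integral_of_le (by norm_num),
          hg]
        simp only [zero_sub, intervalIntegral.integral_same]
        rw [intervalIntegral.integral_symm, neg_neg]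
        refine intervalIntegral.integral_congr fun s hs => hFle s ?_
        rw [uIcc_of_le (by norm_num)] at hs
        exact hs.2
      intro t ht
      have h2 := (convex_Iic (0:ℝ)).norm_image_sub_le_of_norm_hasDerivWithin_le
        (f := fun t => g t - g (t - 1)) (f' := fun t => F t - F (t - 1)) (C := 0)
        (fun s _ => ((hgd s).sub (HasDerivAt.comp_sub_const s 1 (hgd (s - 1)))).hasDerivWithinAt)
        (fun s hs => by
          rw [hFle s hs, hFle (s - 1) (by linarith [mem_Iic.mp hs]), hper s hs]; simp)
        (mem_Iic.mpr le_rfl) (mem_Iic.mpr ht)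
      rw [zero_mul, norm_le_zero_iff] at h2
      linarith
    obtain ⟨C, hC⟩ := (isCompact_Icc (a := (-1:ℝ)) (b := 0)).exists_bound_of_continuousOn
      (f := fun t => t - g t) (by fun_prop)
    have hiter : ∀ k : ℕ, ∀ t ≤ 0, g (t - k) = g t - k := by
      intro k
      induction k with
      | zero => simp
      | succ k ih =>
        intro t ht
        have hk : (0:ℝ) ≤ k := k.cast_nonneg
        push_cast
        rw [← sub_sub, hstep _ (by linarith), ih t ht]
        ring
    refine ⟨C, fun s hs => ?_⟩
    set t := e.symm s with ht
    have hst : s = g t := (hge s).symm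
    have ht0 : t ≤ 0 := by
      have := e.symm.monotone hs
      rwa [he0] at this
    have hk1 := Nat.floor_le (neg_nonneg.mpr ht0)
    have hk2 := Nat.lt_floor_add_one (-t)
    set k := ⌊-t⌋₊
    have h1 := hiter k (t + k) (by linarith)
    rw [add_sub_cancel_right] at h1
    have h2 := hC (t + k) ⟨by linarith, by linarith⟩
    rw [Real.norm_eq_abs] at h2
    rw [hst, h1]
    convert h2 using 2
    ring

end TimeChange

section Regularity

variable {n : ℕ}

/-- The spatial Hessian as an operator. -/
def hessOp (u : En n → ℝ → ℝ) (x : En n) (t : ℝ) : En n →L[ℝ] En n :=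
  fderiv ℝ (fun y => spaceGrad u y t) x

theorem continuousOn_of_inner {X : Type*} [TopologicalSpace X] {g : X → En n} {s : Set X}
    (h : ∀ w, ContinuousOn (fun z => inner ℝ (g z) w) s) : ContinuousOn g s := by
  have h1 : ContinuousOn (fun z => (g z).ofLp) s := by
    refine continuousOn_pi.mpr fun i => ?_
    refine (h (EuclideanSpace.single i 1)).congr fun z _ => ?_
    simp [EuclideanSpace.inner_single_right]
  exact (PiLp.continuous_toLp 2 _).comp_continuousOn h1

theorem differentiableAt_of_inner {X : Type*} [NormedAddCommGroup X] [NormedSpace ℝ X]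
    {g : X → En n} {x : X} (h : ∀ w, DifferentiableAt ℝ (fun z => inner ℝ (g z) w) x) :
    DifferentiableAt ℝ g x := by
  refine differentiableAt_euclidean.mpr fun i => ?_
  refine (h (EuclideanSpace.single i 1)).congr_of_eventuallyEq (Filter.Eventually.of_forall ?_)
  intro z
  simp [EuclideanSpace.inner_single_right]

theorem inner_spaceGrad (u : En n → ℝ → ℝ) (x : En n) (t : ℝ) (v : En n) :
    inner ℝ (spaceGrad u x t) v = fderiv ℝ (fun y => u y t) x v := by
  rw [spaceGrad, gradient, InnerProductSpace.toDual_symm_apply]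

variable {u : En n → ℝ → ℝ}

theorem IsC2kOn.contDiffAt_space (h : IsC2kOn 1 u (halfSpace n)) (x : En n) {t : ℝ} (ht : t ≤ 0) :
    ContDiffAt ℝ 2 (fun y => u y t) x := by
  have := ((h 2 0 (by norm_num)).1 (x, t) ⟨mem_univ _, ht⟩).1
  simp only [iteratedDeriv_zero] at this
  exact_mod_cast this

theorem IsC2kOn.hasDerivAt_time (h : IsC2kOn 1 u (halfSpace n)) (x : En n) {t : ℝ} (ht : t ≤ 0) :
    HasDerivAt (u x) (timeDeriv u x t) t := by
  have := ((h 0 1 (by norm_num)).1 (x, t) ⟨mem_univ _, ht⟩).2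
  exact (this.differentiableAt (by norm_num)).hasDerivAt

theorem IsC2kOn.continuousOn (h : IsC2kOn 1 u (halfSpace n)) :
    ContinuousOn (fun z : En n × ℝ => u z.1 z.2) (halfSpace n) := by
  have h1 := (h 0 0 (by norm_num)).2
  refine ((ContinuousMultilinearMap.apply ℝ (fun _ : Fin 0 => En n) ℝ
    ![]).continuous.comp_continuousOn h1).congr fun z _ => ?_
  simp

theorem IsC2kOn.continuousOn_timeDeriv (h : IsC2kOn 1 u (halfSpace n)) :
    ContinuousOn (fun z : En n × ℝ => timeDeriv u z.1 z.2) (halfSpace n) := by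
  have h1 := (h 0 1 (by norm_num)).2
  refine ((ContinuousMultilinearMap.apply ℝ (fun _ : Fin 0 => En n) ℝ
    ![]).continuous.comp_continuousOn h1).congr fun z _ => ?_
  simp [timeDeriv, iteratedDeriv_one]

theorem IsC2kOn.continuousOn_spaceGrad (h : IsC2kOn 1 u (halfSpace n)) :
    ContinuousOn (fun z : En n × ℝ => spaceGrad u z.1 z.2) (halfSpace n) := by
  refine continuousOn_of_inner fun w => ?_
  have h1 := (h 1 0 (by norm_num)).2
  refine ((ContinuousMultilinearMap.apply ℝ (fun _ : Fin 1 => En n) ℝ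
    ![w]).continuous.comp_continuousOn h1).congr fun z _ => ?_
  simp [inner_spaceGrad, iteratedFDeriv_one_apply]

theorem IsC2kOn.hasGradientAt (h : IsC2kOn 1 u (halfSpace n)) (x : En n) {t : ℝ} (ht : t ≤ 0) :
    HasGradientAt (fun y => u y t) (spaceGrad u x t) x :=
  ((h.contDiffAt_space x ht).differentiableAt (by norm_num)).hasGradientAt

theorem IsC2kOn.differentiableAt_fderiv (h : IsC2kOn 1 u (halfSpace n)) (x : En n) {t : ℝ}
    (ht : t ≤ 0) : DifferentiableAt ℝ (fderiv ℝ (fun y => u y t)) x :=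
  ((h.contDiffAt_space x ht).fderiv_right (m := 1) (by norm_num)).differentiableAt (by norm_num)

theorem IsC2kOn.hasFDerivAt_spaceGrad (h : IsC2kOn 1 u (halfSpace n)) (x : En n) {t : ℝ}
    (ht : t ≤ 0) : HasFDerivAt (fun y => spaceGrad u y t) (hessOp u x t) x := by
  refine (differentiableAt_of_inner fun w => ?_).hasFDerivAt
  simp only [inner_spaceGrad]
  exact (h.differentiableAt_fderiv x ht).clm_apply (differentiableAt_const w)

theorem IsC2kOn.inner_hessOp (h : IsC2kOn 1 u (halfSpace n)) (x : En n) {t : ℝ} (ht : t ≤ 0)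
    (v w : En n) :
    inner ℝ (hessOp u x t v) w = fderiv ℝ (fderiv ℝ (fun y => u y t)) x v w := by
  have h1 := (h.hasFDerivAt_spaceGrad x ht).inner ℝ (hasFDerivAt_const w x)
  simp only [inner_spaceGrad] at h1
  have h2 := (h.differentiableAt_fderiv x ht).hasFDerivAt.clm_apply (hasFDerivAt_const w x)
  have h3 := congrArg (fun L => L v) (h1.unique h2)
  simpa using h3

theorem IsC2kOn.continuousOn_hessOp (h : IsC2kOn 1 u (halfSpace n)) :
    ContinuousOn (fun z : En n × ℝ => hessOp u z.1 z.2) (halfSpace n) := by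
  refine continuousOn_clm_apply.mpr fun v => continuousOn_of_inner fun w => ?_
  have h1 := (h 2 0 (by norm_num)).2
  refine ((ContinuousMultilinearMap.apply ℝ (fun _ : Fin 2 => En n) ℝ
    ![v, w]).continuous.comp_continuousOn h1).congr fun z hz => ?_
  simp [h.inner_hessOp z.1 hz.2, iteratedFDeriv_two_apply]

theorem IsC2kOn.symmOp_hessOp (h : IsC2kOn 1 u (halfSpace n)) (x : En n) {t : ℝ} (ht : t ≤ 0) :
    SymmOp (hessOp u x t) := by
  intro v w
  rw [h.inner_hessOp x ht, real_inner_comm, h.inner_hessOp x ht]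
  exact (h.contDiffAt_space x ht).isSymmSndFDerivAt (by simp) v w

theorem IsC2kOn.det_hessOp (h : IsC2kOn 1 u (halfSpace n)) (x : En n) {t : ℝ} (ht : t ≤ 0) :
    (hessOp u x t).det = (spaceHess u x t).det := by
  rw [ContinuousLinearMap.det, ← LinearMap.det_toMatrix (EuclideanSpace.basisFun (Fin n) ℝ).toBasis,
    ← Matrix.det_transpose]
  congr 1
  ext i j
  rw [Matrix.transpose_apply, LinearMap.toMatrix_apply, spaceHess, iteratedFDeriv_two_apply]
  simp only [Matrix.cons_val_zero, Matrix.cons_val_one]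
  rw [← h.inner_hessOp x ht]
  simp [EuclideanSpace.inner_single_right]

theorem IsC2kOn.inner_hessOp_nonneg (h : IsC2kOn 1 u (halfSpace n))
    (hc : ParabolicallyConvexOn (halfSpace n) u) (x : En n) {t : ℝ} (ht : t ≤ 0) (v : En n) :
    0 ≤ inner ℝ (hessOp u x t v) v := by
  have hconv : ConvexOn ℝ univ (fun y => u y t) := by
    convert hc.1 t using 1
    ext y
    simp [halfSpace, ht]
  have hline : ∀ s : ℝ, HasDerivAt (fun s : ℝ => x + s • v) v s := fun s => by
    simpa using ((hasDerivAt_id s).smul_const v).const_add x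
  have hconv' : ConvexOn ℝ univ (fun s : ℝ => u (x + s • v) t) := by
    have h1 : ConvexOn ℝ univ ((fun y => u y t) ∘ AffineMap.lineMap x (x + v)) :=
      hconv.comp_affineMap (AffineMap.lineMap (k := ℝ) x (x + v))
    have h2 : (fun s : ℝ => u (x + s • v) t) =
        (fun y => u y t) ∘ AffineMap.lineMap x (x + v) := by
      funext s
      simp [AffineMap.lineMap_apply, add_comm]
    rw [h2]
    exact h1
  have hd : ∀ s : ℝ, HasDerivAt (fun s : ℝ => u (x + s • v) t)
      (inner ℝ (spaceGrad u (x + s • v) t) v) s := fun s => by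
    rw [inner_spaceGrad]
    exact ((h.contDiffAt_space (x + s • v) ht).differentiableAt
      (by norm_num)).hasFDerivAt.comp_hasDerivAt s (hline s)
  have hmono : Monotone fun s : ℝ => inner ℝ (spaceGrad u (x + s • v) t) v := by
    have := hconv'.monotoneOn_deriv (fun s _ => (hd s).differentiableAt)
    have h2 : deriv (fun s : ℝ => u (x + s • v) t) =
        fun s : ℝ => inner ℝ (spaceGrad u (x + s • v) t) v := funext fun s => (hd s).deriv
    rwa [h2, monotoneOn_univ] at this
  have hd2 : HasDerivAt (fun s : ℝ => inner ℝ (spaceGrad u (x + s • v) t) v)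
      (inner ℝ (hessOp u x t v) v) 0 := by
    have h1 : HasFDerivAt (fun y => spaceGrad u y t) (hessOp u x t) (x + (0:ℝ) • v) := by
      simpa using h.hasFDerivAt_spaceGrad x ht
    have h2 := (h1.comp_hasDerivAt 0 (hline 0)).inner ℝ (hasDerivAt_const (0:ℝ) v)
    simpa using h2
  rw [← hd2.deriv]
  exact hmono.deriv_nonneg

theorem SymmOp.pos_of_nonneg {E : Type*} [NormedAddCommGroup E] [InnerProductSpace ℝ E]
    [FiniteDimensional ℝ E] {T : E →L[ℝ] E} (hs : SymmOp T) (h0 : ∀ v, 0 ≤ inner ℝ (T v) v)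
    (hd : T.det ≠ 0) {v : E} (hv : v ≠ 0) : 0 < inner ℝ (T v) v := by
  refine (h0 v).lt_of_ne' fun hz => hv ?_
  have hinj : Function.Injective T :=
    (LinearMap.equivOfDetNeZero (T : E →ₗ[ℝ] E) hd).injective
  refine hinj ?_
  rw [map_zero]
  set a := ‖T v‖ ^ 2 with ha
  set c := inner ℝ (T (T v)) (T v) with hc
  have hc0 : 0 ≤ c := h0 _
  have hq : ∀ s : ℝ, 0 ≤ 2 * s * a + s ^ 2 * c := fun s => by
    have h1 := h0 (v + s • T v)
    have h2 : inner ℝ (T (T v)) v = a := by rw [hs, real_inner_self_eq_norm_sq]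
    simp only [map_add, map_smul, inner_add_left, inner_add_right, inner_smul_left,
      inner_smul_right, hz, h2, real_inner_self_eq_norm_sq, ← hc, ← ha, conj_trivial] at h1
    linarith
  have h3 := hq (-a / (c + 1))
  have ha0 : a ^ 2 * (c + 2) ≤ 0 := by
    have h4 : 2 * (-a / (c + 1)) * a + (-a / (c + 1)) ^ 2 * c = -(a ^ 2 * (c + 2)) / (c + 1) ^ 2 := by
      field_simp
      ring
    rw [h4] at h3
    by_contra hcon
    push Not at hcon
    have := div_neg_of_neg_of_pos (neg_lt_zero.mpr hcon) (by positivity : 0 < (c + 1) ^ 2)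
    linarith
  have ha1 : a ^ 2 ≤ 0 := by
    by_contra hcon
    push Not at hcon
    have : 0 < a ^ 2 * (c + 2) := mul_pos hcon (by linarith)
    linarith
  have ha2 : a = 0 := by
    have := sq_nonneg a
    exact pow_eq_zero_iff (two_ne_zero) |>.mp (le_antisymm ha1 this)
  rw [ha] at ha2
  simpa using ha2

end Regularity

section Transform

variable {n : ℕ}

theorem inner_mApply (A : Matrix (Fin n) (Fin n) ℝ) (x y : En n) :
    inner ℝ x (mApply A y) = x.ofLp ⬝ᵥ A.mulVec y.ofLp :=
  Matrix.inner_toEuclideanCLM A x y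

theorem quadForm_eq_inner (A : Matrix (Fin n) (Fin n) ℝ) (x : En n) :
    quadForm A x = inner ℝ x (mApply A x) := by
  rw [inner_mApply, quadForm, dotProduct]
  refine Finset.sum_congr rfl fun i _ => ?_
  rw [Matrix.mulVec, dotProduct, Finset.mul_sum]
  exact Finset.sum_congr rfl fun j _ => by ring

theorem exists_matrix_sqrt {A : Matrix (Fin n) (Fin n) ℝ} (hs : A.IsSymm) (hp : A.PosDef) :
    ∃ B : En n ≃L[ℝ] En n, SymmOp (B : En n →L[ℝ] En n) ∧ (∀ x, B (B x) = mApply A x) ∧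
      (∀ x, quadForm A x = ‖B x‖ ^ 2) ∧
      (B.symm : En n →L[ℝ] En n).det * (B.symm : En n →L[ℝ] En n).det * A.det = 1 := by
  set T : En n →L[ℝ] En n := Matrix.toEuclideanCLM (𝕜 := ℝ) A with hT
  have hTA : ∀ x, T x = mApply A x := fun x => rfl
  have hTs : SymmOp T := fun x y => by
    rw [real_inner_comm, hTA, hTA, inner_mApply, inner_mApply, dotProduct_comm,
      ← Matrix.dotProduct_transpose_mulVec, hs.eq, dotProduct_comm]
  have hTp : ∀ x, x ≠ 0 → 0 < inner ℝ (T x) x := fun x hx => by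
    rw [real_inner_comm, hTA, inner_mApply]
    have := hp.dotProduct_mulVec_pos (x := x.ofLp) (by simpa using hx)
    simpa using this
  obtain ⟨B, hB, hBB⟩ := exists_sqrt T hTs hTp
  refine ⟨B, hB, fun x => hBB x, fun x => ?_, ?_⟩
  · rw [quadForm_eq_inner, ← hTA, ← hBB, ← real_inner_self_eq_norm_sq]
    exact (hB x (B x)).symm
  · have hdT : T.det = A.det := by
      change LinearMap.det (T : En n →ₗ[ℝ] En n) = A.det
      rw [hT, Matrix.coe_toEuclideanCLM_eq_toEuclideanLin, Matrix.toEuclideanLin_eq_toLin_orthonormal,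
        LinearMap.det_toLin]
    have hid : (B.symm : En n →ₗ[ℝ] En n) ∘ₗ (B.symm : En n →ₗ[ℝ] En n) ∘ₗ (T : En n →ₗ[ℝ] En n)
        = LinearMap.id := by
      ext1 x
      simp only [LinearMap.comp_apply, ContinuousLinearMap.coe_coe, LinearMap.id_apply, ← hBB]
      simp
    have h1 := congrArg LinearMap.det hid
    rw [LinearMap.det_comp, LinearMap.det_comp, LinearMap.det_id, ← mul_assoc] at h1
    rw [← hdT]
    exact h1

variable {u : En n → ℝ → ℝ} {f₁ : En n → ℝ} {f₂ : ℝ → ℝ} {θ : ℝ → ℝ} {τ : ℝ}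

/-- Normalization of a solution by a linear change of the space variable and a change of the time
variable. -/
theorem IsC2kOn.sol_transform (h : IsC2kOn 1 u (halfSpace n))
    (hconv : ParabolicallyConvexOn (halfSpace n) u)
    (hw : ∀ x, ∀ t ≤ 0, 0 < -timeDeriv u x t) (hf₁ : ∀ x, 0 < f₁ x) (hf₂ : ∀ t ≤ 0, 0 < f₂ t)
    (hf₂c : ContinuousOn f₂ (Iic 0))
    (heq : ∀ x, ∀ t ≤ 0, -timeDeriv u x t * (spaceHess u x t).det = f₁ x * f₂ t)
    (hτ : 0 < τ) (hθ : Continuous θ) (hθn : ∀ s < 0, θ s < 0)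
    (hθd : ∀ s < 0, HasDerivAt θ (f₂ (θ s))⁻¹ s) {S : En n ≃L[ℝ] En n}
    (hS : SymmOp (S : En n →L[ℝ] En n))
    (hSd : (S : En n →L[ℝ] En n).det * (S : En n →L[ℝ] En n).det = τ) :
    Sol (fun y => f₁ (S y)) (fun y s => u (S y) (θ (s / τ)))
      (fun y s => S (spaceGrad u (S y) (θ (s / τ))))
      (fun y s => (S : En n →L[ℝ] En n) ∘L hessOp u (S y) (θ (s / τ)) ∘L (S : En n →L[ℝ] En n))
      (fun y s => -timeDeriv u (S y) (θ (s / τ)) / (τ * f₂ (θ (s / τ)))) := by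
  have hθn' : ∀ s < 0, θ (s / τ) < 0 := fun s hs => hθn _ (div_neg_of_neg_of_pos hs hτ)
  have hcm : ContinuousOn (fun z : En n × ℝ => (S z.1, θ (z.2 / τ))) (univ ×ˢ Iio 0) := by
    have := S.continuous
    exact Continuous.continuousOn (by fun_prop)
  have hmap : MapsTo (fun z : En n × ℝ => (S z.1, θ (z.2 / τ))) (univ ×ˢ Iio 0) (halfSpace n) :=
    fun z hz => ⟨mem_univ _, (hθn' z.2 hz.2).le⟩
  refine ⟨h.continuousOn.comp hcm hmap, ?_, ?_, ?_, ?_, ?_, ?_, ?_, ?_, ?_, ?_⟩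
  · exact S.continuous.comp_continuousOn (h.continuousOn_spaceGrad.comp hcm hmap)
  · exact continuousOn_const.clm_comp ((h.continuousOn_hessOp.comp hcm hmap).clm_comp
      continuousOn_const)
  · refine (h.continuousOn_timeDeriv.comp hcm hmap).neg.div (continuousOn_const.mul
      (hf₂c.comp hcm.snd fun z hz => (hθn' z.2 hz.2).le)) fun z hz => ?_
    exact (mul_pos hτ (hf₂ _ (hθn' z.2 hz.2).le)).ne'
  · intro s hs y
    have h1 := (hasGradientAt_iff_hasFDerivAt.mp (h.hasGradientAt (S y) (hθn' s hs).le)).comp y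
      S.hasFDerivAt
    rw [hasGradientAt_iff_hasFDerivAt]
    refine h1.congr_fderiv ?_
    ext v
    simpa using (hS (spaceGrad u (S y) (θ (s / τ))) v).symm
  · intro s hs y
    have h1 := (h.hasFDerivAt_spaceGrad (S y) (hθn' s hs).le).comp y S.hasFDerivAt
    exact S.hasFDerivAt.comp y h1
  · intro s hs y
    have h1 : HasDerivAt (fun s => s / τ) (1 / τ) s := (hasDerivAt_id s).div_const τ
    have h2 := (h.hasDerivAt_time (S y) (hθn' s hs).le).comp s
      ((hθd _ (div_neg_of_neg_of_pos hs hτ)).comp s h1)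
    refine h2.congr_deriv ?_
    have := hf₂ _ (hθn' s hs).le
    field_simp
  · intro s hs y v w
    have h1 := h.symmOp_hessOp (S y) (hθn' s hs).le (S v) (S w)
    have h2 := hS (hessOp u (S y) (θ (s / τ)) (S v)) w
    have h3 := hS v (hessOp u (S y) (θ (s / τ)) (S w))
    simp only [ContinuousLinearMap.comp_apply, ContinuousLinearEquiv.coe_coe] at h1 h2 h3 ⊢
    rw [h2, h1, h3]
  · intro s hs y v hv
    have hle := (hθn' s hs).le
    have h2 := hS (hessOp u (S y) (θ (s / τ)) (S v)) v
    simp only [ContinuousLinearMap.comp_apply, ContinuousLinearEquiv.coe_coe] at h2 ⊢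
    rw [h2]
    refine (h.symmOp_hessOp (S y) hle).pos_of_nonneg (h.inner_hessOp_nonneg hconv (S y) hle) ?_
      (by simpa using hv)
    rw [h.det_hessOp _ hle]
    intro h0
    have h3 := heq (S y) _ hle
    rw [h0, mul_zero] at h3
    exact (mul_pos (hf₁ (S y)) (hf₂ _ hle)).ne h3
  · intro s hs y
    exact div_pos (hw _ _ (hθn' s hs).le) (mul_pos hτ (hf₂ _ (hθn' s hs).le))
  · intro s hs y
    have hle := (hθn' s hs).le
    have h1 : ((S : En n →L[ℝ] En n) ∘L hessOp u (S y) (θ (s / τ)) ∘L (S : En n →L[ℝ] En n)).det =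
        τ * (hessOp u (S y) (θ (s / τ))).det := by
      rw [← hSd]
      simp only [ContinuousLinearMap.det, ContinuousLinearMap.toLinearMap_comp, LinearMap.det_comp]
      ring
    have h2 := hf₂ _ hle
    rw [h1, h.det_hessOp _ hle, div_mul_eq_mul_div, div_eq_iff (by positivity)]
    linear_combination τ * heq (S y) _ hle

theorem IsC2kOn.exists_abs_sub_le (h : IsC2kOn 1 u (halfSpace n)) {A : Matrix (Fin n) (Fin n) ℝ}
    {C₀ κ : ℝ} (hκ : 0 ≤ κ) (hC₀ : 0 < C₀)
    (hasym : ∀ (x : En n) (t : ℝ), t ≤ 0 → C₀ ≤ ‖x‖^2 - t →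
      |u x t - ((1/2) * quadForm A x - τ * t)| ≤ C₀ * (‖x‖^2 - t) ^ κ) :
    ∃ C : ℝ, 0 ≤ C ∧ ∀ (x : En n) (t : ℝ), t ≤ 0 →
      |u x t - ((1/2) * quadForm A x - τ * t)| ≤ C * (1 + ‖x‖^2 - t) ^ κ := by
  have hc : ContinuousOn (fun z : En n × ℝ => u z.1 z.2 - ((1/2) * quadForm A z.1 - τ * z.2))
      (halfSpace n) := by
    refine h.continuousOn.sub (Continuous.continuousOn ?_)
    unfold quadForm
    fun_prop
  have hK : IsCompact (Metric.closedBall (0 : En n) (Real.sqrt C₀) ×ˢ Icc (-C₀) 0) :=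
    (isCompact_closedBall _ _).prod isCompact_Icc
  obtain ⟨M, hM⟩ := hK.exists_bound_of_continuousOn
    (hc.mono fun z hz => ⟨mem_univ _, hz.2.2⟩)
  refine ⟨C₀ + |M|, by positivity, fun x t ht => ?_⟩
  have hn := sq_nonneg ‖x‖
  by_cases hx : C₀ ≤ ‖x‖ ^ 2 - t
  · refine (hasym x t ht hx).trans ?_
    have h1 : (‖x‖ ^ 2 - t) ^ κ ≤ (1 + ‖x‖ ^ 2 - t) ^ κ :=
      Real.rpow_le_rpow (by linarith) (by linarith) hκ
    have h2 : 0 ≤ (1 + ‖x‖ ^ 2 - t) ^ κ := Real.rpow_nonneg (by linarith) _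
    exact mul_le_mul (by linarith [abs_nonneg M]) h1 (Real.rpow_nonneg (by linarith) _)
      (by positivity)
  · push Not at hx
    have h1 := hM (x, t) ⟨by
      rw [mem_closedBall_zero_iff]
      exact Real.le_sqrt_of_sq_le (by linarith), by linarith, ht⟩
    rw [Real.norm_eq_abs] at h1
    have h2 : (1:ℝ) ≤ (1 + ‖x‖ ^ 2 - t) ^ κ := Real.one_le_rpow (by linarith) hκ
    calc _ ≤ M := h1
      _ ≤ (C₀ + |M|) * 1 := by linarith [le_abs_self M]
      _ ≤ _ := by gcongr

/-- Growth of the normalized solution. -/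
theorem exists_abs_transform_le {A : Matrix (Fin n) (Fin n) ℝ} {C κ : ℝ} (hκ : 0 ≤ κ) (hC : 0 ≤ C)
    (hg : ∀ (x : En n) (t : ℝ), t ≤ 0 →
      |u x t - ((1/2) * quadForm A x - τ * t)| ≤ C * (1 + ‖x‖^2 - t) ^ κ)
    (hτ : 0 < τ) (hθn : ∀ s < 0, θ s < 0) {M : ℝ} (hM : ∀ s ≤ 0, |θ s - s| ≤ M)
    {B : En n ≃L[ℝ] En n} (hBA : ∀ x, quadForm A x = ‖B x‖ ^ 2) :
    ∃ K : ℝ, 0 ≤ K ∧ ∀ y, ∀ s < 0, |u (B.symm y) (θ (s / τ)) - (‖y‖ ^ 2 / 2 - s)| ≤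
      K * (1 + ‖y‖ ^ 2 - s) ^ κ := by
  have hM0 : 0 ≤ M := (abs_nonneg _).trans (hM 0 le_rfl)
  set b := ‖(B.symm : En n →L[ℝ] En n)‖ with hb
  set L := 1 + b ^ 2 + M + 1 / τ with hL
  have hb0 : 0 ≤ b := norm_nonneg _
  have hL0 : 0 ≤ L := by positivity
  refine ⟨C * L ^ κ + τ * M, by positivity, fun y s hs => ?_⟩
  have hsτ : s / τ < 0 := div_neg_of_neg_of_pos hs hτ
  have h1 := hg (B.symm y) (θ (s / τ)) (hθn _ hsτ).le
  rw [hBA, ContinuousLinearEquiv.apply_symm_apply] at h1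
  have h2 := hM _ hsτ.le
  have h3 : ‖B.symm y‖ ≤ b * ‖y‖ := (B.symm : En n →L[ℝ] En n).le_opNorm y
  have h4 : ‖B.symm y‖ ^ 2 ≤ b ^ 2 * ‖y‖ ^ 2 := by
    rw [← mul_pow]; exact pow_le_pow_left₀ (norm_nonneg _) h3 2
  have hy := sq_nonneg ‖y‖
  have hR1 : 1 ≤ 1 + ‖y‖ ^ 2 - s := by linarith
  have h5 : 1 + ‖B.symm y‖ ^ 2 - θ (s / τ) ≤ L * (1 + ‖y‖ ^ 2 - s) := by
    have h6 := (abs_le.mp h2).1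
    have h7 : s / τ = (1 / τ) * s := by ring
    have h8 : 0 < 1 / τ := by positivity
    have h9 : 0 ≤ M * (‖y‖ ^ 2 - s) := mul_nonneg hM0 (by linarith)
    have h10 : 0 ≤ b ^ 2 * (1 - s) := mul_nonneg (by positivity) (by linarith)
    have h11 : 0 ≤ (1 / τ) * (1 + ‖y‖ ^ 2) := by positivity
    rw [h7] at h6 ⊢
    rw [hL]
    linarith
  have h6 : (1 + ‖B.symm y‖ ^ 2 - θ (s / τ)) ^ κ ≤ L ^ κ * (1 + ‖y‖ ^ 2 - s) ^ κ := by
    rw [← Real.mul_rpow hL0 (by linarith)]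
    refine Real.rpow_le_rpow ?_ h5 hκ
    have := sq_nonneg ‖B.symm y‖
    linarith [hθn _ hsτ]
  have h7 : (1:ℝ) ≤ (1 + ‖y‖ ^ 2 - s) ^ κ := Real.one_le_rpow hR1 hκ
  have h8 : u (B.symm y) (θ (s / τ)) - (‖y‖ ^ 2 / 2 - s) =
      (u (B.symm y) (θ (s / τ)) - (1 / 2 * ‖y‖ ^ 2 - τ * θ (s / τ))) - τ * (θ (s / τ) - s / τ) := by
    field_simp
    ring
  rw [h8]
  refine (abs_sub _ _).trans ?_
  rw [abs_mul, abs_of_pos hτ, add_mul]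
  refine add_le_add (h1.trans ?_) ?_
  · rw [mul_assoc]
    exact mul_le_mul_of_nonneg_left h6 hC
  · calc τ * |θ (s / τ) - s / τ| ≤ τ * M * 1 := by
          rw [mul_one]; exact mul_le_mul_of_nonneg_left h2 hτ.le
      _ ≤ _ := mul_le_mul_of_nonneg_left h7 (by positivity)

theorem asymp_of_rpow_le {E : Type*} [NormedAddCommGroup E] [InnerProductSpace ℝ E]
    [FiniteDimensional ℝ E] [MeasurableSpace E] [BorelSpace E] {v : E → ℝ → ℝ} {K κ : ℝ}
    (hκ0 : 0 ≤ κ) (hκ : κ < 1) (hK : 0 ≤ K)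
    (hg : ∀ y, ∀ s < 0, |v y s - (‖y‖ ^ 2 / 2 - s)| ≤ K * (1 + ‖y‖ ^ 2 - s) ^ κ) : Asymp v := by
  intro γ hγ
  obtain ⟨r₀, hr₀, hr⟩ := exists_rpow_le hκ (show 0 < γ / (3 * K + 1) by positivity)
  refine ⟨r₀, fun ρ hρ x t hx ht ht0 => (hg x t ht0).trans ?_⟩
  have hρ1 : 1 ≤ ρ := hr₀.trans hρ
  have hρ2 : ρ ≤ ρ ^ 2 := by
    rw [sq]; exact le_mul_of_one_le_left (by linarith) hρ1
  have hx2 : ‖x‖ ^ 2 ≤ ρ ^ 2 := pow_le_pow_left₀ (norm_nonneg x) hx 2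
  have h1 : (1 + ‖x‖ ^ 2 - t) ^ κ ≤ (3 * ρ ^ 2) ^ κ :=
    Real.rpow_le_rpow (by linarith [sq_nonneg ‖x‖]) (by linarith) hκ0
  have h2 := hr (3 * ρ ^ 2) (by linarith)
  calc K * (1 + ‖x‖ ^ 2 - t) ^ κ ≤ K * (γ / (3 * K + 1) * (3 * ρ ^ 2)) :=
        mul_le_mul_of_nonneg_left (h1.trans h2) hK
    _ = (3 * K / (3 * K + 1)) * (γ * ρ ^ 2) := by ring
    _ ≤ 1 * (γ * ρ ^ 2) := by
        refine mul_le_mul_of_nonneg_right ?_ (by positivity)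
        rw [div_le_one (by positivity)]
        linarith
    _ = _ := one_mul _

theorem abs_pert_le_of_rpow_le {E : Type*} [NormedAddCommGroup E] [InnerProductSpace ℝ E]
    [FiniteDimensional ℝ E] [MeasurableSpace E] [BorelSpace E] {v : E → ℝ → ℝ} {K κ : ℝ}
    (hκ0 : 0 ≤ κ) (hK : 0 ≤ K)
    (hg : ∀ y, ∀ s < 0, |v y s - (‖y‖ ^ 2 / 2 - s)| ≤ K * (1 + ‖y‖ ^ 2 - s) ^ κ) (y : E) :
    |pert (fun x => v x (-1) - 1) y| ≤ K * 2 ^ κ * ((1 + ‖y‖) ^ κ) ^ 2 := by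
  have h1 := hg y (-1) (by norm_num)
  have h2 : pert (fun x => v x (-1) - 1) y = v y (-1) - (‖y‖ ^ 2 / 2 - -1) := by
    unfold pert; ring
  rw [h2]
  refine h1.trans ?_
  rw [mul_assoc]
  refine mul_le_mul_of_nonneg_left ?_ hK
  have hy := norm_nonneg y
  have h3 : ((1 + ‖y‖) ^ κ) ^ 2 = ((1 + ‖y‖) ^ 2) ^ κ := by
    rw [sq, sq, Real.mul_rpow (by linarith) (by linarith)]
  rw [h3, ← Real.mul_rpow (by norm_num) (by positivity)]
  exact Real.rpow_le_rpow (by linarith [sq_nonneg ‖y‖]) (by nlinarith) hκ0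

end Transform

section Gradient

variable {n : ℕ} {u : En n → ℝ → ℝ} {f₁ : En n → ℝ} {f₂ : ℝ → ℝ} {τ : ℝ}

theorem norm_le_of_abs_inner_le (hn : 0 < n) {B : En n ≃L[ℝ] En n} (hB : SymmOp (B : En n →L[ℝ] En n))
    (v : En n) (η : ℝ) (hη : ∀ i, |inner ℝ v (B (EuclideanSpace.single i 1))| ≤ η) :
    ‖v‖ ≤ (‖(B.symm : En n →L[ℝ] En n)‖ * n + 1) * η := by
  have hη0 : 0 ≤ η := (abs_nonneg _).trans (hη ⟨0, hn⟩)
  have h1 : ∀ i, ‖(B v) i‖ ≤ η := fun i => by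
    have h2 : inner ℝ (B v) (EuclideanSpace.single i 1) =
        inner ℝ v (B (EuclideanSpace.single i 1)) := hB v _
    have h3 : inner ℝ (B v) (EuclideanSpace.single i (1:ℝ)) = (B v) i := by
      simp [EuclideanSpace.inner_single_right]
    rw [← h3, h2]
    exact hη i
  have h2 : ‖B v‖ ≤ n * η := by
    have h3 : B v = ∑ i, (B v) i • EuclideanSpace.single i (1:ℝ) := by
      simpa using ((EuclideanSpace.basisFun (Fin n) ℝ).sum_repr (B v)).symm
    rw [h3]
    refine (norm_sum_le _ _).trans ((Finset.sum_le_sum fun i _ => ?_).trans_eq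
      (Finset.sum_const η |>.trans (by simp)))
    rw [norm_smul, PiLp.norm_single, norm_one, mul_one]
    exact h1 i
  have h3 := (B.symm : En n →L[ℝ] En n).le_opNorm (B v)
  simp only [ContinuousLinearEquiv.coe_coe, ContinuousLinearEquiv.symm_apply_apply] at h3
  calc ‖v‖ ≤ ‖(B.symm : En n →L[ℝ] En n)‖ * ‖B v‖ := h3
    _ ≤ ‖(B.symm : En n →L[ℝ] En n)‖ * (n * η) := by gcongr
    _ ≤ _ := by linarith

/-- The spatial gradient is independent of time and periodic up to a linear map. -/
theorem IsC2kOn.gradient_structure (hn : 1 ≤ n) (h : IsC2kOn 1 u (halfSpace n))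
    (hconv : ParabolicallyConvexOn (halfSpace n) u) {m₂ : ℝ}
    (hw : ∀ x, ∀ t ≤ 0, 0 < -timeDeriv u x t) (hw₂ : ∀ x, ∀ t ≤ 0, -timeDeriv u x t ≤ m₂)
    (hf₁ : ∀ x, 0 < f₁ x) (hf₁c : Continuous f₁) (hf₂c : ContinuousOn f₂ (Iic 0)) {c Λ : ℝ}
    (hc : 0 < c) (hf₂ : ∀ t ≤ 0, c ≤ f₂ t) (hΛ : ∀ x, f₁ x ≤ Λ)
    (heq : ∀ x, ∀ t ≤ 0, -timeDeriv u x t * (spaceHess u x t).det = f₁ x * f₂ t)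
    (hf₁per : ∀ x (i : Fin n), f₁ (x + EuclideanSpace.single i 1) = f₁ x)
    (hf₂per : ∀ t ≤ 0, f₂ (t - 1) = f₂ t)
    (hf₁avg : ∫ x in {x : En n | ∀ i, x i ∈ Icc (0:ℝ) 1}, f₁ x = 1)
    (hf₂avg : ∫ t in Icc (-1:ℝ) 0, f₂ t = 1) (hτ : 0 < τ) {A : Matrix (Fin n) (Fin n) ℝ}
    (hAs : A.IsSymm) (hAp : A.PosDef) (hdet : τ * A.det = 1) {C κ : ℝ} (hκ0 : 0 ≤ κ) (hκ : κ < 1)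
    (hC : 0 ≤ C) (hg : ∀ (x : En n) (t : ℝ), t ≤ 0 →
      |u x t - ((1/2) * quadForm A x - τ * t)| ≤ C * (1 + ‖x‖^2 - t) ^ κ) :
    (∀ x, ∀ t ≤ 0, spaceGrad u x t = spaceGrad u x (-1)) ∧
      ∀ x (i : Fin n), spaceGrad u (x + EuclideanSpace.single i 1) (-1) =
        spaceGrad u x (-1) + mApply A (EuclideanSpace.single i 1) := by
  have : Nonempty (Fin n) := ⟨⟨0, hn⟩⟩
  have : Nontrivial (En n) := by unfold En; infer_instance
  obtain ⟨B, hB, hBB, hBA, hBd⟩ := exists_matrix_sqrt hAs hAp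
  have hdA : A.det ≠ 0 := right_ne_zero_of_mul (hdet.trans_ne one_ne_zero)
  have hSd : (B.symm : En n →L[ℝ] En n).det * (B.symm : En n →L[ℝ] En n).det = τ :=
    mul_right_cancel₀ hdA (hBd.trans hdet.symm)
  obtain ⟨θ, hθ, hθ0, hθn, hθd, hθs, M, hM⟩ := exists_timeChange hf₂c hc hf₂ hf₂per hf₂avg
  have hf₂p : ∀ t ≤ 0, 0 < f₂ t := fun t ht => hc.trans_le (hf₂ t ht)
  have hsol := h.sol_transform hconv hw hf₁ hf₂p hf₂c heq hτ hθ hθn hθd hB.inv hSd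
  obtain ⟨K, hK0, hK⟩ := exists_abs_transform_le hκ0 hC hg hτ hθn hM hBA
  have ha := asymp_of_rpow_le hκ0 hκ hK0 hK
  have hpert := abs_pert_le_of_rpow_le hκ0 hK0 hK
  obtain ⟨ν, d, hav⟩ := averaged_of_period hf₁c hf₁ hΛ hf₁per hf₁avg B
  have hθn' : ∀ s < 0, θ (s / τ) < 0 := fun s hs => hθn _ (div_neg_of_neg_of_pos hs hτ)
  have hwle : ∀ y, ∀ s < 0, -timeDeriv u (B.symm y) (θ (s / τ)) / (τ * f₂ (θ (s / τ))) ≤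
      m₂ / (τ * c) := fun y s hs => by
    have hle := (hθn' s hs).le
    exact div_le_div₀ ((hw 0 0 le_rfl).le.trans (hw₂ 0 0 le_rfl)) (hw₂ _ _ hle) (by positivity)
      (mul_le_mul_of_nonneg_left (hf₂ _ hle) hτ.le)
  have hF : ∀ y, f₁ (B.symm y) ≤ Λ := fun y => hΛ _
  have htime := fun y s hs => hsol.eq_sub_time hwle hF hav.ballMass ha y (t := s) hs
  have hell := hsol.ell hwle hF hav.ballMass ha
  have hgradt : ∀ y, ∀ s < 0, spaceGrad u (B.symm y) (θ (s / τ)) =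
      spaceGrad u (B.symm y) (θ (-1 / τ)) := fun y s hs => by
    have h1 := hsol.grad s hs y
    have h2 := hell.grad y
    rw [hasGradientAt_iff_hasFDerivAt] at h1 h2
    have h3 := (h2.sub_const s).congr_of_eventuallyEq
      (Filter.Eventually.of_forall fun z => htime z s hs)
    have h4 := (InnerProductSpace.toDual ℝ (En n)).injective (h1.unique h3)
    exact B.symm.injective h4
  have hneg : ∀ x, ∀ t < 0, spaceGrad u x t = spaceGrad u x (θ (-1 / τ)) := fun x t ht => by
    obtain ⟨s, hs, rfl⟩ := hθs t ht
    have := hgradt (B x) (s * τ) (mul_neg_of_neg_of_pos hs hτ)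
    rwa [B.symm_apply_apply, mul_div_cancel_right₀ _ hτ.ne'] at this
  have hneg' : ∀ x, ∀ t < 0, spaceGrad u x t = spaceGrad u x (-1) := fun x t ht => by
    rw [hneg x t ht, hneg x (-1) (by norm_num)]
  refine ⟨fun x t ht => ?_, fun x i => ?_⟩
  · rcases ht.lt_or_eq with ht | rfl
    · exact hneg' x t ht
    · have h1 : ContinuousWithinAt (fun t => spaceGrad u x t) (Iic 0) 0 :=
        (h.continuousOn_spaceGrad (x, 0) ⟨mem_univ _, mem_Iic.mpr le_rfl⟩).comp
          (f := fun t => (x, t)) (by fun_prop) (fun t ht => ⟨mem_univ _, ht⟩)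
      have h2 : Filter.Tendsto (fun t => spaceGrad u x t) (nhdsWithin 0 (Iio 0))
          (nhds (spaceGrad u x 0)) := h1.mono Iio_subset_Iic_self
      refine tendsto_nhds_unique h2 (tendsto_const_nhds.congr' ?_)
      filter_upwards [self_mem_nhdsWithin] with t ht
      exact (hneg' x t ht).symm
  · set b : Fin n → En n := fun i => B (EuclideanSpace.single i 1) with hb
    set D := ∑ i, ‖b i‖ with hD
    have hbD : ∀ i, ‖b i‖ ≤ D := fun i =>
      Finset.single_le_sum (f := fun i => ‖b i‖) (fun i _ => norm_nonneg _) (Finset.mem_univ i)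
    have hper : ∀ i y, f₁ (B.symm (y + b i)) = f₁ (B.symm y) := fun i y => by
      rw [map_add, hb, B.symm_apply_apply, hf₁per]
    have h1 := hell.add_period hav hper hbD (Finset.sum_nonneg fun i _ => norm_nonneg _)
      (Cb := ‖(B.symm : En n →L[ℝ] En n)‖ * n + 1) (by positivity)
      (norm_le_of_abs_inner_le hn hB) hκ0 hκ
      (by positivity) hpert i (B x)
    rw [map_add, hb] at h1
    simp only [ContinuousLinearEquiv.symm_apply_apply] at h1
    have h2 := congrArg B h1
    rw [map_add, B.apply_symm_apply, B.apply_symm_apply, hBB] at h2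
    rwa [hneg _ (-1) (by norm_num), hneg x (-1) (by norm_num)]

end Gradient

section Rescaling

variable {n : ℕ} {u : En n → ℝ → ℝ} {A : Matrix (Fin n) (Fin n) ℝ}

theorem quadForm_smul (l : ℝ) (x : En n) : quadForm A (l • x) = l ^ 2 * quadForm A x := by
  unfold quadForm
  simp only [Finset.mul_sum]
  refine Finset.sum_congr rfl fun i _ => Finset.sum_congr rfl fun j _ => ?_
  simp only [PiLp.smul_apply, smul_eq_mul]
  ring

theorem mApply_smul (l : ℝ) (x : En n) : mApply A (l • x) = l • mApply A x :=
  map_smul (Matrix.toEuclideanCLM (𝕜 := ℝ) A) l x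

theorem mApply_add (x y : En n) : mApply A (x + y) = mApply A x + mApply A y :=
  map_add (Matrix.toEuclideanCLM (𝕜 := ℝ) A) x y

theorem tendstoUniformlyOn_rescaling {τ C κ : ℝ} (hκ0 : 0 ≤ κ) (hκ : κ < 1) (hC : 0 ≤ C)
    (hg : ∀ (x : En n) (t : ℝ), t ≤ 0 →
      |u x t - ((1/2) * quadForm A x - τ * t)| ≤ C * (1 + ‖x‖^2 - t) ^ κ)
    {K : Set (En n × ℝ)} (hK : IsCompact K) (hKs : K ⊆ halfSpace n) :
    TendstoUniformlyOn
      (fun (l : ℝ) (p : En n × ℝ) => (l^2)⁻¹ * u (l • p.1) (l^2 * p.2))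
      (fun p : En n × ℝ => -τ * p.2 + (1/2) * quadForm A p.1) Filter.atTop K := by
  obtain ⟨M, hM⟩ := hK.exists_bound_of_continuousOn
    (f := fun p : En n × ℝ => ‖p.1‖ ^ 2 - p.2) (by fun_prop)
  rw [Metric.tendstoUniformlyOn_iff]
  intro ε hε
  set N := 1 + |M| with hN
  have hN1 : 1 ≤ N := by linarith [abs_nonneg M]
  obtain ⟨r₀, hr₀, hr⟩ := exists_rpow_le hκ (show 0 < ε / (C * N + 1) by positivity)
  filter_upwards [Filter.eventually_ge_atTop r₀] with l hl p hp
  have hl1 : 1 ≤ l := hr₀.trans hl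
  have hl2 : l ≤ l ^ 2 := by rw [sq]; exact le_mul_of_one_le_left (by linarith) hl1
  have hl0 : 0 < l ^ 2 := by linarith
  have ht : p.2 ≤ 0 := (hKs hp).2
  have h1 := hg (l • p.1) (l ^ 2 * p.2) (mul_nonpos_of_nonneg_of_nonpos hl0.le ht)
  have hpM : ‖p.1‖ ^ 2 - p.2 ≤ |M| := ((le_abs_self _).trans (hM p hp)).trans (le_abs_self M)
  have hp0 : 0 ≤ ‖p.1‖ ^ 2 - p.2 := by linarith [sq_nonneg ‖p.1‖]
  have h2 : 1 + ‖l • p.1‖ ^ 2 - l ^ 2 * p.2 = 1 + l ^ 2 * (‖p.1‖ ^ 2 - p.2) := by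
    rw [norm_smul, mul_pow, Real.norm_eq_abs, sq_abs]; ring
  have h3 : (1 + ‖l • p.1‖ ^ 2 - l ^ 2 * p.2) ^ κ ≤ (l ^ 2 * N) ^ κ := by
    rw [h2]
    refine Real.rpow_le_rpow (by positivity) ?_ hκ0
    have := mul_le_mul_of_nonneg_left hpM hl0.le
    rw [hN]
    linarith
  have h4 := hr (l ^ 2 * N) (by
    calc r₀ ≤ l ^ 2 * 1 := by linarith
      _ ≤ l ^ 2 * N := by gcongr)
  have h5 : (-τ * p.2 + 1 / 2 * quadForm A p.1) - (l ^ 2)⁻¹ * u (l • p.1) (l ^ 2 * p.2) =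
      -((l ^ 2)⁻¹ *
        (u (l • p.1) (l ^ 2 * p.2) - (1 / 2 * quadForm A (l • p.1) - τ * (l ^ 2 * p.2)))) := by
    rw [quadForm_smul]
    field_simp
    ring
  rw [Real.dist_eq, h5, abs_neg, abs_mul, abs_of_pos (inv_pos.mpr hl0)]
  calc (l ^ 2)⁻¹ * _ ≤ (l ^ 2)⁻¹ * (C * (ε / (C * N + 1) * (l ^ 2 * N))) := by
        refine mul_le_mul_of_nonneg_left (h1.trans ?_) (inv_pos.mpr hl0).le
        exact mul_le_mul_of_nonneg_left (h3.trans h4) hC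
    _ = ε * (C * N / (C * N + 1)) := by field_simp
    _ < ε * 1 := by
        refine mul_lt_mul_of_pos_left ?_ hε
        rw [div_lt_one (by positivity)]
        linarith
    _ = ε := mul_one ε

theorem IsC2kOn.spaceGrad_rescaling (h : IsC2kOn 1 u (halfSpace n)) {l : ℝ} (hl : 0 < l) (x : En n)
    {t : ℝ} (ht : t ≤ 0) :
    spaceGrad (fun y s => (l ^ 2)⁻¹ * u (l • y) (l ^ 2 * s)) x t =
      l⁻¹ • spaceGrad u (l • x) (l ^ 2 * t) := by
  have h1 := hasGradientAt_iff_hasFDerivAt.mp (h.hasGradientAt (l • x)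
    (mul_nonpos_of_nonneg_of_nonpos (sq_nonneg l) ht))
  have h2 := (h1.comp x ((hasFDerivAt_id x).const_smul l)).const_mul ((l ^ 2)⁻¹)
  refine HasGradientAt.gradient (hasGradientAt_iff_hasFDerivAt.mpr (h2.congr_fderiv ?_))
  ext v
  simp
  field_simp

theorem exists_bounds_of_add_period {G : En n → En n} {G' : En n → En n →L[ℝ] En n}
    (hG : ∀ x, HasFDerivAt G (G' x) x) (hG' : Continuous G')
    (hper : ∀ x (i : Fin n), G (x + EuclideanSpace.single i 1) =
      G x + mApply A (EuclideanSpace.single i 1)) :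
    ∃ C L : ℝ, (∀ x, ‖G x - mApply A x‖ ≤ C) ∧
      ∀ x y, ‖(G x - mApply A x) - (G y - mApply A y)‖ ≤ L * ‖x - y‖ := by
  set T : En n →L[ℝ] En n := Matrix.toEuclideanCLM (𝕜 := ℝ) A with hT
  have hd : ∀ x, HasFDerivAt (fun x => G x - mApply A x) (G' x - T) x := fun x =>
    (hG x).sub T.hasFDerivAt
  have hVper : ∀ x (i : Fin n), G (x + EuclideanSpace.single i 1) -
      mApply A (x + EuclideanSpace.single i 1) = G x - mApply A x := fun x i => by
    rw [hper, mApply_add]; abel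
  have hdper : ∀ x (i : Fin n), G' (x + EuclideanSpace.single i 1) - T = G' x - T := fun x i => by
    have h1 := (hd (x + EuclideanSpace.single i 1)).comp x
      ((hasFDerivAt_id x).add_const (EuclideanSpace.single i 1))
    rw [ContinuousLinearMap.comp_id] at h1
    replace h1 := h1.congr_of_eventuallyEq (Filter.Eventually.of_forall fun y => (hVper y i).symm)
    exact h1.unique (hd x)
  obtain ⟨C, hC⟩ := exists_norm_le_of_period (q := fun x => G x - mApply A x)
    (continuous_iff_continuousAt.mpr fun x => (hd x).continuousAt) hVper
  obtain ⟨L, hL⟩ := exists_norm_le_of_period (q := fun x => G' x - T)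
    (hG'.sub continuous_const) hdper
  refine ⟨C, L, hC, fun x y => ?_⟩
  exact convex_univ.norm_image_sub_le_of_norm_hasFDerivWithin_le
    (fun z _ => (hd z).hasFDerivWithinAt) (fun z _ => hL z) (mem_univ y) (mem_univ x)

theorem norm_fst_sub_le_pdist (p q : En n × ℝ) : ‖p.1 - q.1‖ ≤ pdist p q :=
  Real.le_sqrt_of_sq_le (by linarith [abs_nonneg (p.2 - q.2)])

theorem le_rpow_mul_rpow {a b c β : ℝ} (ha : 0 ≤ a) (hb : a ≤ b) (hc : a ≤ c) (h0 : 0 < β)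
    (h1 : β < 1) : a ≤ b ^ (1 - β) * c ^ β :=
  calc a = a ^ (1 - β) * a ^ β := by
        rw [← Real.rpow_add_of_nonneg ha (by linarith) h0.le]; simp
    _ ≤ b ^ (1 - β) * c ^ β :=
      mul_le_mul (Real.rpow_le_rpow ha hb (by linarith)) (Real.rpow_le_rpow ha hc h0.le)
        (Real.rpow_nonneg ha _) (Real.rpow_nonneg (ha.trans hb) _)

/-- Convergence of the gradients of the rescalings in parabolic Hölder norms. -/
theorem IsC2kOn.eventually_spaceGrad_rescaling (h : IsC2kOn 1 u (halfSpace n))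
    (ht : ∀ x, ∀ t ≤ 0, spaceGrad u x t = spaceGrad u x (-1))
    (hper : ∀ x (i : Fin n), spaceGrad u (x + EuclideanSpace.single i 1) (-1) =
        spaceGrad u x (-1) + mApply A (EuclideanSpace.single i 1)) {β δ : ℝ} (hβ0 : 0 < β)
    (hβ1 : β < 1) (hδ : 0 < δ) :
    ∀ᶠ l : ℝ in Filter.atTop,
      (∀ p ∈ halfSpace n, ‖spaceGrad (fun y s => (l ^ 2)⁻¹ * u (l • y) (l ^ 2 * s)) p.1 p.2
        - mApply A p.1‖ ≤ δ) ∧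
      ∀ p ∈ halfSpace n, ∀ q ∈ halfSpace n,
        ‖(spaceGrad (fun y s => (l ^ 2)⁻¹ * u (l • y) (l ^ 2 * s)) p.1 p.2 - mApply A p.1)
          - (spaceGrad (fun y s => (l ^ 2)⁻¹ * u (l • y) (l ^ 2 * s)) q.1 q.2 - mApply A q.1)‖
          ≤ δ * pdist p q ^ β := by
  have h1 : (-1:ℝ) ≤ 0 := by norm_num
  obtain ⟨C, L, hC, hL⟩ := exists_bounds_of_add_period
    (fun x => h.hasFDerivAt_spaceGrad x h1)
    (h.continuousOn_hessOp.comp_continuous (f := fun x => (x, (-1:ℝ))) (by fun_prop)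
      fun x => ⟨mem_univ _, h1⟩) hper
  have hC0 : 0 ≤ C := (norm_nonneg _).trans (hC 0)
  have hlim1 : Filter.Tendsto (fun l : ℝ => C / l) Filter.atTop (nhds 0) :=
    tendsto_const_nhds.div_atTop Filter.tendsto_id
  have hlim2 : Filter.Tendsto (fun l : ℝ => (2 * C / l) ^ (1 - β) * |L| ^ β) Filter.atTop
      (nhds 0) := by
    have h2 : Filter.Tendsto (fun l : ℝ => 2 * C / l) Filter.atTop (nhds 0) :=
      tendsto_const_nhds.div_atTop Filter.tendsto_id
    have h3 := (h2.rpow_const (p := 1 - β) (Or.inr (by linarith))).mul_const (|L| ^ β)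
    rwa [Real.zero_rpow (by linarith), zero_mul] at h3
  filter_upwards [hlim1.eventually_le_const hδ, hlim2.eventually_le_const hδ,
    Filter.eventually_gt_atTop 0] with l hl1 hl2 hl
  have hrep : ∀ p ∈ halfSpace n,
      spaceGrad (fun y s => (l ^ 2)⁻¹ * u (l • y) (l ^ 2 * s)) p.1 p.2 - mApply A p.1 =
        l⁻¹ • (spaceGrad u (l • p.1) (-1) - mApply A (l • p.1)) := fun p hp => by
    rw [h.spaceGrad_rescaling hl p.1 hp.2, ht _ _ (mul_nonpos_of_nonneg_of_nonpos (sq_nonneg l) hp.2),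
      mApply_smul, smul_sub, inv_smul_smul₀ hl.ne']
  have hli : ‖l⁻¹‖ = l⁻¹ := by rw [Real.norm_eq_abs, abs_of_pos (inv_pos.mpr hl)]
  refine ⟨fun p hp => ?_, fun p hp q hq => ?_⟩
  · rw [hrep p hp, norm_smul, hli]
    refine le_trans ?_ hl1
    rw [div_eq_inv_mul]
    exact mul_le_mul_of_nonneg_left (hC _) (inv_pos.mpr hl).le
  · rw [hrep p hp, hrep q hq, ← smul_sub, norm_smul, hli]
    have hpd : 0 ≤ pdist p q := Real.sqrt_nonneg _
    have hb : l⁻¹ * ‖(spaceGrad u (l • p.1) (-1) - mApply A (l • p.1)) -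
        (spaceGrad u (l • q.1) (-1) - mApply A (l • q.1))‖ ≤ 2 * C / l := by
      rw [div_eq_inv_mul]
      refine mul_le_mul_of_nonneg_left ((norm_sub_le _ _).trans ?_) (inv_pos.mpr hl).le
      linarith [hC (l • p.1), hC (l • q.1)]
    have hc : l⁻¹ * ‖(spaceGrad u (l • p.1) (-1) - mApply A (l • p.1)) -
        (spaceGrad u (l • q.1) (-1) - mApply A (l • q.1))‖ ≤ |L| * pdist p q := by
      have h2 := hL (l • p.1) (l • q.1)
      rw [← smul_sub, norm_smul, Real.norm_eq_abs, abs_of_pos hl] at h2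
      calc _ ≤ l⁻¹ * (L * (l * ‖p.1 - q.1‖)) := mul_le_mul_of_nonneg_left h2 (inv_pos.mpr hl).le
        _ = L * ‖p.1 - q.1‖ := by field_simp
        _ ≤ |L| * pdist p q :=
          mul_le_mul (le_abs_self L) (norm_fst_sub_le_pdist p q) (norm_nonneg _) (abs_nonneg L)
    refine (le_rpow_mul_rpow (by positivity) hb hc hβ0 hβ1).trans ?_
    rw [Real.mul_rpow (abs_nonneg L) hpd, ← mul_assoc]
    exact mul_le_mul_of_nonneg_right hl2 (Real.rpow_nonneg hpd _)

end Rescaling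
end PMA

/-- convergence of the parabolic rescalings `u^λ` to the quadratic polynomial `Q`, and local parabolic-Hölder convergence of the spatial gradients along a subsequence. -/
theorem stmt15
    (n : ℕ) (hn : 1 ≤ n) (α : ℝ) (hα : α ∈ Set.Ioo (0:ℝ) 1)
    (f₁ : En n → ℝ) (f₂ : ℝ → ℝ)
    (hf₁pos : ∀ x, 0 < f₁ x) (hf₂pos : ∀ t : ℝ, t ≤ 0 → 0 < f₂ t)
    (hf₁hold : ∃ K : NNReal, HolderWith K α.toNNReal f₁)
    (hf₂hold : ∃ K : NNReal, HolderOnWith K (α/2).toNNReal f₂ (Set.Iic 0))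
    (hf₁per : ∀ (x : En n) (i : Fin n), f₁ (x + EuclideanSpace.single i 1) = f₁ x)
    (hf₂per : ∀ t : ℝ, t ≤ 0 → f₂ (t - 1) = f₂ t)
    (hf₁avg : ∫ x in {x : En n | ∀ i, x i ∈ Set.Icc (0:ℝ) 1}, f₁ x = 1)
    (hf₂avg : ∫ t in Set.Icc (-1:ℝ) 0, f₂ t = 1)
    (lam Λ : ℝ) (hlam : 0 < lam)
    (hfbdd : ∀ (x : En n) (t : ℝ), t ≤ 0 → lam ≤ f₁ x * f₂ t ∧ f₁ x * f₂ t ≤ Λ)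
    (u : En n → ℝ → ℝ)
    (hureg : PMA.IsC2kOn 1 u (PMA.halfSpace n))
    (huconv : PMA.ParabolicallyConvexOn (PMA.halfSpace n) u)
    (m₁ m₂ : ℝ) (hm₁ : 0 < m₁) (hm₂ : 0 < m₂)
    (hut : ∀ (x : En n) (t : ℝ), t ≤ 0 →
      m₁ ≤ -PMA.timeDeriv u x t ∧ -PMA.timeDeriv u x t ≤ m₂)
    (heq : ∀ (x : En n) (t : ℝ), t ≤ 0 →
      -PMA.timeDeriv u x t * (PMA.spaceHess u x t).det = f₁ x * f₂ t)
    (hu0 : u 0 0 = 0) (hDu0 : PMA.spaceGrad u 0 0 = 0)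
    (τ : ℝ) (hτ : τ ∈ Set.Icc m₁ m₂)
    (A : Matrix (Fin n) (Fin n) ℝ) (hAsymm : A.IsSymm) (hApos : A.PosDef)
    (hdetA : τ * A.det = 1)
    (ε C₀ : ℝ) (hε : ε ∈ Set.Ioo (0:ℝ) 1) (hC₀ : 0 < C₀)
    (hasym : ∀ (x : En n) (t : ℝ), t ≤ 0 → C₀ ≤ ‖x‖^2 - t →
      |u x t - ((1/2) * PMA.quadForm A x - τ * t)| ≤ C₀ * (‖x‖^2 - t) ^ ((4-ε)/4))
    :
    (∀ K : Set (En n × ℝ), IsCompact K → K ⊆ PMA.halfSpace n →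
      TendstoUniformlyOn
        (fun (l : ℝ) (p : En n × ℝ) => (l^2)⁻¹ * u (l • p.1) (l^2 * p.2))
        (fun p : En n × ℝ => -τ * p.2 + (1/2) * PMA.quadForm A p.1)
        Filter.atTop K) ∧
    (∀ α' : ℝ, α' ∈ Set.Ioo (0:ℝ) 1 →
      ∃ lamseq : ℕ → ℝ, Filter.Tendsto lamseq Filter.atTop Filter.atTop ∧
        ∀ K : Set (En n × ℝ), IsCompact K → K ⊆ PMA.halfSpace n →
        ∀ δ : ℝ, 0 < δ → ∀ᶠ j in Filter.atTop,
          (∀ p ∈ K,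
            ‖PMA.spaceGrad
                (fun y s => ((lamseq j)^2)⁻¹ * u (lamseq j • y) ((lamseq j)^2 * s)) p.1 p.2
              - PMA.mApply A p.1‖ ≤ δ) ∧
          (∀ p ∈ K, ∀ q ∈ K,
            ‖(PMA.spaceGrad
                (fun y s => ((lamseq j)^2)⁻¹ * u (lamseq j • y) ((lamseq j)^2 * s)) p.1 p.2
                - PMA.mApply A p.1)
              - (PMA.spaceGrad
                (fun y s => ((lamseq j)^2)⁻¹ * u (lamseq j • y) ((lamseq j)^2 * s)) q.1 q.2
                - PMA.mApply A q.1)‖ ≤ δ * (PMA.pdist p q) ^ α')) := by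
  obtain ⟨K₁, hK₁⟩ := hf₁hold
  obtain ⟨K₂, hK₂⟩ := hf₂hold
  have hf₁c : Continuous f₁ := hK₁.continuous (Real.toNNReal_pos.mpr hα.1)
  have hf₂c : ContinuousOn f₂ (Iic 0) :=
    hK₂.continuousOn (Real.toNNReal_pos.mpr (half_pos hα.1))
  have hf₂0 := hf₂pos 0 le_rfl
  have hκ0 : 0 ≤ (4 - ε) / 4 := by linarith [hε.2]
  have hκ1 : (4 - ε) / 4 < 1 := by linarith [hε.1]
  obtain ⟨C, hC, hg⟩ := hureg.exists_abs_sub_le hκ0 hC₀ hasym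
  obtain ⟨ht, hper⟩ := hureg.gradient_structure hn huconv
    (fun x t ht => hm₁.trans_le (hut x t ht).1) (fun x t ht => (hut x t ht).2) hf₁pos hf₁c hf₂c
    (c := lam / f₁ 0) (Λ := Λ / f₂ 0) (div_pos hlam (hf₁pos 0))
    (fun t ht => (div_le_iff₀' (hf₁pos 0)).mpr (hfbdd 0 t ht).1)
    (fun x => (le_div_iff₀ hf₂0).mpr (hfbdd x 0 le_rfl).2) heq hf₁per hf₂per hf₁avg hf₂avg
    (hm₁.trans_le hτ.1) hAsymm hApos hdetA hκ0 hκ1 hC hg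
  refine ⟨fun K hK hKs => PMA.tendstoUniformlyOn_rescaling hκ0 hκ1 hC hg hK hKs,
    fun α' hα' => ⟨fun j => j, tendsto_natCast_atTop_atTop, fun K _ hKs δ hδ => ?_⟩⟩
  have h := tendsto_natCast_atTop_atTop.eventually
    (hureg.eventually_spaceGrad_rescaling ht hper hα'.1 hα'.2 hδ)
  filter_upwards [h] with j hj
  exact ⟨fun p hp => hj.1 p (hKs hp), fun p hp q hq => hj.2 p (hKs hp) q (hKs hq)⟩
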